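/- Let N ≥ 2 and 1 < p_− < p_+ < ∞. Then there exist a constant ϰ₀ > 0 depending only on p_−, p_+ and N, a continuous exponent p : ℝ^N → [p_−, p_+] with |p(x) − p(y)| ≤ ϰ₀·(log(1/|x−y|))^{−1}·log log(1/|x−y|) for 0 < |x−y| ≤ e^{−e}, a compact Lebesgue-null set S ⊂ Ω with p smooth on ℝ^N∖S, and a bounded function w : Ω → ℝ, smooth on Ω∖S, with weak gradient g ∈ L¹(Ω;ℝ^N) and ∫_Ω |g(x)|^{p(x)} dx < ∞, such that there is no sequence (φ_j) of C^∞ functions on Ω with ∫_Ω |∇φ_j(x)|^{p(x)} dx < ∞ for every j, φ_j → w in L¹(Ω), and ∫_Ω (λ|∇φ_j(x) − g(x)|)^{p(x)} dx → 0 as j → ∞ for every λ > 0. (This is the 0-form non-density statement of Theorem C.) -/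

import Mathlib

open MeasureTheory Real Filter
open scoped Topology ENNReal

noncomputable section

/-- `ℝ^N` with the Euclidean structure. -/
abbrev Euc (N : ℕ) := EuclideanSpace ℝ (Fin N)

/-- The open ball of radius `√N` centered at the origin. -/
def Omg (N : ℕ) : Set (Euc N) := Metric.ball 0 (Real.sqrt N)

/-- A smooth function compactly supported in `Ω`. -/
def IsTestFun (N : ℕ) (φ : Euc N → ℝ) : Prop :=
  ContDiff ℝ (⊤ : ℕ∞) φ ∧ HasCompactSupport φ ∧ tsupport φ ⊆ Omg N

/-- `w` is locally integrable on `Ω` and has weak gradient `g ∈ L¹(Ω;ℝ^N)`. -/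
def HasWeakGradOn (N : ℕ) (w : Euc N → ℝ) (g : Euc N → Euc N) : Prop :=
  LocallyIntegrableOn w (Omg N) ∧ IntegrableOn g (Omg N) ∧
  ∀ φ : Euc N → ℝ, IsTestFun N φ → ∀ i : Fin N,
    (∫ x in Omg N, w x * fderiv ℝ φ x (EuclideanSpace.single i 1))
      = - ∫ x in Omg N, g x i * φ x

/-- The smooth decreasing function equal to `1` for `q ≤ a` and to `0` for `q ≥ b`. -/
def cutoff (a b q : ℝ) : ℝ := smoothTransition ((b - q) / (b - a))

lemma cutoff_contDiff (a b : ℝ) : ContDiff ℝ (⊤ : ℕ∞) (cutoff a b) := by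
  unfold cutoff
  exact smoothTransition.contDiff.comp ((contDiff_const.sub contDiff_id).div_const _)

lemma cutoff_nonneg (a b q : ℝ) : 0 ≤ cutoff a b q := smoothTransition.nonneg _

lemma cutoff_le_one (a b q : ℝ) : cutoff a b q ≤ 1 := smoothTransition.le_one _

lemma cutoff_eq_one {a b q : ℝ} (hab : a < b) (h : q ≤ a) : cutoff a b q = 1 :=
  smoothTransition.one_of_one_le (by rw [le_div_iff₀ (by linarith)]; linarith)

lemma cutoff_eq_zero {a b q : ℝ} (hab : a < b) (h : b ≤ q) : cutoff a b q = 0 :=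
  smoothTransition.zero_of_nonpos (div_nonpos_of_nonpos_of_nonneg (by linarith) (by linarith))

lemma cutoff_ne_zero_iff {a b q : ℝ} (hab : a < b) : cutoff a b q ≠ 0 ↔ q < b := by
  unfold cutoff
  rw [Ne, smoothTransition.zero_iff_nonpos, not_le]
  constructor
  · intro h
    by_contra! hc
    exact absurd h (not_lt.2 (div_nonpos_of_nonpos_of_nonneg (by linarith) (by linarith)))
  · intro h
    exact div_pos (by linarith) (by linarith)

lemma cutoff_antitone {a b : ℝ} (hab : a < b) : Antitone (cutoff a b) := fun x y h =>
  smoothTransition.monotone (div_le_div_of_nonneg_right (by linarith) (by linarith))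

lemma deriv_eq_zero_of_forall_le {f : ℝ → ℝ} {x : ℝ} (h : ∀ y, f y ≤ f x) : deriv f x = 0 :=
  IsLocalMax.deriv_eq_zero (Eventually.of_forall h)

lemma deriv_eq_zero_of_forall_ge {f : ℝ → ℝ} {x : ℝ} (h : ∀ y, f x ≤ f y) : deriv f x = 0 :=
  IsLocalMin.deriv_eq_zero (Eventually.of_forall h)

lemma deriv_smoothTransition_of_nonpos {x : ℝ} (h : x ≤ 0) : deriv smoothTransition x = 0 :=
  deriv_eq_zero_of_forall_ge fun y => by
    rw [smoothTransition.zero_of_nonpos h]; exact smoothTransition.nonneg _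

lemma deriv_smoothTransition_of_one_le {x : ℝ} (h : 1 ≤ x) : deriv smoothTransition x = 0 :=
  deriv_eq_zero_of_forall_le fun y => by
    rw [smoothTransition.one_of_one_le h]; exact smoothTransition.le_one _

lemma smoothTransition_hasDerivAt (x : ℝ) :
    HasDerivAt smoothTransition (deriv smoothTransition x) x :=
  ((smoothTransition.contDiff (n := 1)).differentiable (by simp) x).hasDerivAt

/-- A `C¹` function whose derivative vanishes off an interval has bounded derivative. -/
lemma exists_abs_deriv_le {f : ℝ → ℝ} (hf : ContDiff ℝ 1 f) {a b : ℝ}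
    (h : ∀ x, x ∉ Set.Icc a b → deriv f x = 0) : ∃ C, 0 ≤ C ∧ ∀ x, |deriv f x| ≤ C := by
  obtain ⟨C, hC⟩ := isCompact_Icc.exists_bound_of_continuousOn (s := Set.Icc a b)
    ((hf.continuous_deriv le_rfl).continuousOn)
  refine ⟨max C 0, le_max_right _ _, fun x => ?_⟩
  by_cases hx : x ∈ Set.Icc a b
  · exact (hC x hx).trans (le_max_left _ _)
  · rw [h x hx, abs_zero]; exact le_max_right _ _

lemma exists_abs_deriv_smoothTransition_le :
    ∃ C, 0 ≤ C ∧ ∀ x, |deriv smoothTransition x| ≤ C :=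
  exists_abs_deriv_le smoothTransition.contDiff (a := 0) (b := 1) fun x hx => by
    rw [Set.mem_Icc, not_and_or, not_le, not_le] at hx
    rcases hx with hx | hx
    · exact deriv_smoothTransition_of_nonpos hx.le
    · exact deriv_smoothTransition_of_one_le hx.le

/-! ### Smooth approximations of a self-similar Cantor set and of its Cantor function -/

/-- Smoothed indicator of the `k`-th generation of the Cantor set of ratio `l`. -/
def cantorBump (l : ℝ) : ℕ → ℝ → ℝ
  | 0 => fun t => cutoff ((1 / 8 + l / 4) ^ 2) (1 / 16) (t ^ 2)
  | k + 1 => fun t => cantorBump l k ((t - 1 / 8) / l) + cantorBump l k ((t + 1 / 8) / l)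

/-- Smooth approximation of the Cantor function of the Cantor set of ratio `l`. -/
def stairStep (l : ℝ) : ℕ → ℝ → ℝ
  | 0 => fun t => smoothTransition (2 * t + 1 / 2)
  | k + 1 => fun t => (stairStep l k ((t - 1 / 8) / l) + stairStep l k ((t + 1 / 8) / l)) / 2

section Cantor

variable {l : ℝ}

lemma ratio_sq_lt (h0 : 0 < l) (h1 : l < 1 / 2) : (1 / 8 + l / 4) ^ 2 < (1 / 16 : ℝ) := by
  nlinarith

lemma cantorBump_succ (l : ℝ) (k : ℕ) (t : ℝ) : cantorBump l (k + 1) t =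
    cantorBump l k ((t - 1 / 8) / l) + cantorBump l k ((t + 1 / 8) / l) := rfl

lemma stairStep_succ (l : ℝ) (k : ℕ) (t : ℝ) : stairStep l (k + 1) t =
    (stairStep l k ((t - 1 / 8) / l) + stairStep l k ((t + 1 / 8) / l)) / 2 := rfl

lemma cantorBump_contDiff (k : ℕ) : ContDiff ℝ (⊤ : ℕ∞) (cantorBump l k) := by
  induction k with
  | zero => exact (cutoff_contDiff _ _).comp (contDiff_id.pow 2)
  | succ k ih =>
    exact (ih.comp ((contDiff_id.sub contDiff_const).div_const _)).add
      (ih.comp ((contDiff_id.add contDiff_const).div_const _))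

lemma stairStep_contDiff (k : ℕ) : ContDiff ℝ (⊤ : ℕ∞) (stairStep l k) := by
  induction k with
  | zero =>
    exact smoothTransition.contDiff.comp ((contDiff_const.mul contDiff_id).add contDiff_const)
  | succ k ih =>
    exact ((ih.comp ((contDiff_id.sub contDiff_const).div_const _)).add
      (ih.comp ((contDiff_id.add contDiff_const).div_const _))).div_const _

lemma cantorBump_zero_ne_zero_iff (h0 : 0 < l) (h1 : l < 1 / 2) {t : ℝ} :
    cantorBump l 0 t ≠ 0 ↔ |t| < 1 / 4 := by
  have : (1 / 16 : ℝ) = (1 / 4) ^ 2 := by norm_num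
  rw [cantorBump, cutoff_ne_zero_iff (ratio_sq_lt h0 h1), this, sq_lt_sq, abs_of_pos (a := 1 / 4)]
  norm_num

lemma abs_left_branch {t : ℝ} (h0 : 0 < l) (h1 : l < 1 / 2) (ht : 0 ≤ t) :
    1 / 4 ≤ |(t + 1 / 8) / l| := by
  rw [abs_of_nonneg (by positivity), le_div_iff₀ h0]; linarith

lemma abs_right_branch {t : ℝ} (h0 : 0 < l) (h1 : l < 1 / 2) (ht : t ≤ 0) :
    1 / 4 ≤ |(t - 1 / 8) / l| := by
  rw [abs_div, abs_of_pos h0, le_div_iff₀ h0, abs_of_neg (by linarith)]; linarith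

lemma cantorBump_support (h0 : 0 < l) (h1 : l < 1 / 2) (k : ℕ) {t : ℝ}
    (h : cantorBump l k t ≠ 0) : |t| < 1 / 4 := by
  induction k generalizing t with
  | zero => exact (cantorBump_zero_ne_zero_iff h0 h1).1 h
  | succ k ih =>
    have : cantorBump l k ((t - 1 / 8) / l) ≠ 0 ∨ cantorBump l k ((t + 1 / 8) / l) ≠ 0 := by
      by_contra! hc
      exact h (by rw [cantorBump_succ, hc.1, hc.2, add_zero])
    rcases this with h | h
    all_goals
      have := ih h
      rw [abs_div, abs_of_pos h0, div_lt_iff₀ h0, abs_lt] at this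
      rw [abs_lt]; constructor <;> linarith

lemma cantorBump_eq_zero (h0 : 0 < l) (h1 : l < 1 / 2) (k : ℕ) {t : ℝ}
    (h : 1 / 4 ≤ |t|) : cantorBump l k t = 0 := by
  by_contra hc
  exact absurd (cantorBump_support h0 h1 k hc) (not_lt.2 h)

lemma cantorBump_succ_cases (h0 : 0 < l) (h1 : l < 1 / 2) (t : ℝ) :
    (∀ k, cantorBump l k ((t - 1 / 8) / l) = 0 ∧
      cantorBump l (k + 1) t = cantorBump l k ((t + 1 / 8) / l)) ∨
    (∀ k, cantorBump l k ((t + 1 / 8) / l) = 0 ∧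
      cantorBump l (k + 1) t = cantorBump l k ((t - 1 / 8) / l)) := by
  rcases le_total t 0 with ht | ht
  · left; intro k
    have := cantorBump_eq_zero h0 h1 k (abs_right_branch h0 h1 ht)
    exact ⟨this, by rw [cantorBump_succ, this, zero_add]⟩
  · right; intro k
    have := cantorBump_eq_zero h0 h1 k (abs_left_branch h0 h1 ht)
    exact ⟨this, by rw [cantorBump_succ, this, add_zero]⟩

lemma cantorBump_mem (h0 : 0 < l) (h1 : l < 1 / 2) (k : ℕ) (t : ℝ) :
    0 ≤ cantorBump l k t ∧ cantorBump l k t ≤ 1 := by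
  induction k generalizing t with
  | zero => exact ⟨cutoff_nonneg _ _ _, cutoff_le_one _ _ _⟩
  | succ k ih =>
    rcases cantorBump_succ_cases h0 h1 t with h | h <;> rw [(h k).2] <;> exact ih _

lemma cantorBump_eq_one_of_succ (h0 : 0 < l) (h1 : l < 1 / 2) (k : ℕ) {t : ℝ}
    (h : cantorBump l (k + 1) t ≠ 0) : cantorBump l k t = 1 := by
  induction k generalizing t with
  | zero =>
    refine cutoff_eq_one (ratio_sq_lt h0 h1) ?_
    rw [sq_le_sq, abs_of_pos (a := 1 / 8 + l / 4) (by positivity)]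
    rcases cantorBump_succ_cases h0 h1 t with h' | h' <;> rw [(h' 0).2] at h
    all_goals
      have := cantorBump_support h0 h1 _ h
      rw [abs_div, abs_of_pos h0, div_lt_iff₀ h0, abs_lt] at this
      rw [abs_le]; constructor <;> linarith
  | succ k ih =>
    rcases cantorBump_succ_cases h0 h1 t with h' | h' <;> rw [(h' (k + 1)).2] at h <;>
      rw [(h' k).2] <;> exact ih h

lemma cantorBump_ne_zero_of_le (h0 : 0 < l) (h1 : l < 1 / 2) {m n : ℕ} (hmn : m ≤ n) {t : ℝ}
    (h : cantorBump l n t ≠ 0) : cantorBump l m t ≠ 0 := by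
  induction n, hmn using Nat.le_induction with
  | base => exact h
  | succ n _ ih => exact ih (by rw [cantorBump_eq_one_of_succ h0 h1 n h]; exact one_ne_zero)

lemma deriv_cantorBump_of_eq_zero (h0 : 0 < l) (h1 : l < 1 / 2) (k : ℕ) {t : ℝ}
    (h : cantorBump l k t = 0) : deriv (cantorBump l k) t = 0 :=
  deriv_eq_zero_of_forall_ge fun y => by rw [h]; exact (cantorBump_mem h0 h1 k y).1

lemma deriv_cantorBump_of_eq_one (h0 : 0 < l) (h1 : l < 1 / 2) (k : ℕ) {t : ℝ}
    (h : cantorBump l k t = 1) : deriv (cantorBump l k) t = 0 :=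
  deriv_eq_zero_of_forall_le fun y => by rw [h]; exact (cantorBump_mem h0 h1 k y).2

lemma cantorBump_hasDerivAt (k : ℕ) (t : ℝ) :
    HasDerivAt (cantorBump l k) (deriv (cantorBump l k) t) t :=
  ((cantorBump_contDiff k).differentiable (by simp) t).hasDerivAt

lemma stairStep_hasDerivAt (k : ℕ) (t : ℝ) :
    HasDerivAt (stairStep l k) (deriv (stairStep l k) t) t :=
  ((stairStep_contDiff k).differentiable (by simp) t).hasDerivAt

lemma deriv_cantorBump_succ (k : ℕ) (t : ℝ) :
    deriv (cantorBump l (k + 1)) t = (deriv (cantorBump l k) ((t - 1 / 8) / l) +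
      deriv (cantorBump l k) ((t + 1 / 8) / l)) / l := by
  have h1 := (cantorBump_hasDerivAt (l := l) k ((t - 1 / 8) / l)).comp t
    (((hasDerivAt_id t).sub_const (1 / 8)).div_const l)
  have h2 := (cantorBump_hasDerivAt (l := l) k ((t + 1 / 8) / l)).comp t
    (((hasDerivAt_id t).add_const (1 / 8)).div_const l)
  refine (h1.add h2).deriv.trans ?_
  ring

lemma deriv_stairStep_succ (k : ℕ) (t : ℝ) :
    deriv (stairStep l (k + 1)) t = (deriv (stairStep l k) ((t - 1 / 8) / l) +
      deriv (stairStep l k) ((t + 1 / 8) / l)) / (2 * l) := by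
  have h1 := (stairStep_hasDerivAt (l := l) k ((t - 1 / 8) / l)).comp t
    (((hasDerivAt_id t).sub_const (1 / 8)).div_const l)
  have h2 := (stairStep_hasDerivAt (l := l) k ((t + 1 / 8) / l)).comp t
    (((hasDerivAt_id t).add_const (1 / 8)).div_const l)
  refine ((h1.add h2).div_const 2).deriv.trans ?_
  ring

lemma exists_deriv_cantorBump_le (h0 : 0 < l) (h1 : l < 1 / 2) :
    ∃ C, 0 ≤ C ∧ ∀ k t, |deriv (cantorBump l k) t| ≤ C * (l⁻¹) ^ k := by
  obtain ⟨C, hC0, hC⟩ := exists_abs_deriv_le (f := cantorBump l 0)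
    ((cantorBump_contDiff 0).of_le (by simp)) (a := -1) (b := 1) fun x hx =>
      deriv_cantorBump_of_eq_zero h0 h1 0 (cantorBump_eq_zero h0 h1 0 (by
        by_contra! hc
        rw [abs_lt] at hc
        exact hx ⟨by linarith, by linarith⟩))
  refine ⟨C, hC0, fun k => ?_⟩
  induction k with
  | zero => simpa using hC
  | succ k ih =>
    intro t
    rw [deriv_cantorBump_succ, abs_div, abs_of_pos h0, pow_succ, ← mul_assoc, ← div_eq_mul_inv]
    gcongr
    rcases cantorBump_succ_cases h0 h1 t with h | h <;>
      rw [deriv_cantorBump_of_eq_zero h0 h1 k (h k).1] <;> simpa using ih _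

lemma stairStep_mem (k : ℕ) (t : ℝ) : 0 ≤ stairStep l k t ∧ stairStep l k t ≤ 1 := by
  induction k generalizing t with
  | zero => exact ⟨smoothTransition.nonneg _, smoothTransition.le_one _⟩
  | succ k ih =>
    have a := ih ((t - 1 / 8) / l)
    have b := ih ((t + 1 / 8) / l)
    rw [stairStep_succ]; constructor <;> linarith

lemma deriv_stairStep_nonneg (h0 : 0 < l) (k : ℕ) (t : ℝ) : 0 ≤ deriv (stairStep l k) t := by
  induction k generalizing t with
  | zero =>
    refine Monotone.deriv_nonneg fun x y h => smoothTransition.monotone ?_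
    linarith
  | succ k ih =>
    rw [deriv_stairStep_succ]
    exact div_nonneg (add_nonneg (ih _) (ih _)) (by linarith)

lemma stairStep_of_ge (h0 : 0 < l) (h1 : l < 1 / 2) (k : ℕ) {t : ℝ} (h : 1 / 4 ≤ t) :
    stairStep l k t = 1 := by
  induction k generalizing t with
  | zero => exact smoothTransition.one_of_one_le (by linarith)
  | succ k ih =>
    rw [stairStep_succ, ih, ih]
    · norm_num
    all_goals rw [le_div_iff₀ h0]; linarith

lemma stairStep_of_le (h0 : 0 < l) (h1 : l < 1 / 2) (k : ℕ) {t : ℝ} (h : t ≤ -(1 / 4)) :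
    stairStep l k t = 0 := by
  induction k generalizing t with
  | zero => exact smoothTransition.zero_of_nonpos (by linarith)
  | succ k ih =>
    rw [stairStep_succ, ih, ih]
    · norm_num
    all_goals rw [div_le_iff₀ h0]; linarith

lemma deriv_stairStep_of_eq_zero (h0 : 0 < l) (h1 : l < 1 / 2) (k : ℕ) {t : ℝ}
    (h : cantorBump l k t = 0) : deriv (stairStep l k) t = 0 := by
  induction k generalizing t with
  | zero =>
    by_contra hc
    refine (cantorBump_zero_ne_zero_iff h0 h1).2 ?_ h
    by_contra! hc'
    rcases le_abs.1 hc' with h' | h'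
    · exact hc (deriv_eq_zero_of_forall_le fun y => by
        rw [stairStep_of_ge h0 h1 0 h']; exact (stairStep_mem 0 y).2)
    · exact hc (deriv_eq_zero_of_forall_ge fun y => by
        rw [stairStep_of_le h0 h1 0 (by linarith)]; exact (stairStep_mem 0 y).1)
  | succ k ih =>
    rw [deriv_stairStep_succ]
    rcases cantorBump_succ_cases h0 h1 t with h' | h' <;> rw [(h' k).2] at h <;>
      rw [ih h, ih (h' k).1] <;> simp

lemma exists_deriv_stairStep_le (h0 : 0 < l) (h1 : l < 1 / 2) :
    ∃ C, 0 ≤ C ∧ ∀ k t, |deriv (stairStep l k) t| ≤ C * ((2 * l)⁻¹) ^ k := by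
  obtain ⟨C, hC0, hC⟩ := exists_abs_deriv_le (f := stairStep l 0)
    ((stairStep_contDiff 0).of_le (by simp)) (a := -1) (b := 1) fun x hx =>
      deriv_stairStep_of_eq_zero h0 h1 0 (cantorBump_eq_zero h0 h1 0 (by
        by_contra! hc
        rw [abs_lt] at hc
        exact hx ⟨by linarith, by linarith⟩))
  refine ⟨C, hC0, fun k => ?_⟩
  induction k with
  | zero => simpa using hC
  | succ k ih =>
    intro t
    rw [deriv_stairStep_succ, abs_div, abs_of_pos (a := 2 * l) (by positivity), pow_succ,
      ← mul_assoc, ← div_eq_mul_inv]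
    gcongr
    rcases cantorBump_succ_cases h0 h1 t with h | h <;>
      rw [deriv_stairStep_of_eq_zero h0 h1 k (h k).1] <;> simpa using ih _

lemma stairStep_succ_sub_of_eq_zero (h0 : 0 < l) (h1 : l < 1 / 2) (k : ℕ) {t : ℝ}
    (h : cantorBump l k t = 0) : stairStep l (k + 1) t - stairStep l k t = 0 := by
  induction k generalizing t with
  | zero =>
    have : 1 / 4 ≤ |t| := by
      by_contra! hc
      exact (cantorBump_zero_ne_zero_iff h0 h1).2 hc h
    rcases le_abs.1 this with h' | h'
    · rw [stairStep_of_ge h0 h1 _ h', stairStep_of_ge h0 h1 _ h', sub_self]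
    · have h' : t ≤ -(1 / 4) := by linarith
      rw [stairStep_of_le h0 h1 _ h', stairStep_of_le h0 h1 _ h', sub_self]
  | succ k ih =>
    have : cantorBump l k ((t - 1 / 8) / l) = 0 ∧ cantorBump l k ((t + 1 / 8) / l) = 0 := by
      rcases cantorBump_succ_cases h0 h1 t with h' | h' <;> rw [(h' k).2] at h
      · exact ⟨(h' k).1, h⟩
      · exact ⟨h, (h' k).1⟩
    have a := ih this.1
    have b := ih this.2
    rw [stairStep_succ l (k + 1) t, stairStep_succ l k t]
    linarith

lemma abs_stairStep_succ_sub_le (h0 : 0 < l) (h1 : l < 1 / 2) (k : ℕ) (t : ℝ) :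
    |stairStep l (k + 1) t - stairStep l k t| ≤ (1 / 2) ^ k := by
  induction k generalizing t with
  | zero =>
    have a := stairStep_mem (l := l) 0 t
    have b := stairStep_mem (l := l) 1 t
    rw [pow_zero, abs_le]; constructor <;> linarith
  | succ k ih =>
    have key : stairStep l (k + 2) t - stairStep l (k + 1) t =
        ((stairStep l (k + 1) ((t - 1 / 8) / l) - stairStep l k ((t - 1 / 8) / l)) +
        (stairStep l (k + 1) ((t + 1 / 8) / l) - stairStep l k ((t + 1 / 8) / l))) / 2 := by
      rw [stairStep_succ l (k + 1) t, stairStep_succ l k t]; ring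
    rw [key, abs_div, abs_of_pos (a := (2 : ℝ)) two_pos, pow_succ, ← div_eq_mul_one_div]
    gcongr
    rcases cantorBump_succ_cases h0 h1 t with h | h <;>
      rw [stairStep_succ_sub_of_eq_zero h0 h1 k (h k).1] <;> simpa using ih _

lemma volume_cantorBump_support_le (h0 : 0 < l) (h1 : l < 1 / 2) (k : ℕ) :
    volume {t | cantorBump l k t ≠ 0} ≤ ENNReal.ofReal ((2 * l) ^ k) := by
  induction k with
  | zero =>
    have : {t | cantorBump l 0 t ≠ 0} ⊆ Set.Icc (-(1 / 2)) (1 / 2) := fun t ht => by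
      have := abs_lt.1 (cantorBump_support h0 h1 0 ht)
      exact ⟨by linarith, by linarith⟩
    refine (measure_mono this).trans ?_
    rw [Real.volume_Icc]; norm_num
  | succ k ih =>
    have hs : {t | cantorBump l (k + 1) t ≠ 0} ⊆
        (fun t => t + -(1 / 8)) ⁻¹' ((fun t => l⁻¹ * t) ⁻¹' {t | cantorBump l k t ≠ 0}) ∪
        (fun t => t + 1 / 8) ⁻¹' ((fun t => l⁻¹ * t) ⁻¹' {t | cantorBump l k t ≠ 0}) := by
      intro t ht
      rw [Set.mem_ofPred_eq] at ht
      rcases cantorBump_succ_cases h0 h1 t with h | h <;> rw [(h k).2, div_eq_inv_mul] at ht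
      · right; exact ht
      · left; exact ht
    refine (measure_mono hs).trans ((measure_union_le _ _).trans ?_)
    rw [measure_preimage_add_right, measure_preimage_add_right,
      Real.volume_preimage_mul_left (inv_ne_zero h0.ne'), inv_inv, abs_of_pos h0, ← two_mul]
    calc 2 * (ENNReal.ofReal l * volume {t | cantorBump l k t ≠ 0})
        ≤ 2 * (ENNReal.ofReal l * ENNReal.ofReal ((2 * l) ^ k)) := by gcongr
      _ = ENNReal.ofReal ((2 * l) ^ (k + 1)) := by
        rw [pow_succ, mul_comm ((2 * l) ^ k), ENNReal.ofReal_mul (by positivity),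
          ENNReal.ofReal_mul (by positivity), ENNReal.ofReal_ofNat, mul_assoc]

end Cantor

/-! ### Interpolating a sequence of functions across dyadic-type layers -/

/-- Smooth interpolation: equals (up to a transition) `a k` for `s` in `[k, k + 1)`. -/
def mix (a : ℕ → ℝ → ℝ) (q : ℝ × ℝ) : ℝ :=
  a 0 q.1 + ∑ k ∈ Finset.range ⌈q.2⌉₊, smoothTransition (q.2 - k) * (a (k + 1) q.1 - a k q.1)

lemma mix_eq_sum (a : ℕ → ℝ → ℝ) {q : ℝ × ℝ} {n : ℕ} (h : q.2 ≤ n) : mix a q =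
    a 0 q.1 + ∑ k ∈ Finset.range n, smoothTransition (q.2 - k) * (a (k + 1) q.1 - a k q.1) := by
  unfold mix
  congr 1
  apply Finset.sum_subset
  · exact Finset.range_subset_range.2 (Nat.ceil_le.2 h)
  · intro k _ hk
    have h2 : q.2 ≤ k := by
      have := Nat.le_of_ceil_le (not_lt.1 (fun h' => hk (Finset.mem_range.2 h')))
      exact this
    rw [smoothTransition.zero_of_nonpos (by linarith), zero_mul]

lemma mix_eventuallyEq (a : ℕ → ℝ → ℝ) (q : ℝ × ℝ) {n : ℕ} (h : q.2 < n) : mix a =ᶠ[𝓝 q]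
    fun r => a 0 r.1 +
      ∑ k ∈ Finset.range n, smoothTransition (r.2 - k) * (a (k + 1) r.1 - a k r.1) := by
  filter_upwards [(isOpen_lt continuous_snd continuous_const).mem_nhds h] with r hr
  exact mix_eq_sum a (le_of_lt hr)

lemma mix_contDiff {a : ℕ → ℝ → ℝ} (ha : ∀ k, ContDiff ℝ (⊤ : ℕ∞) (a k)) :
    ContDiff ℝ (⊤ : ℕ∞) (mix a) := by
  rw [contDiff_iff_contDiffAt]
  intro q
  obtain ⟨n, hn⟩ := exists_nat_gt q.2
  refine ContDiffAt.congr_of_eventuallyEq (ContDiff.contDiffAt ?_) (mix_eventuallyEq a q hn)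
  refine ((ha 0).comp contDiff_fst).add (ContDiff.sum fun k _ => ?_)
  exact (smoothTransition.contDiff.comp (contDiff_snd.sub contDiff_const)).mul
    (((ha _).comp contDiff_fst).sub ((ha _).comp contDiff_fst))

lemma sum_floor_telescope (a : ℕ → ℝ) (s : ℝ) :
    a 0 + ∑ k ∈ Finset.range (⌊s⌋₊ + 1), smoothTransition (s - k) * (a (k + 1) - a k) =
      a ⌊s⌋₊ + smoothTransition (s - ⌊s⌋₊) * (a (⌊s⌋₊ + 1) - a ⌊s⌋₊) := by
  have h : ∀ k ∈ Finset.range ⌊s⌋₊,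
      smoothTransition (s - k) * (a (k + 1) - a k) = a (k + 1) - a k := by
    intro k hk
    have h1 : ((k + 1 : ℕ) : ℝ) ≤ s :=
      (Nat.le_floor_iff' (Nat.succ_ne_zero k)).1 (Finset.mem_range.1 hk)
    push_cast at h1
    rw [smoothTransition.one_of_one_le (by linarith), one_mul]
  rw [Finset.sum_range_succ, Finset.sum_congr rfl h, Finset.sum_range_sub]
  ring

lemma mix_eq (a : ℕ → ℝ → ℝ) (t s : ℝ) : mix a (t, s) =
    a ⌊s⌋₊ t + smoothTransition (s - ⌊s⌋₊) * (a (⌊s⌋₊ + 1) t - a ⌊s⌋₊ t) := by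
  have h : (t, s).2 ≤ ((⌊s⌋₊ + 1 : ℕ) : ℝ) := by push_cast; exact (Nat.lt_floor_add_one s).le
  rw [mix_eq_sum a h]
  exact sum_floor_telescope (fun k => a k t) s

lemma mix_hasFDerivAt {a : ℕ → ℝ → ℝ} (ha : ∀ k, ContDiff ℝ (⊤ : ℕ∞) (a k)) (t s : ℝ) :
    HasFDerivAt (mix a)
      ((deriv (a ⌊s⌋₊) t + smoothTransition (s - ⌊s⌋₊) *
          (deriv (a (⌊s⌋₊ + 1)) t - deriv (a ⌊s⌋₊) t)) • ContinuousLinearMap.fst ℝ ℝ ℝ +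
        (deriv smoothTransition (s - ⌊s⌋₊) * (a (⌊s⌋₊ + 1) t - a ⌊s⌋₊ t)) •
          ContinuousLinearMap.snd ℝ ℝ ℝ) (t, s) := by
  have h : (t, s).2 < ((⌊s⌋₊ + 1 : ℕ) : ℝ) := by push_cast; exact Nat.lt_floor_add_one s
  refine HasFDerivAt.congr_of_eventuallyEq ?_ (mix_eventuallyEq a (t, s) h)
  have hd : ∀ k, HasFDerivAt (fun r : ℝ × ℝ => a k r.1)
      (deriv (a k) t • ContinuousLinearMap.fst ℝ ℝ ℝ) (t, s) := fun k => by
    have h1 : HasDerivAt (a k) (deriv (a k) t) t :=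
      ((ha k).differentiable (by simp) t).hasDerivAt
    exact HasDerivAt.comp_hasFDerivAt (t, s) h1 hasFDerivAt_fst
  have hw : ∀ k : ℕ, HasFDerivAt (fun r : ℝ × ℝ => smoothTransition (r.2 - k))
      (deriv smoothTransition (s - k) • ContinuousLinearMap.snd ℝ ℝ ℝ) (t, s) := fun k => by
    have h1 := smoothTransition_hasDerivAt (s - k)
    have h2 : HasFDerivAt (fun r : ℝ × ℝ => r.2 - k) (ContinuousLinearMap.snd ℝ ℝ ℝ) (t, s) :=
      hasFDerivAt_snd.sub_const _
    exact HasDerivAt.comp_hasFDerivAt (t, s) h1 h2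
  have hsum := (hd 0).add (HasFDerivAt.fun_sum (u := Finset.range (⌊s⌋₊ + 1))
    fun k _ => (hw k).mul ((hd (k + 1)).sub (hd k)))
  refine hsum.congr_fderiv ?_
  have h1 := sum_floor_telescope (fun k => deriv (a k) t) s
  have h2 : ∑ k ∈ Finset.range (⌊s⌋₊ + 1), deriv smoothTransition (s - k) *
      (a (k + 1) t - a k t) = deriv smoothTransition (s - ⌊s⌋₊) *
        (a (⌊s⌋₊ + 1) t - a ⌊s⌋₊ t) := by
    rw [Finset.sum_range_succ, Finset.sum_eq_zero, zero_add]
    intro k hk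
    have h1 : ((k + 1 : ℕ) : ℝ) ≤ s :=
      (Nat.le_floor_iff' (Nat.succ_ne_zero k)).1 (Finset.mem_range.1 hk)
    push_cast at h1
    rw [deriv_smoothTransition_of_one_le (by linarith), zero_mul]
  rw [← h1, ← h2]
  ext <;> simp [Finset.sum_add_distrib, mul_comm]

section Lift

lemma coord_contDiff {N : ℕ} (i : Fin N) : ContDiff ℝ (⊤ : ℕ∞) fun x : Euc N => x i :=
  (EuclideanSpace.proj (𝕜 := ℝ) i : Euc N →L[ℝ] ℝ).contDiff

lemma coord_hasFDerivAt {N : ℕ} (i : Fin N) (x : Euc N) :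
    HasFDerivAt (fun x : Euc N => x i) (EuclideanSpace.proj (𝕜 := ℝ) i) x :=
  (EuclideanSpace.proj (𝕜 := ℝ) i : Euc N →L[ℝ] ℝ).hasFDerivAt

variable {N : ℕ} (l : ℝ) (i j : Fin N)

/-- The height coordinate on a logarithmic scale. -/
def logHeight (y : ℝ) : ℝ := log y / log l

/-- The index of the layer containing height `y`. -/
def layerIdx (y : ℝ) : ℕ := ⌊logHeight l y⌋₊

/-- Function on space interpolating the functions `a k` of `x i` over layers of `|x j|`. -/
def lift (a : ℕ → ℝ → ℝ) (x : Euc N) : ℝ := mix a (x i, logHeight l (x j))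

variable {l i j}

lemma pow_layerIdx_lt (h0 : 0 < l) (h1 : l < 1 / 2) {y : ℝ} (hy : y ≠ 0) :
    l ^ (layerIdx l y + 1) < |y| := by
  have hl : log l < 0 := log_neg h0 (by linarith)
  have h := Nat.lt_floor_add_one (logHeight l y)
  rw [← log_lt_log_iff (by positivity) (abs_pos.2 hy), log_pow, log_abs]
  unfold logHeight at h
  rw [div_lt_iff_of_neg hl] at h
  push_cast
  exact h

lemma le_pow_layerIdx (h0 : 0 < l) (h1 : l < 1 / 2) {y : ℝ} (hy : y ≠ 0) (hy1 : |y| ≤ 1) :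
    |y| ≤ l ^ layerIdx l y := by
  have hl : log l < 0 := log_neg h0 (by linarith)
  have hs : 0 ≤ logHeight l y :=
    div_nonneg_of_nonpos (by rw [← log_abs]; exact log_nonpos (abs_nonneg _) hy1) hl.le
  have h := Nat.floor_le hs
  rw [← log_le_log_iff (abs_pos.2 hy) (by positivity), log_pow, log_abs]
  rw [logHeight, le_div_iff_of_neg hl] at h
  exact h

lemma lift_eq (a : ℕ → ℝ → ℝ) (x : Euc N) : ∃ θ : ℝ, 0 ≤ θ ∧ θ ≤ 1 ∧ lift l i j a x =
    a (layerIdx l (x j)) (x i) +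
      θ * (a (layerIdx l (x j) + 1) (x i) - a (layerIdx l (x j)) (x i)) :=
  ⟨_, smoothTransition.nonneg _, smoothTransition.le_one _, mix_eq a _ _⟩

lemma lift_contDiffAt {a : ℕ → ℝ → ℝ} (ha : ∀ k, ContDiff ℝ (⊤ : ℕ∞) (a k)) {x : Euc N}
    (hx : x j ≠ 0) : ContDiffAt ℝ (⊤ : ℕ∞) (lift l i j a) x := by
  exact (mix_contDiff ha).contDiffAt.comp x
    ((coord_contDiff i).contDiffAt.prodMk (((coord_contDiff j).contDiffAt.log hx).div_const _))

lemma lift_hasFDerivAt {a : ℕ → ℝ → ℝ} (ha : ∀ k, ContDiff ℝ (⊤ : ℕ∞) (a k)) {x : Euc N}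
    (hx : x j ≠ 0) : ∃ θ d : ℝ, 0 ≤ θ ∧ θ ≤ 1 ∧ 0 ≤ d ∧
      (∀ C, (∀ s, |deriv smoothTransition s| ≤ C) → d ≤ C) ∧
      HasFDerivAt (lift l i j a)
        ((deriv (a (layerIdx l (x j))) (x i) + θ * (deriv (a (layerIdx l (x j) + 1)) (x i) -
          deriv (a (layerIdx l (x j))) (x i))) • EuclideanSpace.proj i +
        (d * (a (layerIdx l (x j) + 1) (x i) - a (layerIdx l (x j)) (x i)) / (x j * log l)) •
          EuclideanSpace.proj (𝕜 := ℝ) j) x := by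
  refine ⟨smoothTransition (logHeight l (x j) - ⌊logHeight l (x j)⌋₊),
    deriv smoothTransition (logHeight l (x j) - ⌊logHeight l (x j)⌋₊),
    smoothTransition.nonneg _, smoothTransition.le_one _,
    smoothTransition.monotone.deriv_nonneg, fun C hC => (le_abs_self _).trans (hC _), ?_⟩
  have hlog : HasDerivAt (logHeight l) ((x j)⁻¹ / log l) (x j) :=
    (hasDerivAt_log hx).div_const _
  have hlj : HasFDerivAt (fun x : Euc N => logHeight l (x j))
      (((x j)⁻¹ / log l) • EuclideanSpace.proj (𝕜 := ℝ) j) x :=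
    HasDerivAt.comp_hasFDerivAt x (f := fun x : Euc N => x j) hlog (coord_hasFDerivAt j x)
  have hm := (mix_hasFDerivAt ha (x i) (logHeight l (x j))).comp x
    ((coord_hasFDerivAt i x).prodMk hlj)
  refine hm.congr_fderiv ?_
  ext v
  simp only [layerIdx, ContinuousLinearMap.comp_apply, add_apply,
    smul_apply, ContinuousLinearMap.prod_apply, smul_eq_mul,
    ContinuousLinearMap.coe_fst', ContinuousLinearMap.coe_snd']
  field_simp

end Lift

section Layered

variable {N : ℕ} {l : ℝ} {i j : Fin N}

lemma norm_coord_le (i : Fin N) : ‖(EuclideanSpace.proj (𝕜 := ℝ) i : Euc N →L[ℝ] ℝ)‖ ≤ 1 :=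
  ContinuousLinearMap.opNorm_le_bound _ zero_le_one fun x => by
    rw [one_mul]; exact PiLp.norm_apply_le x i

lemma exists_norm_fderiv_lift_le (h0 : 0 < l) (h1 : l < 1 / 2) {a : ℕ → ℝ → ℝ}
    (ha : ∀ k, ContDiff ℝ (⊤ : ℕ∞) (a k)) {Γ C : ℝ} (hΓ : 1 ≤ Γ)
    (hd : ∀ k t, |deriv (a k) t| ≤ C * Γ ^ k)
    (hs : ∀ k t, |a (k + 1) t - a k t| ≤ (Γ * l) ^ k) :
    ∃ C', 0 ≤ C' ∧ ∀ x : Euc N, x j ≠ 0 →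
      ‖fderiv ℝ (lift l i j a) x‖ ≤ C' * Γ ^ layerIdx l (x j) := by
  obtain ⟨D, hD0, hD⟩ := exists_abs_deriv_smoothTransition_le
  have hl : log l < 0 := log_neg h0 (by linarith)
  have hC : 0 ≤ C := by simpa using (abs_nonneg _).trans (hd 0 0)
  refine ⟨C + C * Γ + D / (l * |log l|), by positivity, fun x hx => ?_⟩
  obtain ⟨θ, d, hθ0, hθ1, hd0, hdC, hf⟩ := lift_hasFDerivAt (l := l) (i := i) ha hx
  rw [hf.fderiv]
  have hdD := hdC D hD
  have hy := pow_layerIdx_lt h0 h1 hx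
  set k := layerIdx l (x j)
  have e1 : |deriv (a k) (x i) + θ * (deriv (a (k + 1)) (x i) - deriv (a k) (x i))| ≤
      (C + C * Γ) * Γ ^ k := by
    have h2 : deriv (a k) (x i) + θ * (deriv (a (k + 1)) (x i) - deriv (a k) (x i)) =
      (1 - θ) * deriv (a k) (x i) + θ * deriv (a (k + 1)) (x i) := by ring
    rw [h2]
    refine (abs_add_le _ _).trans ?_
    rw [abs_mul, abs_mul, abs_of_nonneg hθ0, abs_of_nonneg (by linarith : 0 ≤ 1 - θ)]
    have h3 := hd k (x i)
    have h4 := hd (k + 1) (x i)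
    have h5 : (1 - θ) * |deriv (a k) (x i)| ≤ 1 * (C * Γ ^ k) :=
      mul_le_mul (by linarith) h3 (abs_nonneg _) zero_le_one
    have h6 : θ * |deriv (a (k + 1)) (x i)| ≤ 1 * (C * Γ ^ (k + 1)) :=
      mul_le_mul (by linarith) h4 (abs_nonneg _) zero_le_one
    rw [pow_succ] at h6
    linarith
  have e2 : |d * (a (k + 1) (x i) - a k (x i)) / (x j * log l)| ≤
      D / (l * |log l|) * Γ ^ k := by
    rw [abs_div, abs_mul, abs_mul, abs_of_nonneg hd0]
    have h3 : d * |a (k + 1) (x i) - a k (x i)| ≤ D * (Γ * l) ^ k :=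
      mul_le_mul hdD (hs k _) (abs_nonneg _) hD0
    have h4 : l ^ (k + 1) * |log l| ≤ |x j| * |log l| :=
      mul_le_mul_of_nonneg_right hy.le (abs_nonneg _)
    have hla : 0 < |log l| := abs_pos.2 hl.ne
    refine (div_le_div₀ (by positivity) h3 (by positivity) h4).trans (le_of_eq ?_)
    rw [mul_pow, pow_succ]
    field_simp
  refine (norm_add_le _ _).trans ?_
  rw [norm_smul, norm_smul, Real.norm_eq_abs, Real.norm_eq_abs]
  have e3 := mul_le_mul e1 (norm_coord_le i) (norm_nonneg _) (by positivity)
  have e4 := mul_le_mul e2 (norm_coord_le j) (norm_nonneg _) (by positivity)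
  linarith

/-- The reflection of the `j`-th coordinate. -/
def coordReflection (j : Fin N) : Euc N ≃ₗᵢ[ℝ] Euc N :=
  LinearIsometryEquiv.piLpCongrRight 2 fun k =>
    if k = j then LinearIsometryEquiv.neg ℝ else LinearIsometryEquiv.refl ℝ ℝ

@[simp] lemma coordReflection_same (j : Fin N) (x : Euc N) : coordReflection j x j = -x j := by
  simp [coordReflection]

lemma coordReflection_ne {i j : Fin N} (hij : i ≠ j) (x : Euc N) :
    coordReflection j x i = x i := by
  simp [coordReflection, hij]

lemma logHeight_neg (l y : ℝ) : logHeight l (-y) = logHeight l y := by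
  simp [logHeight, log_neg_eq_log]

lemma lift_coordReflection (hij : i ≠ j) (a : ℕ → ℝ → ℝ) (x : Euc N) :
    lift l i j a (coordReflection j x) = lift l i j a x := by
  simp [lift, coordReflection_ne hij, logHeight_neg]

/-- A bounded function, smooth off `{x j = 0}`, whose gradient and whose jump across that
hyperplane are carried by the generations of a Cantor set. -/
structure IsLayered (l : ℝ) (i j : Fin N) (Γ : ℝ) (z : Euc N → ℝ) : Prop where
  smooth : ∀ x, x j ≠ 0 → ContDiffAt ℝ (⊤ : ℕ∞) z x
  mem : ∀ x, 0 ≤ z x ∧ z x ≤ 1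
  grad_le : ∃ C, 0 ≤ C ∧ ∀ x, x j ≠ 0 → ‖fderiv ℝ z x‖ ≤ C * Γ ^ layerIdx l (x j)
  grad_support : ∀ x, x j ≠ 0 → fderiv ℝ z x ≠ 0 → cantorBump l (layerIdx l (x j)) (x i) ≠ 0
  jump_support : ∀ x, x j ≠ 0 → z (coordReflection j x) ≠ z x →
    cantorBump l (layerIdx l (x j)) (x i) ≠ 0

lemma IsLayered.mul {Γ Γ' Γ'' : ℝ} {z z' : Euc N → ℝ} (h : IsLayered l i j Γ z)
    (h' : IsLayered l i j Γ' z') (hΓ0 : 0 ≤ Γ) (hΓ'0 : 0 ≤ Γ') (hΓ : Γ ≤ Γ'') (hΓ' : Γ' ≤ Γ'') :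
    IsLayered l i j Γ'' (fun x => z x * z' x) := by
  have hf : ∀ x, x j ≠ 0 → fderiv ℝ (fun x => z x * z' x) x =
      z x • fderiv ℝ z' x + z' x • fderiv ℝ z x := fun x hx =>
    fderiv_fun_mul ((h.smooth x hx).differentiableAt (by simp))
      ((h'.smooth x hx).differentiableAt (by simp))
  refine ⟨fun x hx => (h.smooth x hx).mul (h'.smooth x hx), fun x => ?_, ?_, fun x hx hne => ?_,
    fun x hx hne => ?_⟩
  · have := h.mem x
    have := h'.mem x
    exact ⟨by nlinarith, by nlinarith⟩
  · obtain ⟨C, hC0, hC⟩ := h.grad_le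
    obtain ⟨C', hC'0, hC'⟩ := h'.grad_le
    refine ⟨C' + C, by positivity, fun x hx => ?_⟩
    rw [hf x hx]
    refine (norm_add_le _ _).trans ?_
    rw [norm_smul, norm_smul, add_mul]
    have key : ∀ {c A B G G' : ℝ} (k : ℕ), 0 ≤ c → c ≤ 1 → 0 ≤ A → A ≤ B * G ^ k → 0 ≤ B →
        0 ≤ G → G ≤ G' → ‖c‖ * A ≤ B * G' ^ k := by
      intro c A B G G' k hc0 hc1 hA hAB hB hG hGG
      rw [Real.norm_of_nonneg hc0]
      calc c * A ≤ 1 * A := by gcongr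
        _ ≤ B * G ^ k := by rwa [one_mul]
        _ ≤ B * G' ^ k := by gcongr
    exact add_le_add (key _ (h.mem x).1 (h.mem x).2 (norm_nonneg _) (hC' x hx) hC'0 hΓ'0 hΓ')
      (key _ (h'.mem x).1 (h'.mem x).2 (norm_nonneg _) (hC x hx) hC0 hΓ0 hΓ)
  · rw [hf x hx] at hne
    by_contra hcon
    apply hne
    rw [not_imp_not.1 (h.grad_support x hx) hcon, not_imp_not.1 (h'.grad_support x hx) hcon]
    simp
  · by_contra hcon
    apply hne
    rw [not_imp_not.1 (h.jump_support x hx) hcon, not_imp_not.1 (h'.jump_support x hx) hcon]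

/-! ### The building blocks -/

variable (l i j)

/-- Equal to `1` above and below the Cantor set, to `0` away from it. -/
def capFn : Euc N → ℝ := lift l i j (cantorBump l)

/-- The function `capFn` with two more generations, separating the gradients of `capFn` and of
`stairFn`. -/
def sepFn : Euc N → ℝ := lift l i j fun k => cantorBump l (k + 2)

/-- Smoothing of the Cantor function of the first variable. -/
def stairFn : Euc N → ℝ := lift l i j fun k => stairStep l (k + 4)

/-- The function `capFn` restricted to the upper half space. -/
def halfFn (x : Euc N) : ℝ := if 0 < x j then capFn l i j x else 0

variable {l i j}

lemma lift_mem {a : ℕ → ℝ → ℝ} (ha : ∀ k t, 0 ≤ a k t ∧ a k t ≤ 1) (x : Euc N) :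
    0 ≤ lift l i j a x ∧ lift l i j a x ≤ 1 := by
  obtain ⟨θ, hθ0, hθ1, h⟩ := lift_eq (l := l) (i := i) (j := j) a x
  rw [h]
  have hA := ha (layerIdx l (x j)) (x i)
  have hB := ha (layerIdx l (x j) + 1) (x i)
  constructor <;> nlinarith

lemma cantorBump_eq_zero_of_le (h0 : 0 < l) (h1 : l < 1 / 2) {m n : ℕ} (hmn : m ≤ n) {t : ℝ}
    (h : cantorBump l m t = 0) : cantorBump l n t = 0 := by
  by_contra hne
  exact cantorBump_ne_zero_of_le h0 h1 hmn hne h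

lemma cantorBump_eq_one_of_lt (h0 : 0 < l) (h1 : l < 1 / 2) {m n : ℕ} (hmn : m < n) {t : ℝ}
    (h : cantorBump l n t ≠ 0) : cantorBump l m t = 1 :=
  cantorBump_eq_one_of_succ h0 h1 m (cantorBump_ne_zero_of_le h0 h1 hmn h)

lemma fderiv_capFn_eq_zero (h0 : 0 < l) (h1 : l < 1 / 2) {x : Euc N} (hx : x j ≠ 0)
    (h : cantorBump l (layerIdx l (x j)) (x i) = 0) : fderiv ℝ (capFn l i j) x = 0 := by
  obtain ⟨θ, d, -, -, -, -, hf⟩ := lift_hasFDerivAt (l := l) (i := i) (cantorBump_contDiff (l := l)) hx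
  have h2 := cantorBump_eq_zero_of_le h0 h1 (Nat.le_succ _) h
  rw [capFn, hf.fderiv, deriv_cantorBump_of_eq_zero h0 h1 _ h,
    deriv_cantorBump_of_eq_zero h0 h1 _ h2, h, h2]
  simp

lemma fderiv_capFn_eq_zero_of_ne (h0 : 0 < l) (h1 : l < 1 / 2) {x : Euc N} (hx : x j ≠ 0)
    (h : cantorBump l (layerIdx l (x j) + 2) (x i) ≠ 0) : fderiv ℝ (capFn l i j) x = 0 := by
  obtain ⟨θ, d, -, -, -, -, hf⟩ := lift_hasFDerivAt (l := l) (i := i) (cantorBump_contDiff (l := l)) hx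
  have h2 := cantorBump_eq_one_of_lt h0 h1 (Nat.lt_succ_self (layerIdx l (x j) + 1)) h
  have h3 := cantorBump_eq_one_of_lt h0 h1 (by omega : layerIdx l (x j) < layerIdx l (x j) + 2) h
  rw [capFn, hf.fderiv, deriv_cantorBump_of_eq_one h0 h1 _ h2,
    deriv_cantorBump_of_eq_one h0 h1 _ h3, h3, h2]
  simp

lemma sepFn_eq_zero (h0 : 0 < l) (h1 : l < 1 / 2) {x : Euc N}
    (h : cantorBump l (layerIdx l (x j) + 2) (x i) = 0) : sepFn l i j x = 0 := by
  obtain ⟨θ, hθ0, hθ1, hh⟩ := lift_eq (l := l) (i := i) (j := j) (fun k => cantorBump l (k + 2)) x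
  rw [sepFn, hh, h, cantorBump_eq_zero_of_le h0 h1 (by omega) h]
  simp

lemma sepFn_eq_one (h0 : 0 < l) (h1 : l < 1 / 2) {x : Euc N}
    (h : cantorBump l (layerIdx l (x j) + 4) (x i) ≠ 0) : sepFn l i j x = 1 := by
  obtain ⟨θ, hθ0, hθ1, hh⟩ := lift_eq (l := l) (i := i) (j := j) (fun k => cantorBump l (k + 2)) x
  rw [sepFn, hh, cantorBump_eq_one_of_lt h0 h1 (by omega) h,
    cantorBump_eq_one_of_lt h0 h1 (by omega) h]
  simp

lemma capFn_eq_one (h0 : 0 < l) (h1 : l < 1 / 2) {x : Euc N}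
    (h : cantorBump l (layerIdx l (x j) + 4) (x i) ≠ 0) : capFn l i j x = 1 := by
  obtain ⟨θ, hθ0, hθ1, hh⟩ := lift_eq (l := l) (i := i) (j := j) (cantorBump l) x
  rw [capFn, hh, cantorBump_eq_one_of_lt h0 h1 (by omega) h,
    cantorBump_eq_one_of_lt h0 h1 (by omega) h]
  simp

lemma fderiv_stairFn_eq_zero (h0 : 0 < l) (h1 : l < 1 / 2) {x : Euc N} (hx : x j ≠ 0)
    (h : cantorBump l (layerIdx l (x j) + 4) (x i) = 0) : fderiv ℝ (stairFn l i j) x = 0 := by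
  obtain ⟨θ, d, -, -, -, -, hf⟩ := lift_hasFDerivAt (l := l) (i := i) (a := fun k => stairStep l (k + 4))
    (fun k => stairStep_contDiff (l := l) (k + 4)) hx
  have h2 := cantorBump_eq_zero_of_le h0 h1 (Nat.le_succ _) h
  have h3 := stairStep_succ_sub_of_eq_zero h0 h1 _ h
  have h4 := deriv_stairStep_of_eq_zero h0 h1 _ h
  have h5 := deriv_stairStep_of_eq_zero h0 h1 _ h2
  rw [stairFn, hf.fderiv]
  simp only [show layerIdx l (x j) + 1 + 4 = layerIdx l (x j) + 4 + 1 by ring] at *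
  rw [h3, h4]
  simp only [Nat.succ_eq_add_one] at h5
  rw [h5]
  simp

lemma sepFn_eq_zero_of_capFn (h0 : 0 < l) (h1 : l < 1 / 2) {x : Euc N} (hx : x j ≠ 0)
    (h : fderiv ℝ (capFn l i j) x ≠ 0) : sepFn l i j x = 0 := by
  apply sepFn_eq_zero h0 h1
  by_contra hne
  exact h (fderiv_capFn_eq_zero_of_ne h0 h1 hx hne)

lemma sepFn_eq_one_of_stairFn (h0 : 0 < l) (h1 : l < 1 / 2) {x : Euc N} (hx : x j ≠ 0)
    (h : fderiv ℝ (stairFn l i j) x ≠ 0) : sepFn l i j x = 1 := by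
  apply sepFn_eq_one h0 h1
  by_contra hne
  exact h (fderiv_stairFn_eq_zero h0 h1 hx hne)

lemma capFn_eq_one_of_stairFn (h0 : 0 < l) (h1 : l < 1 / 2) {x : Euc N} (hx : x j ≠ 0)
    (h : fderiv ℝ (stairFn l i j) x ≠ 0) : capFn l i j x = 1 := by
  apply capFn_eq_one h0 h1
  by_contra hne
  exact h (fderiv_stairFn_eq_zero h0 h1 hx hne)

lemma halfFn_eventuallyEq {x : Euc N} (hx : x j ≠ 0) :
    (0 < x j ∧ halfFn l i j =ᶠ[𝓝 x] capFn l i j) ∨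
      (x j < 0 ∧ halfFn l i j =ᶠ[𝓝 x] fun _ => 0) := by
  have hc : Continuous fun x : Euc N => x j := (coord_contDiff j).continuous
  rcases lt_or_gt_of_ne hx with h | h
  · right
    refine ⟨h, ?_⟩
    filter_upwards [(isOpen_lt hc continuous_const).mem_nhds h] with y hy
    simp [halfFn, not_lt.2 (le_of_lt (show y j < 0 from hy))]
  · left
    refine ⟨h, ?_⟩
    filter_upwards [(isOpen_lt continuous_const hc).mem_nhds h] with y hy
    exact if_pos hy

lemma fderiv_halfFn_of_pos {x : Euc N} (hx : 0 < x j) :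
    fderiv ℝ (halfFn l i j) x = fderiv ℝ (capFn l i j) x := by
  rcases halfFn_eventuallyEq (l := l) (i := i) hx.ne' with ⟨-, h⟩ | ⟨h, -⟩
  · exact h.fderiv_eq
  · linarith

lemma fderiv_halfFn_of_neg {x : Euc N} (hx : x j < 0) : fderiv ℝ (halfFn l i j) x = 0 := by
  rcases halfFn_eventuallyEq (l := l) (i := i) hx.ne with ⟨h, -⟩ | ⟨-, h⟩
  · linarith
  · rw [h.fderiv_eq]; simp

lemma fderiv_capFn_ne_zero_of_halfFn {x : Euc N} (hx : x j ≠ 0)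
    (h : fderiv ℝ (halfFn l i j) x ≠ 0) : fderiv ℝ (capFn l i j) x ≠ 0 := by
  rcases lt_or_gt_of_ne hx with h' | h'
  · exact absurd (fderiv_halfFn_of_neg h') h
  · rwa [← fderiv_halfFn_of_pos h']

lemma norm_fderiv_halfFn_le {x : Euc N} (hx : x j ≠ 0) :
    ‖fderiv ℝ (halfFn l i j) x‖ ≤ ‖fderiv ℝ (capFn l i j) x‖ := by
  rcases lt_or_gt_of_ne hx with h' | h'
  · rw [fderiv_halfFn_of_neg h', norm_zero]; exact norm_nonneg _
  · rw [fderiv_halfFn_of_pos h']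

lemma capFn_eq_zero (h0 : 0 < l) (h1 : l < 1 / 2) {x : Euc N}
    (h : cantorBump l (layerIdx l (x j)) (x i) = 0) : capFn l i j x = 0 := by
  obtain ⟨θ, hθ0, hθ1, hh⟩ := lift_eq (l := l) (i := i) (j := j) (cantorBump l) x
  rw [capFn, hh, h, cantorBump_eq_zero_of_le h0 h1 (by omega) h]
  simp

lemma exists_fderiv_bumps_le (h0 : 0 < l) (h1 : l < 1 / 2) (m : ℕ) :
    ∃ C, 0 ≤ C ∧ ∀ x : Euc N, x j ≠ 0 →
      ‖fderiv ℝ (lift l i j fun k => cantorBump l (k + m)) x‖ ≤ C * l⁻¹ ^ layerIdx l (x j) := by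
  obtain ⟨C, hC0, hC⟩ := exists_deriv_cantorBump_le h0 h1
  refine exists_norm_fderiv_lift_le h0 h1 (a := fun k => cantorBump l (k + m)) (C := C * l⁻¹ ^ m)
    (fun k => cantorBump_contDiff _) ((one_le_inv₀ h0).2 (by linarith)) (fun k t => ?_)
    (fun k t => ?_)
  · refine (hC _ _).trans (le_of_eq ?_); rw [pow_add]; ring
  · rw [inv_mul_cancel₀ h0.ne', one_pow]
    have hA := cantorBump_mem h0 h1 (k + m) t
    have hB := cantorBump_mem h0 h1 (k + 1 + m) t
    rw [abs_le]; constructor <;> linarith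

lemma halfFn_isLayered (hij : i ≠ j) (h0 : 0 < l) (h1 : l < 1 / 2) :
    IsLayered l i j l⁻¹ (halfFn l i j) := by
  have hcap : ∀ x : Euc N, 0 ≤ capFn l i j x ∧ capFn l i j x ≤ 1 :=
    lift_mem (cantorBump_mem h0 h1)
  refine ⟨fun x hx => ?_, fun x => ?_, ?_, fun x hx h => ?_, fun x hx h => ?_⟩
  · rcases halfFn_eventuallyEq (l := l) (i := i) hx with ⟨-, h⟩ | ⟨-, h⟩
    · exact (lift_contDiffAt (fun k => cantorBump_contDiff k) hx).congr_of_eventuallyEq h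
    · exact contDiffAt_const.congr_of_eventuallyEq h
  · unfold halfFn
    split_ifs
    · exact hcap x
    · simp
  · obtain ⟨C, hC0, hC⟩ := exists_fderiv_bumps_le (i := i) (j := j) h0 h1 0
    exact ⟨C, hC0, fun x hx => (norm_fderiv_halfFn_le hx).trans (hC x hx)⟩
  · by_contra hcon
    exact fderiv_capFn_ne_zero_of_halfFn hx h (fderiv_capFn_eq_zero h0 h1 hx hcon)
  · by_contra hcon
    apply h
    have e1 := capFn_eq_zero (i := i) h0 h1 hcon
    have e2 : capFn l i j (coordReflection j x) = 0 := by
      rw [capFn, lift_coordReflection hij]; exact e1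
    simp [halfFn, e1, e2]

lemma stairFn_isLayered (hij : i ≠ j) (h0 : 0 < l) (h1 : l < 1 / 2) :
    IsLayered l i j (2 * l)⁻¹ (stairFn l i j) := by
  refine ⟨fun x hx => ?_, lift_mem fun k => stairStep_mem (k + 4), ?_, fun x hx h => ?_,
    fun x hx h => absurd (lift_coordReflection hij _ x) h⟩
  · exact lift_contDiffAt (fun k => stairStep_contDiff (k + 4)) hx
  · obtain ⟨C, hC0, hC⟩ := exists_deriv_stairStep_le h0 h1
    refine exists_norm_fderiv_lift_le h0 h1 (a := fun k => stairStep l (k + 4))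
      (C := C * (2 * l)⁻¹ ^ 4) (fun k => stairStep_contDiff _)
      ((one_le_inv₀ (by positivity)).2 (by linarith)) (fun k t => ?_) (fun k t => ?_)
    · refine (hC _ _).trans (le_of_eq ?_); rw [pow_add]; ring
    · have e := abs_stairStep_succ_sub_le h0 h1 (k + 4) t
      rw [show k + 1 + 4 = k + 4 + 1 by ring]
      refine e.trans ?_
      rw [show (2 * l)⁻¹ * l = 1 / 2 by field_simp]
      exact pow_le_pow_of_le_one (by norm_num) (by norm_num) (by omega)
  · by_contra hcon
    exact h (fderiv_stairFn_eq_zero h0 h1 hx (cantorBump_eq_zero_of_le h0 h1 (by omega) hcon))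

end Layered

section LayerMeasure

variable {N : ℕ} {l : ℝ} {i j : Fin N}

lemma volume_coord_eq_zero (j : Fin N) : volume {x : Euc N | x j = 0} = 0 := by
  have h := Measure.addHaar_submodule (volume : Measure (Euc N))
    (EuclideanSpace.proj (𝕜 := ℝ) j : Euc N →L[ℝ] ℝ).ker (fun htop => by
      have h1 : EuclideanSpace.single j (1 : ℝ) ∈
          (EuclideanSpace.proj (𝕜 := ℝ) j : Euc N →L[ℝ] ℝ).ker := by
        rw [htop]; trivial
      simp at h1)
  convert h using 2
  ext x; simp

lemma ae_coord_ne_zero (j : Fin N) : ∀ᵐ x : Euc N, x j ≠ 0 := by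
  rw [ae_iff]
  simpa using volume_coord_eq_zero j

lemma volume_box_le (hij : i ≠ j) {δ : ℝ} {T : Set ℝ} (hT : MeasurableSet T) :
    volume {x : Euc N | x ∈ Metric.ball 0 1 ∧ |x j| ≤ δ ∧ x i ∈ T} ≤
      volume T * ENNReal.ofReal δ * 2 ^ N := by
  let s : Fin N → Set ℝ := fun k =>
    if k = i then T else if k = j then Set.Icc (-δ) δ else Set.Icc (-1) 1
  have hs : ∀ k, MeasurableSet (s k) := fun k => by
    simp only [s]; split_ifs
    · exact hT
    · exact measurableSet_Icc
    · exact measurableSet_Icc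
  have hsub : {x : Euc N | x ∈ Metric.ball 0 1 ∧ |x j| ≤ δ ∧ x i ∈ T} ⊆
      WithLp.ofLp ⁻¹' (Set.univ.pi s) := by
    rintro x ⟨hx, hxj, hxi⟩ k -
    simp only [s]; split_ifs with h1 h2
    · rw [h1]; exact hxi
    · rw [h2]; exact abs_le.1 hxj
    · rw [mem_ball_zero_iff] at hx
      have := (PiLp.norm_apply_le x k).trans hx.le
      exact abs_le.1 this
  refine (measure_mono hsub).trans ?_
  rw [(PiLp.volume_preserving_ofLp (Fin N)).measure_preimage
    (MeasurableSet.univ_pi hs).nullMeasurableSet, volume_pi_pi]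
  calc ∏ k, volume (s k) ≤ ∏ k, ((if k = i then volume T else 1) *
        (if k = j then ENNReal.ofReal δ else 1)) * 2 := by
        refine Finset.prod_le_prod' fun k _ => ?_
        simp only [s]
        split_ifs with h1 h2 h2
        · exact absurd (h1.symm.trans h2) hij
        · rw [mul_one]; exact le_mul_of_one_le_right' (by norm_num)
        · rw [Real.volume_Icc, one_mul, sub_neg_eq_add, ← mul_two, ENNReal.ofReal_mul' zero_le_two]
          simp
        · rw [Real.volume_Icc]; norm_num
    _ = volume T * ENNReal.ofReal δ * 2 ^ N := by
        rw [Finset.prod_mul_distrib, Finset.prod_mul_distrib]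
        simp

/-- The part of the `n`-th neighbourhood of the Cantor set lying in the unit ball. -/
def slab (l : ℝ) (i j : Fin N) (n : ℕ) : Set (Euc N) :=
  {x | x ∈ Metric.ball 0 1 ∧ |x j| ≤ l ^ n ∧ x i ∈ {t | cantorBump l n t ≠ 0}}

lemma measurableSet_cantorBump (n : ℕ) : MeasurableSet {t | cantorBump l n t ≠ 0} :=
  (isOpen_ne_fun (cantorBump_contDiff n).continuous continuous_const).measurableSet

lemma measurableSet_slab (n : ℕ) : MeasurableSet (slab l i j n) := by
  have hm : ∀ k : Fin N, Measurable fun x : Euc N => x k := fun k =>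
    (coord_contDiff k).continuous.measurable
  exact Metric.isOpen_ball.measurableSet.inter
    ((measurableSet_le (hm j).abs measurable_const).inter (hm i (measurableSet_cantorBump n)))

lemma volume_slab_le (hij : i ≠ j) (h0 : 0 < l) (h1 : l < 1 / 2) (n : ℕ) :
    volume (slab l i j n) ≤ ENNReal.ofReal (2 ^ N * (2 * l ^ 2) ^ n) := by
  refine (volume_box_le hij (measurableSet_cantorBump n)).trans ?_
  calc _ ≤ ENNReal.ofReal ((2 * l) ^ n) * ENNReal.ofReal (l ^ n) * 2 ^ N := by
        gcongr; exact volume_cantorBump_support_le h0 h1 n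
    _ = _ := by
        have h2 : (2 : ℝ≥0∞) ^ N = ENNReal.ofReal (2 ^ N) := by
          rw [ENNReal.ofReal_pow zero_le_two]; simp
        rw [h2, ← ENNReal.ofReal_mul (by positivity), ← ENNReal.ofReal_mul (by positivity),
          ← mul_pow]
        congr 1
        ring

lemma mem_slab_layerIdx (h0 : 0 < l) (h1 : l < 1 / 2) {x : Euc N} (hx1 : x ∈ Metric.ball 0 1)
    (hx : x j ≠ 0) (h : cantorBump l (layerIdx l (x j)) (x i) ≠ 0) :
    x ∈ slab l i j (layerIdx l (x j)) := by
  refine ⟨hx1, le_pow_layerIdx h0 h1 hx ?_, h⟩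
  rw [mem_ball_zero_iff] at hx1
  exact (PiLp.norm_apply_le x j).trans hx1.le

lemma lintegral_layers_lt_top (hij : i ≠ j) (h0 : 0 < l) (h1 : l < 1 / 2) {F : Euc N → ℝ≥0∞}
    {B : ℕ → ℝ} (hB : ∀ k, 0 ≤ B k) (hsum : Summable fun k => B k * (2 * l ^ 2) ^ k)
    (hF : ∀ x ∈ Metric.ball (0 : Euc N) 1, x j ≠ 0 → F x ≤ ENNReal.ofReal (B (layerIdx l (x j))))
    (hF0 : ∀ x ∈ Metric.ball (0 : Euc N) 1, x j ≠ 0 →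
      cantorBump l (layerIdx l (x j)) (x i) = 0 → F x = 0) :
    ∫⁻ x in Metric.ball 0 1, F x < ⊤ := by
  have hle : ∀ᵐ x ∂volume.restrict (Metric.ball (0 : Euc N) 1), F x ≤
      ∑' k, (slab l i j k).indicator (fun _ => ENNReal.ofReal (B k)) x := by
    filter_upwards [ae_restrict_mem Metric.isOpen_ball.measurableSet,
      ae_restrict_of_ae (ae_coord_ne_zero j)] with x hx hxj
    by_cases he : cantorBump l (layerIdx l (x j)) (x i) = 0
    · rw [hF0 x hx hxj he]; exact zero_le
    · refine (hF x hx hxj).trans (le_trans (le_of_eq ?_) (ENNReal.le_tsum (layerIdx l (x j))))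
      rw [Set.indicator_of_mem (mem_slab_layerIdx h0 h1 hx hxj he)]
  refine (lintegral_mono_ae hle).trans_lt ?_
  rw [lintegral_tsum fun k => (measurable_const.indicator (measurableSet_slab k)).aemeasurable]
  have hk : ∀ k, ∫⁻ x in Metric.ball (0 : Euc N) 1,
      (slab l i j k).indicator (fun _ => ENNReal.ofReal (B k)) x ≤
        ENNReal.ofReal (2 ^ N * (B k * (2 * l ^ 2) ^ k)) := by
    intro k
    refine (setLIntegral_le_lintegral _ _).trans ?_
    rw [lintegral_indicator_const (measurableSet_slab k)]
    refine (mul_le_mul_right (volume_slab_le hij h0 h1 k) _).trans (le_of_eq ?_)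
    rw [← ENNReal.ofReal_mul (hB k)]
    congr 1; ring
  refine (ENNReal.tsum_le_tsum hk).trans_lt ?_
  rw [← ENNReal.ofReal_tsum_of_nonneg
    (fun k => mul_nonneg (by positivity) (mul_nonneg (hB k) (by positivity))) (hsum.mul_left _)]
  exact ENNReal.ofReal_lt_top

lemma IsLayered.integrableOn_fderiv (hij : i ≠ j) (h0 : 0 < l) (h1 : l < 1 / 2) {Γ : ℝ}
    {z : Euc N → ℝ} (hz : IsLayered l i j Γ z) (hΓ0 : 0 ≤ Γ) (hΓ : Γ ≤ l⁻¹) :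
    IntegrableOn (fderiv ℝ z) (Metric.ball 0 1) := by
  refine ⟨(measurable_fderiv ℝ z).aestronglyMeasurable, ?_⟩
  obtain ⟨C, hC0, hC⟩ := hz.grad_le
  refine lintegral_layers_lt_top hij h0 h1 (B := fun k => C * Γ ^ k)
    (fun k => by positivity) ?_ (fun x _ hx => ?_) (fun x _ hx he => ?_)
  · have : ∀ k, C * Γ ^ k * (2 * l ^ 2) ^ k = C * (Γ * (2 * l ^ 2)) ^ k := fun k => by
      rw [mul_pow]; ring
    simp_rw [this]
    refine (summable_geometric_of_lt_one (by positivity) ?_).mul_left C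
    calc Γ * (2 * l ^ 2) ≤ l⁻¹ * (2 * l ^ 2) := by gcongr
      _ = 2 * l := by field_simp
      _ < 1 := by linarith
  · rw [← ofReal_norm]
    exact ENNReal.ofReal_le_ofReal (hC x hx)
  · by_contra hne
    exact hz.grad_support x hx (fun h => hne (by rw [h, ← ofReal_norm, norm_zero, ENNReal.ofReal_zero])) he

lemma IsLayered.aestronglyMeasurable {Γ : ℝ} {z : Euc N → ℝ} (hz : IsLayered l i j Γ z) :
    AEStronglyMeasurable z := by
  have hopen : IsOpen {x : Euc N | x j ≠ 0} :=
    isOpen_ne_fun (coord_contDiff j).continuous continuous_const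
  have h : ContinuousOn z {x : Euc N | x j ≠ 0} := fun x hx =>
    (hz.smooth x hx).continuousAt.continuousWithinAt
  have h2 := h.aestronglyMeasurable hopen.measurableSet (μ := volume)
  have h3 : volume.restrict {x : Euc N | x j ≠ 0} = volume :=
    Measure.restrict_eq_self_of_ae_mem (ae_coord_ne_zero j)
  rwa [h3] at h2

end LayerMeasure

/-! ### Integration by parts for layered functions -/

/-- A smooth even function vanishing near `0` and equal to `1` outside `[-1, 1]`. -/
def evenCut (s : ℝ) : ℝ := 1 - cutoff (1 / 4) 1 (s ^ 2)

lemma evenCut_contDiff : ContDiff ℝ (⊤ : ℕ∞) evenCut :=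
  contDiff_const.sub ((cutoff_contDiff _ _).comp (contDiff_id.pow 2))

lemma evenCut_eq_zero {s : ℝ} (h : |s| ≤ 1 / 2) : evenCut s = 0 := by
  rw [evenCut, cutoff_eq_one (by norm_num), sub_self]
  rw [← sq_abs]; nlinarith [abs_nonneg s]

lemma evenCut_eq_one {s : ℝ} (h : 1 ≤ |s|) : evenCut s = 1 := by
  rw [evenCut, cutoff_eq_zero (by norm_num), sub_zero]
  rw [← sq_abs]; nlinarith

lemma evenCut_mem (s : ℝ) : 0 ≤ evenCut s ∧ evenCut s ≤ 1 :=
  ⟨sub_nonneg.2 (cutoff_le_one _ _ _), sub_le_self _ (cutoff_nonneg _ _ _)⟩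

lemma deriv_evenCut_neg (s : ℝ) : deriv evenCut (-s) = -deriv evenCut s := by
  have h : (fun s => evenCut (-s)) = evenCut := by funext s; simp [evenCut]
  have h2 := deriv_comp_neg evenCut s
  rw [h] at h2
  linarith

lemma deriv_evenCut_eq_zero {s : ℝ} (h : 1 ≤ |s|) : deriv evenCut s = 0 :=
  deriv_eq_zero_of_forall_le fun y => by rw [evenCut_eq_one h]; exact (evenCut_mem y).2

lemma exists_abs_deriv_evenCut_le : ∃ C, 0 ≤ C ∧ ∀ s, |deriv evenCut s| ≤ C :=
  exists_abs_deriv_le (evenCut_contDiff.of_le (by simp)) (a := -1) (b := 1) fun x hx =>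
    deriv_evenCut_eq_zero (not_lt.1 fun h => hx (Set.mem_Icc.2 (abs_le.1 h.le)))

section Parts

variable {N : ℕ} {l : ℝ} {i j : Fin N}

lemma norm_sub_coordReflection (x : Euc N) : ‖x - coordReflection j x‖ = 2 * |x j| := by
  have h : x - coordReflection j x = EuclideanSpace.single j (2 * x j) := by
    ext k
    by_cases hk : k = j
    · subst hk; simp; ring
    · simp [coordReflection_ne hk, hk]
  rw [h, PiLp.norm_single, Real.norm_eq_abs, abs_mul, abs_two]

/-- The cutoff `evenCut` at height `ε`. -/
def planeCut (j : Fin N) (ε : ℝ) (x : Euc N) : ℝ := evenCut (x j / ε)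

lemma planeCut_contDiff (j : Fin N) (ε : ℝ) : ContDiff ℝ (⊤ : ℕ∞) (planeCut j ε) :=
  evenCut_contDiff.comp ((coord_contDiff j).div_const ε)

lemma fderiv_planeCut (j : Fin N) (ε : ℝ) (x v : Euc N) :
    fderiv ℝ (planeCut j ε) x v = deriv evenCut (x j / ε) * (v j / ε) := by
  have h1 : HasDerivAt evenCut (deriv evenCut (x j / ε)) (x j / ε) :=
    (evenCut_contDiff.differentiable (by simp) _).hasDerivAt
  have h2 : HasFDerivAt (fun x : Euc N => x j / ε) (ε⁻¹ • EuclideanSpace.proj (𝕜 := ℝ) j) x := by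
    simpa only [div_eq_mul_inv] using (coord_hasFDerivAt j x).mul_const ε⁻¹
  have h3 : HasFDerivAt (planeCut j ε) _ x :=
    HasDerivAt.comp_hasFDerivAt x (f := fun x : Euc N => x j / ε) h1 h2
  rw [h3.fderiv]
  change deriv evenCut (x j / ε) * (ε⁻¹ * v j) = _
  ring

lemma slab_mono_layer (h0 : 0 < l) (h1 : l < 1 / 2) {n : ℕ} {x : Euc N} (hx : x j ≠ 0)
    (hn : |x j| ≤ l ^ n) : n ≤ layerIdx l (x j) := by
  have h := (pow_layerIdx_lt h0 h1 hx).trans_le hn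
  have := (pow_lt_pow_iff_right_of_lt_one₀ h0 (by linarith)).1 h
  omega

lemma IsLayered.exists_integral_cut_le (hij : i ≠ j) (h0 : 0 < l) (h1 : l < 1 / 2) {Γ : ℝ}
    {z : Euc N → ℝ} (hz : IsLayered l i j Γ z) {ψ : Euc N → ℝ} (hψ : ContDiff ℝ (⊤ : ℕ∞) ψ)
    (hc : HasCompactSupport ψ) (hs : tsupport ψ ⊆ Metric.ball 0 1) :
    ∃ K, ∀ n : ℕ, |∫ x, z x * ψ x * deriv evenCut (x j / l ^ n)| ≤
      K * ((2 * l ^ 2) ^ n + (l ^ n) ^ 2) := by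
  obtain ⟨D, hD0, hD⟩ := exists_abs_deriv_evenCut_le
  obtain ⟨M, hM⟩ := hc.exists_bound_of_continuous hψ.continuous
  have hM0 : 0 ≤ M := (norm_nonneg _).trans (hM 0)
  obtain ⟨L, hL⟩ := ContDiff.lipschitzWith_of_hasCompactSupport hc hψ (by simp)
  refine ⟨D * M * 2 ^ N + D * (2 * L) * (2 * 2 ^ N), fun n => ?_⟩
  set R := coordReflection j
  set G : Euc N → ℝ := fun x => z x * ψ x * deriv evenCut (x j / l ^ n) with hG
  have hln : 0 < l ^ n := by positivity
  have hGi : Integrable G := by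
    have h2 : Integrable fun x => ψ x * deriv evenCut (x j / l ^ n) := by
      refine Continuous.integrable_of_hasCompactSupport ?_ hc.mul_right
      exact hψ.continuous.mul ((evenCut_contDiff.continuous_deriv (by simp)).comp
        ((coord_contDiff j).continuous.div_const _))
    have h3 := h2.bdd_mul (c := 1) hz.aestronglyMeasurable (Eventually.of_forall fun x => by
      rw [Real.norm_of_nonneg (hz.mem x).1]; exact (hz.mem x).2)
    refine h3.congr (Eventually.of_forall fun x => ?_)
    simp only [hG]; ring
  have hmp : MeasurePreserving R volume volume := R.measurePreserving
  have hGR : ∫ x, G (R x) = ∫ x, G x :=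
    hmp.integral_comp R.toHomeomorph.measurableEmbedding G
  have hGRi : Integrable fun x => G (R x) := hmp.integrable_comp_of_integrable hGi
  have hzero : ∀ x ∉ Metric.ball (0 : Euc N) 1, ψ x = 0 := fun x hx =>
    image_eq_zero_of_notMem_tsupport fun h => hx (hs h)
  set box : Set (Euc N) :=
    {x | x ∈ Metric.ball 0 1 ∧ |x j| ≤ l ^ n ∧ x i ∈ Set.Icc (-1 : ℝ) 1} with hbox
  have hboxm : MeasurableSet box := by
    have hm : ∀ k : Fin N, Measurable fun x : Euc N => x k := fun k =>
      (coord_contDiff k).continuous.measurable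
    exact Metric.isOpen_ball.measurableSet.inter
      ((measurableSet_le (hm j).abs measurable_const).inter (hm i measurableSet_Icc))
  have hboxv : volume box ≤ ENNReal.ofReal (2 * 2 ^ N * l ^ n) := by
    refine (volume_box_le hij measurableSet_Icc).trans (le_of_eq ?_)
    have h2 : (2 : ℝ≥0∞) ^ N = ENNReal.ofReal (2 ^ N) := by
      rw [ENNReal.ofReal_pow zero_le_two]; simp
    rw [Real.volume_Icc, h2, ← ENNReal.ofReal_mul (by norm_num),
      ← ENNReal.ofReal_mul (by positivity)]
    congr 1; ring
  have hsv := volume_slab_le (N := N) hij h0 h1 n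
  have hpt : ∀ᵐ x, ‖G x + G (R x)‖ ≤ (slab l i j n).indicator (fun _ => D * M) x +
      box.indicator (fun _ => D * (2 * L * l ^ n)) x := by
    filter_upwards [ae_coord_ne_zero j] with x hx
    have hsum : G x + G (R x) =
        ((z x - z (R x)) * ψ x + z (R x) * (ψ x - ψ (R x))) * deriv evenCut (x j / l ^ n) := by
      simp only [hG, R, coordReflection_same, neg_div, deriv_evenCut_neg]
      ring
    have hnn1 : 0 ≤ (slab l i j n).indicator (fun _ => D * M) x :=
      Set.indicator_nonneg (fun _ _ => by positivity) _
    have hnn2 : 0 ≤ box.indicator (fun _ => D * (2 * L * l ^ n)) x :=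
      Set.indicator_nonneg (fun _ _ => by positivity) _
    rw [hsum, norm_mul, Real.norm_eq_abs, Real.norm_eq_abs]
    by_cases hxb : x ∈ Metric.ball (0 : Euc N) 1
    swap
    · have hRx : R x ∉ Metric.ball (0 : Euc N) 1 := by
        simpa [mem_ball_zero_iff] using hxb
      rw [hzero x hxb, hzero _ hRx]
      simp only [mul_zero, sub_zero, add_zero, abs_zero, zero_mul]
      positivity
    by_cases hxn : 1 ≤ |x j / l ^ n|
    · rw [deriv_evenCut_eq_zero hxn]
      simp only [abs_zero, mul_zero]
      positivity
    have hxn' : |x j| ≤ l ^ n := by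
      rw [abs_div, abs_of_pos hln, not_le, div_lt_one hln] at hxn
      exact hxn.le
    have hxbox : x ∈ box := ⟨hxb, hxn', by
      rw [mem_ball_zero_iff] at hxb
      exact abs_le.1 ((PiLp.norm_apply_le x i).trans hxb.le)⟩
    have e2 : |z (R x) * (ψ x - ψ (R x))| ≤ 2 * L * l ^ n := by
      rw [abs_mul, abs_of_nonneg (hz.mem _).1]
      have h3 : |ψ x - ψ (R x)| ≤ L * (2 * |x j|) := by
        rw [← norm_sub_coordReflection, ← Real.norm_eq_abs]
        exact hL.norm_sub_le _ _
      calc z (R x) * |ψ x - ψ (R x)| ≤ 1 * (L * (2 * |x j|)) :=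
            mul_le_mul (hz.mem _).2 h3 (abs_nonneg _) zero_le_one
        _ ≤ 1 * (L * (2 * l ^ n)) := by gcongr
        _ = _ := by ring
    have e1 : D * |(z x - z (R x)) * ψ x| ≤ (slab l i j n).indicator (fun _ => D * M) x := by
      by_cases hzz : z (R x) = z x
      · rw [hzz, sub_self, zero_mul, abs_zero, mul_zero]; exact hnn1
      · have he := hz.jump_support x hx hzz
        have hmem : x ∈ slab l i j n :=
          ⟨hxb, hxn', cantorBump_ne_zero_of_le h0 h1 (slab_mono_layer h0 h1 hx hxn') he⟩
        rw [Set.indicator_of_mem hmem, abs_mul]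
        have h4 : |z x - z (R x)| ≤ 1 := by
          have hA := hz.mem x
          have hB := hz.mem (R x)
          rw [abs_le]; constructor <;> linarith
        have h5 : |z x - z (R x)| * |ψ x| ≤ 1 * M :=
          mul_le_mul h4 (hM x) (abs_nonneg _) zero_le_one
        rw [one_mul] at h5
        gcongr
    rw [Set.indicator_of_mem hxbox]
    calc |(z x - z (R x)) * ψ x + z (R x) * (ψ x - ψ (R x))| * |deriv evenCut (x j / l ^ n)|
        ≤ (|(z x - z (R x)) * ψ x| + |z (R x) * (ψ x - ψ (R x))|) * D := by
          gcongr
          · exact abs_add_le _ _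
          · exact hD _
      _ ≤ (|(z x - z (R x)) * ψ x| + 2 * L * l ^ n) * D := by gcongr
      _ = D * |(z x - z (R x)) * ψ x| + D * (2 * L * l ^ n) := by ring
      _ ≤ _ := by gcongr
  have hsfin : volume (slab l i j n) ≠ ⊤ := (hsv.trans_lt ENNReal.ofReal_lt_top).ne
  have hbfin : volume box ≠ ⊤ := (hboxv.trans_lt ENNReal.ofReal_lt_top).ne
  have i1 : Integrable ((slab l i j n).indicator fun _ => D * M) :=
    (integrable_indicator_iff (measurableSet_slab n)).2 (integrableOn_const hsfin)
  have i2 : Integrable (box.indicator fun _ => D * (2 * L * l ^ n)) :=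
    (integrable_indicator_iff hboxm).2 (integrableOn_const hbfin)
  have hfin := norm_integral_le_of_norm_le (i1.add i2) hpt
  rw [integral_add hGi hGRi, hGR, integral_add' i1 i2,
    integral_indicator_const _ (measurableSet_slab n), integral_indicator_const _ hboxm,
    smul_eq_mul, smul_eq_mul, Real.norm_eq_abs] at hfin
  have r1 : volume.real (slab l i j n) ≤ 2 ^ N * (2 * l ^ 2) ^ n :=
    ENNReal.toReal_le_of_le_ofReal (by positivity) hsv
  have r2 : volume.real box ≤ 2 * 2 ^ N * l ^ n :=
    ENNReal.toReal_le_of_le_ofReal (by positivity) hboxv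
  have hG2 : |∫ x, G x| ≤ |(∫ x, G x) + ∫ x, G x| := by
    rw [← two_mul, abs_mul, abs_two]; linarith [abs_nonneg (∫ x, G x)]
  refine hG2.trans (hfin.trans ?_)
  have s1 : volume.real (slab l i j n) * (D * M) ≤ 2 ^ N * (2 * l ^ 2) ^ n * (D * M) := by gcongr
  have s2 : volume.real box * (D * (2 * L * l ^ n)) ≤
    2 * 2 ^ N * l ^ n * (D * (2 * L * l ^ n)) := by gcongr
  have t1 : 0 ≤ D * M * 2 ^ N * (l ^ n) ^ 2 := by positivity
  have t2 : 0 ≤ D * (2 * L) * (2 * 2 ^ N) * (2 * l ^ 2) ^ n := by positivity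
  nlinarith

lemma IsLayered.integral_mul_fderiv (hij : i ≠ j) (h0 : 0 < l) (h1 : l < 1 / 2) {Γ : ℝ}
    {z : Euc N → ℝ} (hz : IsLayered l i j Γ z) (hΓ0 : 0 ≤ Γ) (hΓ : Γ ≤ l⁻¹) {ψ : Euc N → ℝ}
    (hψ : ContDiff ℝ (⊤ : ℕ∞) ψ) (hc : HasCompactSupport ψ) (hs : tsupport ψ ⊆ Metric.ball 0 1)
    (v : Euc N) :
    Integrable (fun x => z x * fderiv ℝ ψ x v) ∧ Integrable (fun x => fderiv ℝ z x v * ψ x) ∧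
      ∫ x, z x * fderiv ℝ ψ x v = -∫ x, fderiv ℝ z x v * ψ x := by
  have hzb : ∀ᵐ x, ‖z x‖ ≤ 1 := Eventually.of_forall fun x => by
    rw [Real.norm_of_nonneg (hz.mem x).1]; exact (hz.mem x).2
  have hdψc : Continuous fun x => fderiv ℝ ψ x v :=
    (hψ.continuous_fderiv (by simp)).clm_apply continuous_const
  have hdψ : Integrable fun x => fderiv ℝ ψ x v :=
    hdψc.integrable_of_hasCompactSupport (hc.fderiv_apply ℝ v)
  have hψi : Integrable ψ := hψ.continuous.integrable_of_hasCompactSupport hc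
  obtain ⟨M, hM⟩ := hc.exists_bound_of_continuous hψ.continuous
  have hi1 : Integrable fun x => z x * fderiv ℝ ψ x v := hdψ.bdd_mul hz.aestronglyMeasurable hzb
  have hzi : IntegrableOn (fun x => fderiv ℝ z x v) (Metric.ball 0 1) :=
    ((ContinuousLinearMap.apply ℝ ℝ v).integrable_comp
      (hz.integrableOn_fderiv hij h0 h1 hΓ0 hΓ))
  have hi2 : Integrable fun x => fderiv ℝ z x v * ψ x := by
    have h2 : IntegrableOn (fun x => fderiv ℝ z x v * ψ x) (Metric.ball 0 1) :=
      hzi.mul_bdd hψ.continuous.aestronglyMeasurable (Eventually.of_forall hM)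
    refine (integrableOn_iff_integrable_of_support_subset fun x hx => hs ?_).1 h2
    exact subset_tsupport _ (fun h => hx (by simp [h]))
  refine ⟨hi1, hi2, ?_⟩
  have hcut : ∀ n : ℕ, ∀ x, ‖planeCut j (l ^ n) x‖ ≤ 1 := fun n x => by
    unfold planeCut
    rw [Real.norm_of_nonneg (evenCut_mem _).1]; exact (evenCut_mem _).2
  have hlim : ∀ᵐ x : Euc N, ∀ᶠ n : ℕ in atTop, planeCut j (l ^ n) x = 1 := by
    filter_upwards [ae_coord_ne_zero j] with x hx
    have ht := tendsto_pow_atTop_nhds_zero_of_lt_one h0.le (by linarith : l < 1)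
    filter_upwards [ht.eventually (gt_mem_nhds (abs_pos.2 hx))] with n hn
    refine evenCut_eq_one ?_
    have hln : 0 < l ^ n := by positivity
    rw [abs_div, abs_of_pos hln, le_div_iff₀ hln, one_mul]
    exact hn.le
  have hzcut : ∀ (n : ℕ) x, ContDiffAt ℝ (⊤ : ℕ∞) (fun x => z x * planeCut j (l ^ n) x) x := by
    intro n x
    by_cases hx : x j = 0
    · refine contDiffAt_const (c := (0 : ℝ)) |>.congr_of_eventuallyEq ?_
      have hcj : Continuous fun x : Euc N => |x j / l ^ n| :=
        ((coord_contDiff j).continuous.div_const _).abs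
      have hmem : {x : Euc N | |x j / l ^ n| < 1 / 2} ∈ 𝓝 x :=
        (isOpen_lt hcj continuous_const).mem_nhds (by
          change |x j / l ^ n| < 1 / 2
          rw [hx]; norm_num)
      filter_upwards [hmem] with y hy
      have : planeCut j (l ^ n) y = 0 := evenCut_eq_zero (le_of_lt hy)
      rw [this, mul_zero]
    · exact (hz.smooth x hx).mul (planeCut_contDiff j _).contDiffAt
  have hcn : ∀ n : ℕ, AEStronglyMeasurable (planeCut j (l ^ n)) (volume : Measure (Euc N)) :=
    fun n => (planeCut_contDiff j _).continuous.aestronglyMeasurable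
  have hdcut : ∀ (n : ℕ), ∀ᵐ x, fderiv ℝ (fun x => z x * planeCut j (l ^ n) x) x v * ψ x =
      planeCut j (l ^ n) x * (fderiv ℝ z x v * ψ x) +
        (v j / l ^ n) * (z x * ψ x * deriv evenCut (x j / l ^ n)) := by
    intro n
    filter_upwards [ae_coord_ne_zero j] with x hx
    rw [fderiv_fun_mul ((hz.smooth x hx).differentiableAt (by simp))
      ((planeCut_contDiff j _).contDiffAt.differentiableAt (by simp))]
    simp only [_root_.add_apply, _root_.smul_apply, smul_eq_mul, fderiv_planeCut]
    ring
  have hgi : ∀ n : ℕ, Integrable fun x => z x * ψ x * deriv evenCut (x j / l ^ n) := by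
    intro n
    have h2 : Integrable fun x => ψ x * deriv evenCut (x j / l ^ n) := by
      refine Continuous.integrable_of_hasCompactSupport ?_ hc.mul_right
      exact hψ.continuous.mul ((evenCut_contDiff.continuous_deriv (by simp)).comp
        ((coord_contDiff j).continuous.div_const _))
    refine (h2.bdd_mul hz.aestronglyMeasurable hzb).congr (Eventually.of_forall fun x => ?_)
    ring
  have hi2n : ∀ n : ℕ, Integrable fun x => planeCut j (l ^ n) x * (fderiv ℝ z x v * ψ x) :=
    fun n => hi2.bdd_mul (hcn n) (Eventually.of_forall (hcut n))
  have hparts : ∀ n : ℕ, ∫ x, planeCut j (l ^ n) x * (z x * fderiv ℝ ψ x v) =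
      -(∫ x, planeCut j (l ^ n) x * (fderiv ℝ z x v * ψ x)) -
        (v j / l ^ n) * ∫ x, z x * ψ x * deriv evenCut (x j / l ^ n) := by
    intro n
    have hrhs : Integrable fun x => fderiv ℝ (fun x => z x * planeCut j (l ^ n) x) x v * ψ x :=
      ((hi2n n).add ((hgi n).const_mul (v j / l ^ n))).congr
        ((hdcut n).mono fun x hx => hx.symm)
    have e := integral_mul_fderiv_eq_neg_fderiv_mul_of_integrable
      (f := fun x => z x * planeCut j (l ^ n) x) (g := ψ) (v := v) (μ := volume) hrhs
      ((hi1.bdd_mul (hcn n) (Eventually.of_forall (hcut n))).congr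
        (Eventually.of_forall fun x => by ring))
      (((hψi.bdd_mul (hcn n) (Eventually.of_forall (hcut n))).bdd_mul
        hz.aestronglyMeasurable hzb).congr (Eventually.of_forall fun x => by ring))
      (fun x _ => (hzcut n x).differentiableAt (by simp))
      (fun x _ => hψ.differentiable (by simp) x)
    rw [integral_congr_ae (hdcut n), integral_add (hi2n n) ((hgi n).const_mul _),
      integral_const_mul] at e
    rw [sub_eq_add_neg, ← neg_add, ← e]
    exact integral_congr_ae (Eventually.of_forall fun x => by ring)
  have hL1 : ∀ {f : Euc N → ℝ}, Integrable f →
      Tendsto (fun n : ℕ => ∫ x, planeCut j (l ^ n) x * f x) atTop (𝓝 (∫ x, f x)) := by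
    intro f hf
    refine tendsto_integral_of_dominated_convergence (fun x => ‖f x‖)
      (fun n => (hcn n).mul hf.aestronglyMeasurable) hf.norm
      (fun n => Eventually.of_forall fun x => ?_) ?_
    · rw [norm_mul]
      exact mul_le_of_le_one_left (norm_nonneg _) (hcut n x)
    · filter_upwards [hlim] with x hx
      refine tendsto_const_nhds.congr' ?_
      filter_upwards [hx] with n hn
      rw [hn, one_mul]
  have hL3 : Tendsto (fun n : ℕ => (v j / l ^ n) *
      ∫ x, z x * ψ x * deriv evenCut (x j / l ^ n)) atTop (𝓝 0) := by
    obtain ⟨K, hK⟩ := hz.exists_integral_cut_le hij h0 h1 hψ hc hs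
    have hb : Tendsto (fun n : ℕ => |v j| * K * ((2 * l) ^ n + l ^ n)) atTop (𝓝 0) := by
      have t1 := tendsto_pow_atTop_nhds_zero_of_lt_one (by positivity : 0 ≤ 2 * l)
        (by linarith : 2 * l < 1)
      have t2 := tendsto_pow_atTop_nhds_zero_of_lt_one h0.le (by linarith : l < 1)
      simpa using (t1.add t2).const_mul (|v j| * K)
    refine squeeze_zero_norm (fun n => ?_) hb
    have hln : 0 < l ^ n := by positivity
    rw [norm_mul, Real.norm_eq_abs, Real.norm_eq_abs, abs_div, abs_of_pos hln]
    calc |v j| / l ^ n * |∫ x, z x * ψ x * deriv evenCut (x j / l ^ n)|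
        ≤ |v j| / l ^ n * (K * ((2 * l ^ 2) ^ n + (l ^ n) ^ 2)) := by gcongr; exact hK n
      _ = _ := by
        rw [show 2 * l ^ 2 = 2 * l * l by ring, mul_pow (2 * l) l n]
        field_simp
  refine tendsto_nhds_unique (hL1 hi1) ?_
  have := (hL1 hi2).neg.sub hL3
  rw [sub_zero] at this
  exact this.congr fun n => (hparts n).symm

end Parts

/-! ### The modulation of the exponent -/

/-- The modulus `log ℓ / ℓ`. -/
def logMod (s : ℝ) : ℝ := log s / s

lemma logMod_antitone {s t : ℝ} (hs : exp 1 ≤ s) (hst : s ≤ t) : logMod t ≤ logMod s :=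
  log_div_self_antitoneOn (show exp 1 ≤ s from hs) (show exp 1 ≤ t from hs.trans hst) hst

lemma one_le_log_of_exp_le {s : ℝ} (hs : exp 1 ≤ s) : 1 ≤ log s := by
  rw [le_log_iff_exp_le ((exp_pos 1).trans_le hs)]; exact hs

lemma one_lt_of_exp_le {s : ℝ} (hs : exp 1 ≤ s) : 1 < s :=
  (by linarith [add_one_le_exp (1 : ℝ)] : (1 : ℝ) < exp 1).trans_le hs

lemma logMod_pos {s : ℝ} (hs : exp 1 ≤ s) : 0 < logMod s :=
  div_pos (by linarith [one_le_log_of_exp_le hs]) (by linarith [one_lt_of_exp_le hs])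

lemma logMod_mul_exp_mono {s t : ℝ} (hs : exp 1 ≤ s) (hst : s ≤ t) :
    logMod s * exp s ≤ logMod t * exp t := by
  have h1 := one_lt_of_exp_le hs
  have hs0 : 0 < s := by linarith
  have ht0 : 0 < t := by linarith
  have h2 : exp s / s ≤ exp t / t := by
    rw [div_le_div_iff₀ hs0 ht0]
    have h3 : exp t = exp s * exp (t - s) := by rw [← exp_add]; congr 1; ring
    rw [h3, mul_assoc]
    refine mul_le_mul_of_nonneg_left ?_ (exp_pos s).le
    nlinarith [add_one_le_exp (t - s)]
  have h4 : log s ≤ log t := log_le_log hs0 hst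
  calc logMod s * exp s = log s * (exp s / s) := by unfold logMod; ring
    _ ≤ log t * (exp t / t) := by
      have := one_le_log_of_exp_le hs
      gcongr
      linarith
    _ = _ := by unfold logMod; ring

lemma logMod_hasDerivAt {s : ℝ} (hs : s ≠ 0) : HasDerivAt logMod ((1 - log s) / s ^ 2) s := by
  have h := (hasDerivAt_log hs).div (hasDerivAt_id s) hs
  refine h.congr_deriv ?_
  simp [hs]

lemma abs_deriv_logMod_le {s : ℝ} (hs : exp 1 ≤ s) : |(1 - log s) / s ^ 2| ≤ logMod s := by
  have h1 := one_lt_of_exp_le hs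
  have h2 := one_le_log_of_exp_le hs
  rw [abs_div, abs_of_nonpos (by linarith), abs_of_nonneg (by positivity), logMod]
  rw [div_le_div_iff₀ (by positivity) (by positivity)]
  nlinarith [mul_nonneg (by linarith : 0 ≤ log s) (by nlinarith : 0 ≤ s * (s - 1))]

lemma tendsto_logMod : Tendsto logMod atTop (𝓝 0) :=
  isLittleO_log_id_atTop.tendsto_div_nhds_zero

section Exponent

variable {N : ℕ} {l : ℝ} {i j : Fin N} {K : ℝ}

/-- A smooth radial cutoff. -/
def radCut {N : ℕ} (a b : ℝ) (x : Euc N) : ℝ := cutoff a b (‖x‖ ^ 2)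

lemma radCut_contDiff (a b : ℝ) : ContDiff ℝ (⊤ : ℕ∞) (radCut a b : Euc N → ℝ) :=
  (cutoff_contDiff a b).comp (contDiff_norm_sq ℝ)

lemma radCut_hasCompactSupport {a b : ℝ} (hab : a < b) (hb : b ≤ 1) :
    HasCompactSupport (radCut a b : Euc N → ℝ) := by
  refine HasCompactSupport.intro (isCompact_closedBall 0 1) fun x hx => ?_
  refine cutoff_eq_zero hab (hb.trans ?_)
  rw [mem_closedBall_zero_iff, not_le] at hx
  nlinarith

/-- The size of the modulation at height `y`. -/
def heightMod (K y : ℝ) : ℝ := if y = 0 then 0 else logMod (K - log y)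

lemma le_sub_log {y : ℝ} (hy : |y| ≤ 1) : K ≤ K - log y := by
  have : log y ≤ 0 := by rw [← log_abs]; exact log_nonpos (abs_nonneg _) hy
  linarith

lemma heightMod_nonneg (hK : exp 1 ≤ K) {y : ℝ} (hy : |y| ≤ 1) : 0 ≤ heightMod K y := by
  unfold heightMod
  split_ifs
  · exact le_rfl
  · exact (logMod_pos (hK.trans (le_sub_log hy))).le

lemma heightMod_le (hK : exp 1 ≤ K) {y : ℝ} (hy : |y| ≤ 1) : heightMod K y ≤ logMod K := by
  unfold heightMod
  split_ifs
  · exact (logMod_pos hK).le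
  · exact logMod_antitone hK (le_sub_log hy)

lemma heightMod_hasDerivAt (hK : exp 1 ≤ K) {y : ℝ} (hy0 : y ≠ 0) (hy : |y| ≤ 1) :
    ∃ D, |D| ≤ logMod (K - log y) / |y| ∧ HasDerivAt (heightMod K) D y := by
  have hs := hK.trans (le_sub_log hy)
  have hs0 : K - log y ≠ 0 := by linarith [one_lt_of_exp_le hs]
  refine ⟨(1 - log (K - log y)) / (K - log y) ^ 2 * (0 - y⁻¹), ?_, ?_⟩
  · rw [abs_mul, zero_sub, abs_neg, abs_inv, div_eq_mul_inv]
    exact mul_le_mul_of_nonneg_right (abs_deriv_logMod_le hs) (inv_nonneg.2 (abs_nonneg _))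
  · have h1 : HasDerivAt (fun y => K - log y) (0 - y⁻¹) y :=
      (hasDerivAt_const y K).sub (hasDerivAt_log hy0)
    have h2 := (logMod_hasDerivAt hs0).comp y h1
    refine h2.congr_of_eventuallyEq ?_
    filter_upwards [isOpen_ne.mem_nhds hy0] with z hz
    exact if_neg hz

lemma heightMod_contDiffAt (hK : exp 1 ≤ K) {y : ℝ} (hy0 : y ≠ 0) (hy : |y| ≤ 1) :
    ContDiffAt ℝ (⊤ : ℕ∞) (heightMod K) y := by
  have hs := hK.trans (le_sub_log hy)
  have hs0 : K - log y ≠ 0 := by linarith [one_lt_of_exp_le hs]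
  have h1 : ContDiffAt ℝ (⊤ : ℕ∞) (fun y => K - log y) y :=
    contDiffAt_const.sub (contDiffAt_id.log hy0)
  have h2 : ContDiffAt ℝ (⊤ : ℕ∞) (fun y => log (K - log y) / (K - log y)) y :=
    (h1.log hs0).div h1 hs0
  refine h2.congr_of_eventuallyEq ?_
  filter_upwards [isOpen_ne.mem_nhds hy0] with z hz
  exact if_neg hz

variable (l i j K) in
/-- The modulation of the exponent: positive where the gradient of `stairFn` lives and negative
where the gradient of `capFn` lives. -/
def expMod (x : Euc N) : ℝ := heightMod K (x j) * (2 * sepFn l i j x - 1) * radCut (7 / 8) 1 x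

lemma sepFn_mem (h0 : 0 < l) (h1 : l < 1 / 2) (x : Euc N) :
    0 ≤ sepFn l i j x ∧ sepFn l i j x ≤ 1 :=
  lift_mem (fun k => cantorBump_mem h0 h1 (k + 2)) x

lemma expMod_eq_zero {x : Euc N} (hx : 1 ≤ ‖x‖) : expMod l i j K x = 0 := by
  rw [expMod, radCut, cutoff_eq_zero (by norm_num) (by nlinarith), mul_zero]

lemma abs_coord_le_one {x : Euc N} (hx : ‖x‖ ≤ 1) (k : Fin N) : |x k| ≤ 1 :=
  (PiLp.norm_apply_le x k).trans hx

lemma abs_expMod_le_heightMod (h0 : 0 < l) (h1 : l < 1 / 2) (hK : exp 1 ≤ K) {x : Euc N}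
    (hx : ‖x‖ ≤ 1) : |expMod l i j K x| ≤ heightMod K (x j) := by
  have hh := heightMod_nonneg hK (abs_coord_le_one hx j)
  have hs := sepFn_mem (i := i) (j := j) h0 h1 x
  rw [expMod, abs_mul, abs_mul, abs_of_nonneg hh, radCut, abs_of_nonneg (cutoff_nonneg _ _ _)]
  have h2 : |2 * sepFn l i j x - 1| ≤ 1 := by rw [abs_le]; constructor <;> linarith
  calc _ ≤ heightMod K (x j) * 1 * 1 := by
        gcongr
        · exact cutoff_nonneg _ _ _
        · exact cutoff_le_one _ _ _
    _ = _ := by ring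

lemma abs_expMod_le (h0 : 0 < l) (h1 : l < 1 / 2) (hK : exp 1 ≤ K) (x : Euc N) :
    |expMod l i j K x| ≤ logMod K := by
  rcases le_total ‖x‖ 1 with hx | hx
  · exact (abs_expMod_le_heightMod h0 h1 hK hx).trans
      (heightMod_le hK (abs_coord_le_one hx j))
  · rw [expMod_eq_zero hx, abs_zero]; exact (logMod_pos hK).le

lemma expMod_eventuallyEq {x : Euc N} (hx : 1 < ‖x‖) : expMod l i j K =ᶠ[𝓝 x] fun _ => 0 := by
  filter_upwards [(isOpen_lt continuous_const continuous_norm).mem_nhds hx] with y hy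
  exact expMod_eq_zero (le_of_lt hy)

lemma expMod_contDiffAt (hK : exp 1 ≤ K) {x : Euc N} (hx : x j ≠ 0 ∨ 1 < ‖x‖) :
    ContDiffAt ℝ (⊤ : ℕ∞) (expMod l i j K) x := by
  rcases lt_or_ge 1 ‖x‖ with h | h
  · exact contDiffAt_const.congr_of_eventuallyEq (expMod_eventuallyEq h)
  · have hx0 := hx.resolve_right (not_lt.2 h)
    have e1 : ContDiffAt ℝ (⊤ : ℕ∞) (fun x : Euc N => heightMod K (x j)) x :=
      ContDiffAt.comp x (f := fun x : Euc N => x j)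
        (heightMod_contDiffAt hK hx0 (abs_coord_le_one h j)) (coord_contDiff j).contDiffAt
    have e2 : ContDiffAt ℝ (⊤ : ℕ∞) (sepFn l i j) x :=
      lift_contDiffAt (fun k => cantorBump_contDiff (k + 2)) hx0
    exact (e1.mul ((contDiffAt_const.mul e2).sub contDiffAt_const)).mul
      (radCut_contDiff _ _).contDiffAt

lemma exists_norm_fderiv_expMod_le (h0 : 0 < l) (h1 : l < 1 / 2) (hK : exp 1 ≤ K) :
    ∃ A, 0 ≤ A ∧ ∀ x : Euc N, x j ≠ 0 → ‖x‖ ≤ 1 →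
      ‖fderiv ℝ (expMod l i j K) x‖ ≤ A * (logMod (K - log |x j|) / |x j|) := by
  obtain ⟨C, hC0, hC⟩ := exists_fderiv_bumps_le (i := i) (j := j) h0 h1 2
  obtain ⟨M, hM⟩ := ((radCut_hasCompactSupport (N := N) (by norm_num : (7 / 8 : ℝ) < 1)
    le_rfl).fderiv ℝ).exists_bound_of_continuous
      ((radCut_contDiff (7 / 8) 1).continuous_fderiv (by simp))
  have hM0 : 0 ≤ M := (norm_nonneg _).trans (hM 0)
  refine ⟨M + (2 * C + 1), by positivity, fun x hx hx1 => ?_⟩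
  have hy1 := abs_coord_le_one hx1 j
  obtain ⟨D, hD, hDd⟩ := heightMod_hasDerivAt hK hx hy1
  have e1 : HasFDerivAt (fun x : Euc N => heightMod K (x j))
      (D • EuclideanSpace.proj (𝕜 := ℝ) j) x :=
    HasDerivAt.comp_hasFDerivAt x (f := fun x : Euc N => x j) hDd (coord_hasFDerivAt j x)
  have e2 : HasFDerivAt (fun x => 2 * sepFn l i j x - 1) ((2 : ℝ) • fderiv ℝ (sepFn l i j) x) x :=
    ((((lift_contDiffAt (fun k => cantorBump_contDiff (k + 2)) hx :
      ContDiffAt ℝ (⊤ : ℕ∞) (sepFn l i j) x).differentiableAt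
        (by simp)).hasFDerivAt.const_mul 2).sub_const 1)
  have e3 : HasFDerivAt (radCut (7 / 8) 1) (fderiv ℝ (radCut (7 / 8) 1) x) x :=
    ((radCut_contDiff (7 / 8) 1).differentiable (by simp) x).hasFDerivAt
  have e : HasFDerivAt (expMod l i j K) _ x := (e1.mul e2).mul e3
  rw [e.fderiv]
  have hG0 : 0 ≤ heightMod K (x j) := heightMod_nonneg hK hy1
  have hGe : heightMod K (x j) = logMod (K - log |x j|) := by
    rw [heightMod, if_neg hx, log_abs]
  rw [← log_abs, ← hGe] at hD
  rw [← hGe]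
  set G := heightMod K (x j)
  have hy0 : 0 < |x j| := abs_pos.2 hx
  have hs := sepFn_mem (i := i) (j := j) h0 h1 x
  have hb2 : ‖2 * sepFn l i j x - 1‖ ≤ 1 := by
    rw [Real.norm_eq_abs, abs_le]; constructor <;> linarith
  have hb3 : ‖(radCut (7 / 8) 1 x : ℝ)‖ ≤ 1 := by
    rw [radCut, Real.norm_of_nonneg (cutoff_nonneg _ _ _)]; exact cutoff_le_one _ _ _
  have hGy : G ≤ G / |x j| := by
    rw [le_div_iff₀ hy0]; exact mul_le_of_le_one_right hG0 hy1
  have hk : ‖fderiv ℝ (sepFn l i j) x‖ ≤ C / |x j| := by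
    refine (hC x hx).trans ?_
    rw [div_eq_mul_inv]
    gcongr
    rw [inv_pow]
    gcongr
    exact le_pow_layerIdx h0 h1 hx hy1
  have n1 : ‖D • (EuclideanSpace.proj (𝕜 := ℝ) j : Euc N →L[ℝ] ℝ)‖ ≤ G / |x j| := by
    rw [norm_smul, Real.norm_eq_abs]
    exact (mul_le_of_le_one_right (abs_nonneg _) (norm_coord_le j)).trans hD
  have n2 : ‖G • ((2 : ℝ) • fderiv ℝ (sepFn l i j) x)‖ ≤ 2 * C * (G / |x j|) := by
    rw [norm_smul, norm_smul, Real.norm_of_nonneg hG0, Real.norm_ofNat]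
    calc G * (2 * ‖fderiv ℝ (sepFn l i j) x‖) ≤ G * (2 * (C / |x j|)) := by gcongr
      _ = _ := by ring
  have n3 : ‖(2 * sepFn l i j x - 1) • (D • (EuclideanSpace.proj (𝕜 := ℝ) j : Euc N →L[ℝ] ℝ))‖ ≤
      G / |x j| := by
    rw [norm_smul]
    exact (mul_le_of_le_one_left (norm_nonneg _) hb2).trans n1
  have n4 : ‖(G * (2 * sepFn l i j x - 1)) • fderiv ℝ (radCut (7 / 8) 1 : Euc N → ℝ) x‖ ≤
      M * (G / |x j|) := by
    rw [norm_smul, norm_mul, Real.norm_of_nonneg hG0]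
    calc G * ‖2 * sepFn l i j x - 1‖ * ‖fderiv ℝ (radCut (7 / 8) 1 : Euc N → ℝ) x‖
        ≤ G * 1 * M := by gcongr; exact hM x
      _ = M * G := by ring
      _ ≤ _ := by gcongr
  refine (norm_add_le _ _).trans ?_
  rw [add_mul]
  refine add_le_add n4 ?_
  rw [norm_smul]
  refine (mul_le_of_le_one_left (norm_nonneg _) hb3).trans ((norm_add_le _ _).trans ?_)
  rw [add_mul, one_mul]
  exact add_le_add n2 n3

lemma abs_expMod_le_logMod (h0 : 0 < l) (h1 : l < 1 / 2) (hK : exp 1 ≤ K) {x : Euc N} {d : ℝ}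
    (hd : 0 < d) (hde : d ≤ exp (-exp 1)) (hx : |x j| ≤ 3 * d) :
    |expMod l i j K x| ≤ logMod (log (1 / d)) := by
  have hL : exp 1 ≤ log (1 / d) := by
    rw [one_div, log_inv]
    have := (log_le_iff_le_exp hd).2 hde
    linarith
  rcases le_total ‖x‖ 1 with hx1 | hx1
  · refine (abs_expMod_le_heightMod h0 h1 hK hx1).trans ?_
    unfold heightMod
    split_ifs with hx0
    · exact (logMod_pos hL).le
    · refine logMod_antitone hL ?_
      have h2 : log |x j| ≤ log (3 * d) := log_le_log (abs_pos.2 hx0) hx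
      rw [log_mul (by norm_num) hd.ne', log_abs] at h2
      have h3 : log 3 ≤ 2 := by
        have := log_le_sub_one_of_pos (by norm_num : (0 : ℝ) < 3)
        linarith
      have h4 : (2 : ℝ) ≤ exp 1 := by linarith [add_one_le_exp (1 : ℝ)]
      rw [one_div, log_inv]
      linarith
  · rw [expMod_eq_zero hx1, abs_zero]; exact (logMod_pos hL).le

lemma exists_expMod_modulus (h0 : 0 < l) (h1 : l < 1 / 2) (hK : exp 1 ≤ K) :
    ∃ A, 0 < A ∧ ∀ x y : Euc N, 0 < dist x y → dist x y ≤ exp (-exp 1) →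
      |expMod l i j K x - expMod l i j K y| ≤ A * logMod (log (1 / dist x y)) := by
  obtain ⟨A, hA0, hA⟩ := exists_norm_fderiv_expMod_le (i := i) (j := j) h0 h1 hK
  refine ⟨A + 2, by positivity, fun x y hd hde => ?_⟩
  set d := dist x y with hdd
  have hL : exp 1 ≤ log (1 / d) := by
    rw [one_div, log_inv]
    have := (log_le_iff_le_exp hd).2 hde
    linarith
  have hm := logMod_pos hL
  have hcoord : ∀ z ∈ Metric.closedBall x d, |x j| - d ≤ |z j| ∧ |z j| ≤ |x j| + d := by
    intro z hz
    have h3 : |z j - x j| ≤ d := by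
      refine (PiLp.norm_apply_le (z - x) j).trans ?_
      rw [← dist_eq_norm]; exact hz
    have h4 := abs_sub_abs_le_abs_sub (z j) (x j)
    have h5 := abs_sub_abs_le_abs_sub (x j) (z j)
    rw [abs_sub_comm (x j)] at h5
    constructor <;> linarith
  have hyb : y ∈ Metric.closedBall x d := by
    rw [Metric.mem_closedBall, dist_comm]
  rcases le_or_gt |x j| (2 * d) with hx | hx
  · have b1 := abs_expMod_le_logMod (i := i) h0 h1 hK hd hde (by linarith : |x j| ≤ 3 * d)
    have b2 := abs_expMod_le_logMod (i := i) h0 h1 hK hd hde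
      (by linarith [(hcoord y hyb).2] : |y j| ≤ 3 * d)
    calc _ ≤ |expMod l i j K x| + |expMod l i j K y| := abs_sub _ _
      _ ≤ 2 * logMod (log (1 / d)) := by linarith
      _ ≤ _ := by gcongr; linarith
  · have hbound : ∀ z ∈ Metric.closedBall x d, ‖fderiv ℝ (expMod l i j K) z‖ ≤
        A * (logMod (log (1 / d)) / d) := by
      intro z hz
      have hzd : d ≤ |z j| := by linarith [(hcoord z hz).1]
      have hz0 : z j ≠ 0 := abs_pos.1 (hd.trans_le hzd)
      rcases lt_or_ge 1 ‖z‖ with hz1 | hz1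
      · rw [(expMod_eventuallyEq hz1).fderiv_eq]
        simp only [fderiv_fun_const, Pi.zero_apply, norm_zero]
        positivity
      · refine (hA z hz0 hz1).trans (mul_le_mul_of_nonneg_left ?_ hA0)
        have hzj1 := abs_coord_le_one hz1 j
        have hs : exp 1 ≤ K - log |z j| := by
          have := log_nonpos (abs_nonneg _) hzj1
          linarith
        have hle : K - log |z j| ≤ K - log d := by
          have := log_le_log hd hzd
          linarith
        have h6 := logMod_mul_exp_mono hs hle
        rw [exp_sub, exp_sub, exp_log (abs_pos.2 hz0), exp_log hd] at h6
        have h7 : logMod (K - log |z j|) / |z j| ≤ logMod (K - log d) / d := by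
          have h8 : exp K * (logMod (K - log |z j|) / |z j|) ≤
              exp K * (logMod (K - log d) / d) := by
            calc _ = logMod (K - log |z j|) * (exp K / |z j|) := by ring
              _ ≤ _ := h6
              _ = _ := by ring
          exact le_of_mul_le_mul_left h8 (exp_pos K)
        refine h7.trans (div_le_div_of_nonneg_right (logMod_antitone hL ?_) hd.le)
        rw [one_div, log_inv]
        linarith [exp_pos 1]
    have hmv := (convex_closedBall x d).norm_image_sub_le_of_norm_fderiv_le (𝕜 := ℝ)
      (f := expMod l i j K) (fun z hz => (expMod_contDiffAt hK (Or.inl (abs_pos.1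
        (hd.trans_le (by linarith [(hcoord z hz).1]))))).differentiableAt (by simp)) hbound
      hyb (Metric.mem_closedBall_self hd.le)
    rw [← dist_eq_norm x y, ← hdd] at hmv
    calc |expMod l i j K x - expMod l i j K y| ≤ A * (logMod (log (1 / d)) / d) * d := hmv
      _ = A * logMod (log (1 / d)) := by field_simp
      _ ≤ _ := by gcongr; linarith

lemma expMod_continuous (h0 : 0 < l) (h1 : l < 1 / 2) (hK : exp 1 ≤ K) :
    Continuous (expMod l i j K : Euc N → ℝ) := by
  obtain ⟨A, hA0, hA⟩ := exists_expMod_modulus (i := i) (j := j) h0 h1 hK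
  rw [continuous_iff_continuousAt]
  intro x
  by_cases hxj : x j = 0
  swap
  · exact (expMod_contDiffAt hK (Or.inl hxj)).continuousAt
  have hlim : Tendsto (fun d : ℝ => A * logMod (log (1 / d))) (𝓝[>] 0) (𝓝 0) := by
    have h3 : Tendsto (fun d : ℝ => log (1 / d)) (𝓝[>] 0) atTop := by
      simp_rw [one_div]
      exact tendsto_log_atTop.comp tendsto_inv_nhdsGT_zero
    simpa using (tendsto_logMod.comp h3).const_mul A
  rw [Metric.continuousAt_iff]
  intro ε hε
  have hev := (hlim.eventually (gt_mem_nhds hε)).and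
    (Ioo_mem_nhdsGT (exp_pos (-exp 1)))
  rw [(nhdsGT_basis (0 : ℝ)).eventually_iff] at hev
  obtain ⟨δ, hδ, hev⟩ := hev
  refine ⟨δ, hδ, fun y hy => ?_⟩
  rcases (dist_nonneg (x := y) (y := x)).eq_or_lt with h | h
  · rw [dist_eq_zero.1 h.symm, dist_self]; exact hε
  · have := hev ⟨h, hy⟩
    exact (hA y x h this.2.2.le).trans_lt this.1

end Exponent

/-! ### Energy estimates -/

section Energy

variable {N : ℕ} {l : ℝ} {i j : Fin N} {K : ℝ}

lemma summable_exp_neg_logMod {L K c : ℝ} (hL : 0 < L) (hK : exp 1 ≤ K) (hc : 4 * L ≤ c) :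
    Summable fun k : ℕ => exp (-(c * k * logMod (K + (k + 1) * L))) := by
  have hs : Summable fun k : ℕ => (L ^ 2)⁻¹ * ((k : ℝ) ^ 2)⁻¹ :=
    (Real.summable_nat_pow_inv.2 one_lt_two).mul_left _
  refine summable_of_isBigO_nat hs (Asymptotics.IsBigO.of_bound 1 ?_)
  filter_upwards [eventually_ge_atTop (⌈(K + L) / L⌉₊ + 1)] with k hk
  have hk1 : (K + L) / L ≤ k :=
    (Nat.le_ceil _).trans (by exact_mod_cast (Nat.le_succ _).trans hk)
  have hk2 : (0 : ℝ) < k := by exact_mod_cast (Nat.succ_pos _).trans_le hk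
  rw [div_le_iff₀ hL] at hk1
  set s := K + (k + 1) * L with hsdef
  have hKs : exp 1 ≤ s := by nlinarith
  have hs2 : s ≤ 2 * (k * L) := by nlinarith
  have hs0 : 0 < s := (exp_pos 1).trans_le hKs
  have hkL : k * L ≤ s := by have := exp_pos 1; nlinarith
  have hlog := one_le_log_of_exp_le hKs
  have h1 : 2 * log s ≤ c * k * logMod s := by
    rw [logMod, ← mul_div_assoc, le_div_iff₀ hs0]
    have : 2 * s ≤ c * k := by nlinarith
    nlinarith
  have h2 : exp (-(c * k * logMod s)) ≤ (s ^ 2)⁻¹ := by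
    calc _ ≤ exp (-(2 * log s)) := exp_le_exp.2 (by linarith)
      _ = (s ^ 2)⁻¹ := by
        rw [exp_neg, two_mul, exp_add, exp_log hs0, sq]
  rw [Real.norm_of_nonneg (exp_pos _).le, one_mul, Real.norm_of_nonneg (by positivity),
    ← mul_inv, ← mul_pow, mul_comm L]
  refine h2.trans ?_
  gcongr

lemma logMod_le_heightMod (h0 : 0 < l) (h1 : l < 1 / 2) (hK : exp 1 ≤ K) {y : ℝ} (hy0 : y ≠ 0)
    (hy : |y| ≤ 1) : logMod (K + (layerIdx l y + 1) * log l⁻¹) ≤ heightMod K y := by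
  rw [heightMod, if_neg hy0]
  refine logMod_antitone (hK.trans (le_sub_log hy)) ?_
  have h2 := log_le_log (by positivity) (pow_layerIdx_lt h0 h1 hy0).le
  rw [log_pow, log_abs] at h2
  rw [log_inv]
  push_cast at h2
  linarith

lemma IsLayered.lintegral_rpow_lt_top (hij : i ≠ j) (h0 : 0 < l) (h1 : l < 1 / 2)
    (hK : exp 1 ≤ K) {Γ q₀ κ R : ℝ} {z : Euc N → ℝ} (hz : IsLayered l i j Γ z) (hΓ : 1 ≤ Γ)
    (hΓq : 2 * l ^ 2 * Γ ^ q₀ = 1) (hκ0 : 0 ≤ κ) (hκ : 4 * log l⁻¹ ≤ κ * log Γ) (hR : 0 ≤ R)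
    {T : Set (Euc N)} (hT : MeasurableSet T) (hTb : T ⊆ Metric.ball 0 1) {q : Euc N → ℝ}
    (hq0 : ∀ x ∈ T, 0 < q x)
    (hq : ∀ x ∈ T, x j ≠ 0 → fderiv ℝ z x ≠ 0 → q x ≤ q₀ - κ * heightMod K (x j)) :
    ∫⁻ x in T, ENNReal.ofReal ((R * ‖fderiv ℝ z x‖) ^ q x) < ⊤ := by
  obtain ⟨C, hC0, hC⟩ := hz.grad_le
  set M := R * C + 1 with hM
  have hM1 : 1 ≤ M := by have := mul_nonneg hR hC0; linarith
  set B : ℕ → ℝ := fun k => M ^ q₀ * (Γ ^ q₀) ^ k *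
    exp (-(κ * log Γ * k * logMod (K + (k + 1) * log l⁻¹))) with hB
  have hΓ0 : 0 < Γ := by linarith
  have hl : 0 < log l⁻¹ := log_pos ((one_lt_inv₀ h0).2 (by linarith))
  have hmain : ∫⁻ x in Metric.ball 0 1,
      T.indicator (fun x => ENNReal.ofReal ((R * ‖fderiv ℝ z x‖) ^ q x)) x < ⊤ := by
    refine lintegral_layers_lt_top hij h0 h1 (B := B) (fun k => by positivity) ?_ ?_ ?_
    · refine ((summable_exp_neg_logMod hl hK hκ).mul_left (M ^ q₀)).congr fun k => ?_
      have : (Γ ^ q₀) ^ k * (2 * l ^ 2) ^ k = 1 := by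
        rw [← mul_pow, mul_comm, hΓq, one_pow]
      simp only [hB]
      linear_combination (-(M ^ q₀ * exp (-(κ * log Γ * k * logMod (K + (k + 1) * log l⁻¹))))) *
        this
    · intro x hx hxj
      by_cases hxT : x ∈ T
      swap
      · rw [Set.indicator_of_notMem hxT]; exact zero_le
      rw [Set.indicator_of_mem hxT]
      by_cases hd : fderiv ℝ z x = 0
      · rw [hd, norm_zero, mul_zero, zero_rpow (hq0 x hxT).ne', ENNReal.ofReal_zero]
        exact zero_le
      refine ENNReal.ofReal_le_ofReal ?_
      have hx1 : |x j| ≤ 1 := abs_coord_le_one (mem_ball_zero_iff.1 hx).le j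
      set k := layerIdx l (x j)
      have hΓk : 1 ≤ Γ ^ k := one_le_pow₀ hΓ
      have hb : R * ‖fderiv ℝ z x‖ ≤ M * Γ ^ k := by
        have := hC x hxj
        calc _ ≤ R * (C * Γ ^ k) := by gcongr
          _ ≤ _ := by rw [hM]; nlinarith
      have hh := heightMod_nonneg hK hx1
      have hlh : logMod (K + (k + 1) * log l⁻¹) ≤ heightMod K (x j) :=
        logMod_le_heightMod h0 h1 hK hxj hx1
      have hlΓ : 0 ≤ log Γ := log_nonneg hΓ
      calc _ ≤ (M * Γ ^ k) ^ q x := by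
            have := (hq0 x hxT).le
            gcongr
        _ ≤ (M * Γ ^ k) ^ (q₀ - κ * heightMod K (x j)) :=
            rpow_le_rpow_of_exponent_le (by nlinarith) (hq x hxT hxj hd)
        _ = M ^ (q₀ - κ * heightMod K (x j)) * (Γ ^ k) ^ (q₀ - κ * heightMod K (x j)) :=
            mul_rpow (by linarith) (by linarith)
        _ ≤ M ^ q₀ * (Γ ^ k) ^ (q₀ - κ * heightMod K (x j)) := by
            gcongr
            · have := mul_nonneg hκ0 hh; linarith
        _ = M ^ q₀ * ((Γ ^ q₀) ^ k * exp (-(κ * log Γ * k * heightMod K (x j)))) := by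
            rw [rpow_sub (by positivity), ← rpow_natCast, ← rpow_mul hΓ0.le, ← rpow_mul hΓ0.le,
              mul_comm (k : ℝ) q₀, rpow_mul hΓ0.le, rpow_natCast, div_eq_mul_inv, ← rpow_neg hΓ0.le,
              rpow_def_of_pos hΓ0 (-_)]
            congr 3
            ring
        _ ≤ M ^ q₀ * ((Γ ^ q₀) ^ k *
              exp (-(κ * log Γ * k * logMod (K + (k + 1) * log l⁻¹)))) := by
            gcongr
        _ = _ := by simp only [hB]; ring
    · intro x hx hxj hb
      by_cases hxT : x ∈ T
      swap
      · rw [Set.indicator_of_notMem hxT]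
      have hd : fderiv ℝ z x = 0 := by
        by_contra hd
        exact hz.grad_support x hxj hd hb
      rw [Set.indicator_of_mem hxT, hd, norm_zero, mul_zero, zero_rpow (hq0 x hxT).ne',
        ENNReal.ofReal_zero]
  rwa [setLIntegral_indicator hT, Set.inter_eq_left.2 hTb] at hmain

end Energy

/-! ### The Jacobian bracket -/

section Bracket

variable {N : ℕ} {l : ℝ} {i j : Fin N}

/-- The bracket `∂ᵢa ∂ⱼb - ∂ⱼa ∂ᵢb`. -/
def bracket (i j : Fin N) (a b : Euc N → ℝ) (x : Euc N) : ℝ :=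
  fderiv ℝ a x (EuclideanSpace.single i 1) * fderiv ℝ b x (EuclideanSpace.single j 1) -
    fderiv ℝ a x (EuclideanSpace.single j 1) * fderiv ℝ b x (EuclideanSpace.single i 1)

lemma IsLayered.integral_bracket (hij : i ≠ j) (h0 : 0 < l) (h1 : l < 1 / 2) {Γ : ℝ}
    {z : Euc N → ℝ} (hz : IsLayered l i j Γ z) (hΓ0 : 0 ≤ Γ) (hΓ : Γ ≤ l⁻¹) {ψ : Euc N → ℝ}
    (hψ : ContDiff ℝ (⊤ : ℕ∞) ψ) (hc : HasCompactSupport ψ) (hs : tsupport ψ ⊆ Metric.ball 0 1) :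
    Integrable (bracket i j z ψ) ∧ ∫ x, bracket i j z ψ x = 0 := by
  have key : ∀ v w : Euc N, Integrable (fun x => fderiv ℝ z x v * fderiv ℝ ψ x w) ∧
      ∫ x, z x * fderiv ℝ (fun x => fderiv ℝ ψ x w) x v =
        -∫ x, fderiv ℝ z x v * fderiv ℝ ψ x w := fun v w =>
    (hz.integral_mul_fderiv hij h0 h1 hΓ0 hΓ (ψ := fun x => fderiv ℝ ψ x w)
      ((hψ.fderiv_right (by simp)).clm_apply contDiff_const) (hc.fderiv_apply ℝ w)
      ((tsupport_fderiv_apply_subset ℝ w).trans hs) v).2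
  have h2 : (2 : WithTop ℕ∞) ≤ ((⊤ : ℕ∞) : WithTop ℕ∞) := by
    exact WithTop.coe_le_coe.2 (le_top : (2 : ℕ∞) ≤ ⊤)
  have hsymm : ∀ v w x, fderiv ℝ (fun x => fderiv ℝ ψ x w) x v =
      fderiv ℝ (fun x => fderiv ℝ ψ x v) x w := by
    intro v w x
    have hd : DifferentiableAt ℝ (fderiv ℝ ψ) x :=
      (hψ.fderiv_right (m := (⊤ : ℕ∞)) (by simp)).differentiable (by simp) x
    rw [fderiv_clm_apply hd (differentiableAt_const w), fderiv_clm_apply hd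
      (differentiableAt_const v)]
    simpa using (hψ.contDiffAt.isSymmSndFDerivAt (by simpa using h2)) v w
  obtain ⟨hi1, he1⟩ := key (EuclideanSpace.single i 1) (EuclideanSpace.single j 1)
  obtain ⟨hi2, he2⟩ := key (EuclideanSpace.single j 1) (EuclideanSpace.single i 1)
  refine ⟨hi1.sub hi2, ?_⟩
  unfold bracket
  rw [integral_sub hi1 hi2, ← neg_inj, neg_sub, sub_eq_add_neg, ← he1]
  simp_rw [hsymm]
  rw [he2]
  ring

/-- A one-dimensional even cutoff. -/
def coordCut (t : ℝ) : ℝ := cutoff (1 / 16) (1 / 4) (t ^ 2)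

lemma coordCut_contDiff : ContDiff ℝ (⊤ : ℕ∞) coordCut :=
  (cutoff_contDiff _ _).comp (contDiff_id.pow 2)

lemma coordCut_eq_one {t : ℝ} (h : |t| ≤ 1 / 4) : coordCut t = 1 :=
  cutoff_eq_one (by norm_num) (by rw [← sq_abs]; nlinarith [abs_nonneg t])

lemma coordCut_nonneg (t : ℝ) : 0 ≤ coordCut t := cutoff_nonneg _ _ _

lemma coordCut_le_one (t : ℝ) : coordCut t ≤ 1 := cutoff_le_one _ _ _

lemma coordCut_eq_zero {t : ℝ} (h : 1 / 2 ≤ |t|) : coordCut t = 0 :=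
  cutoff_eq_zero (by norm_num) (by rw [← sq_abs]; nlinarith)

lemma deriv_coordCut_eq_zero {t : ℝ} (h : |t| ≤ 1 / 4) : deriv coordCut t = 0 := by
  refine deriv_eq_zero_of_forall_le fun y => ?_
  rw [coordCut_eq_one h]
  exact coordCut_le_one y

lemma deriv_coordCut_eq_zero_of_ge {t : ℝ} (h : 1 / 2 ≤ |t|) : deriv coordCut t = 0 := by
  refine deriv_eq_zero_of_forall_ge fun y => ?_
  rw [coordCut_eq_zero h]
  exact coordCut_nonneg y

lemma deriv_coordCut_nonpos {t : ℝ} (h : 0 ≤ t) : deriv coordCut t ≤ 0 := by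
  have h1 : HasDerivAt (cutoff (1 / 16) (1 / 4)) (deriv (cutoff (1 / 16) (1 / 4)) (t ^ 2)) (t ^ 2) :=
    ((cutoff_contDiff _ _).differentiable (by simp) _).hasDerivAt
  have h2 : HasDerivAt coordCut _ t := HasDerivAt.comp t (h := fun t : ℝ => t ^ 2) h1 (hasDerivAt_pow 2 t)
  rw [h2.deriv]
  exact mul_nonpos_of_nonpos_of_nonneg (cutoff_antitone (by norm_num)).deriv_nonpos
    (by simpa using h)

lemma exists_deriv_coordCut_neg : ∃ t, 0 < t ∧ deriv coordCut t < 0 := by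
  obtain ⟨t, ht, h⟩ := exists_deriv_eq_slope coordCut (by norm_num : (1 / 4 : ℝ) < 1 / 2)
    coordCut_contDiff.continuous.continuousOn (coordCut_contDiff.differentiable (by simp)).differentiableOn
  refine ⟨t, by linarith [ht.1], ?_⟩
  rw [h, coordCut_eq_one (t := 1 / 4) (by norm_num [abs_of_pos]),
    coordCut_eq_zero (t := 1 / 2) (by norm_num [abs_of_pos])]
  norm_num

variable (i j) in
/-- A cutoff in the coordinates other than `i` and `j`. -/
def restCut (x : Euc N) : ℝ := cutoff (1 / 16) (1 / 4) (‖x‖ ^ 2 - x i ^ 2 - x j ^ 2)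

lemma restCut_contDiff : ContDiff ℝ (⊤ : ℕ∞) (restCut i j : Euc N → ℝ) :=
  (cutoff_contDiff _ _).comp (((contDiff_norm_sq ℝ).sub ((coord_contDiff i).pow 2)).sub
    ((coord_contDiff j).pow 2))

lemma fderiv_restCut (hij : i ≠ j) (x : Euc N) :
    fderiv ℝ (restCut i j) x (EuclideanSpace.single i 1) = 0 ∧
      fderiv ℝ (restCut i j) x (EuclideanSpace.single j 1) = 0 := by
  have h1 : HasFDerivAt (fun x : Euc N => ‖x‖ ^ 2 - x i ^ 2 - x j ^ 2) _ x :=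
    ((hasStrictFDerivAt_norm_sq x).hasFDerivAt.sub ((coord_hasFDerivAt i x).pow 2)).sub
      ((coord_hasFDerivAt j x).pow 2)
  have h2 : HasFDerivAt (restCut i j) _ x := HasDerivAt.comp_hasFDerivAt x
    (f := fun x : Euc N => ‖x‖ ^ 2 - x i ^ 2 - x j ^ 2)
    ((cutoff_contDiff (1 / 16) (1 / 4)).differentiable (by simp) _).hasDerivAt h1
  rw [h2.fderiv]
  constructor <;> simp [hij, hij.symm, EuclideanSpace.inner_single_right]

variable (i j) in
/-- The test function used to detect the bracket of `halfFn` and `stairFn`. -/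
def testCut (x : Euc N) : ℝ := coordCut (x i) * coordCut (x j) * restCut i j x

lemma testCut_contDiff : ContDiff ℝ (⊤ : ℕ∞) (testCut i j : Euc N → ℝ) :=
  ((coordCut_contDiff.comp (coord_contDiff i)).mul (coordCut_contDiff.comp (coord_contDiff j))).mul
    restCut_contDiff

lemma restCut_mem (x : Euc N) : 0 ≤ restCut i j x ∧ restCut i j x ≤ 1 :=
  ⟨cutoff_nonneg _ _ _, cutoff_le_one _ _ _⟩

lemma testCut_mem (x : Euc N) : 0 ≤ testCut i j x ∧ testCut i j x ≤ 1 := by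
  have h1 := coordCut_nonneg (x i)
  have h2 := coordCut_nonneg (x j)
  have h3 := (restCut_mem (i := i) (j := j) x)
  exact ⟨mul_nonneg (mul_nonneg h1 h2) h3.1, mul_le_one₀ (mul_le_one₀ (coordCut_le_one _) h2
    (coordCut_le_one _)) h3.1 h3.2⟩

lemma tsupport_testCut : tsupport (testCut i j : Euc N → ℝ) ⊆ {x | ‖x‖ ^ 2 ≤ 3 / 4} := by
  refine closure_minimal (fun x hx => ?_) (isClosed_le (by fun_prop) continuous_const)
  have h := (Function.mem_support.1 hx)
  have h1 := (cutoff_ne_zero_iff (by norm_num)).1 (left_ne_zero_of_mul (left_ne_zero_of_mul h))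
  have h2 := (cutoff_ne_zero_iff (by norm_num)).1 (right_ne_zero_of_mul (left_ne_zero_of_mul h))
  have h3 := (cutoff_ne_zero_iff (by norm_num)).1 (right_ne_zero_of_mul h)
  change ‖x‖ ^ 2 ≤ 3 / 4
  linarith

lemma testCut_hasCompactSupport : HasCompactSupport (testCut i j : Euc N → ℝ) := by
  refine (isCompact_closedBall (0 : Euc N) 1).of_isClosed_subset (isClosed_tsupport _)
    (tsupport_testCut.trans fun x hx => ?_)
  rw [mem_closedBall_zero_iff]
  change ‖x‖ ^ 2 ≤ 3 / 4 at hx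
  nlinarith [norm_nonneg x]

lemma fderiv_testCut (hij : i ≠ j) (x : Euc N) :
    fderiv ℝ (testCut i j) x (EuclideanSpace.single i 1) =
        deriv coordCut (x i) * coordCut (x j) * restCut i j x ∧
      fderiv ℝ (testCut i j) x (EuclideanSpace.single j 1) =
        coordCut (x i) * deriv coordCut (x j) * restCut i j x := by
  have hc : ∀ k : Fin N, HasFDerivAt (fun x : Euc N => coordCut (x k))
      (deriv coordCut (x k) • EuclideanSpace.proj (𝕜 := ℝ) k) x := fun k =>
    HasDerivAt.comp_hasFDerivAt x (f := fun x : Euc N => x k)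
      (coordCut_contDiff.differentiable (by simp) _).hasDerivAt (coord_hasFDerivAt k x)
  have h : HasFDerivAt (testCut i j) _ x := ((hc i).mul (hc j)).mul
    (restCut_contDiff.differentiable (by simp) x).hasFDerivAt
  rw [h.fderiv]
  obtain ⟨e1, e2⟩ := fderiv_restCut hij x
  constructor <;> simp [hij, hij.symm, e1, e2] <;> ring

lemma IsLayered.bracket_testCut (hij : i ≠ j) (h0 : 0 < l) (h1 : l < 1 / 2) {Γ : ℝ}
    {z : Euc N → ℝ} (hz : IsLayered l i j Γ z) {x : Euc N} (hx : x j ≠ 0) :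
    bracket i j z (testCut i j) x =
      fderiv ℝ z x (EuclideanSpace.single i 1) * (deriv coordCut (x j) * restCut i j x) := by
  rw [bracket, (fderiv_testCut hij x).1, (fderiv_testCut hij x).2]
  by_cases hd : fderiv ℝ z x = 0
  · simp [hd]
  · have h := (cantorBump_support h0 h1 _ (hz.grad_support x hx hd)).le
    rw [deriv_coordCut_eq_zero h, coordCut_eq_one h]
    ring

lemma IsLayered.exists_bracket_testCut_le (hij : i ≠ j) (h0 : 0 < l) (h1 : l < 1 / 2) {Γ : ℝ}
    {z : Euc N → ℝ} (hz : IsLayered l i j Γ z) (hΓ0 : 0 ≤ Γ) (hΓ : Γ ≤ l⁻¹) :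
    ∃ C, 0 ≤ C ∧ ∀ x, x j ≠ 0 → |bracket i j z (testCut i j) x| ≤ C := by
  obtain ⟨C, hC0, hC⟩ := hz.grad_le
  obtain ⟨M, hM0, hM⟩ := exists_abs_deriv_le (coordCut_contDiff.of_le (by simp))
    (a := -(1 / 2)) (b := 1 / 2) (fun x hx => deriv_coordCut_eq_zero_of_ge (by
      by_contra hlt
      exact hx (abs_le.1 (not_le.1 hlt).le)))
  refine ⟨C * 4 * M, by positivity, fun x hx => ?_⟩
  rw [hz.bracket_testCut hij h0 h1 hx]
  by_cases hd : deriv coordCut (x j) = 0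
  · rw [hd, zero_mul, mul_zero, abs_zero]; positivity
  have hlo : 1 / 4 < |x j| := by
    by_contra h; exact hd (deriv_coordCut_eq_zero (not_lt.1 h))
  have hhi : |x j| < 1 / 2 := by
    by_contra h; exact hd (deriv_coordCut_eq_zero_of_ge (not_lt.1 h))
  have hk : Γ ^ layerIdx l (x j) ≤ 4 := by
    calc _ ≤ l⁻¹ ^ layerIdx l (x j) := by gcongr
      _ ≤ |x j|⁻¹ := by
        rw [inv_pow]
        gcongr
        exact le_pow_layerIdx h0 h1 hx (by linarith)
      _ ≤ 4 := by
        rw [inv_le_comm₀ (by linarith) (by norm_num)]; linarith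
  have hr := restCut_mem (i := i) (j := j) x
  have e1 : |fderiv ℝ z x (EuclideanSpace.single i 1)| ≤ C * 4 := by
    refine ((fderiv ℝ z x).le_opNorm _).trans ?_
    rw [PiLp.norm_single, norm_one, mul_one]
    exact (hC x hx).trans (by gcongr)
  rw [abs_mul, abs_mul, abs_of_nonneg hr.1]
  have := hM (x j)
  calc _ ≤ C * 4 * (M * 1) := by
        gcongr
        · exact mul_nonneg (abs_nonneg _) hr.1
        · exact hr.1
        · exact hr.2
    _ = _ := by ring

end Bracket

section Sign

variable {N : ℕ} {l : ℝ} {i j : Fin N}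

lemma fderiv_stairFn_single_nonneg (hij : i ≠ j) (h0 : 0 < l) {x : Euc N} (hx : x j ≠ 0) :
    0 ≤ fderiv ℝ (stairFn l i j) x (EuclideanSpace.single i 1) := by
  obtain ⟨θ, d, hθ0, hθ1, -, -, hf⟩ := lift_hasFDerivAt (l := l) (i := i)
    (a := fun k => stairStep l (k + 4)) (fun k => stairStep_contDiff (l := l) (k + 4)) hx
  rw [stairFn, hf.fderiv]
  have h1 := deriv_stairStep_nonneg h0 (layerIdx l (x j) + 4) (x i)
  have h2 := deriv_stairStep_nonneg h0 (layerIdx l (x j) + 1 + 4) (x i)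
  simp only [_root_.add_apply, _root_.smul_apply, PiLp.proj_apply, PiLp.single_apply, smul_eq_mul,
    if_true, if_neg hij.symm, mul_one, mul_zero, add_zero]
  nlinarith [mul_nonneg hθ0 h2, mul_nonneg (by linarith : 0 ≤ 1 - θ) h1]

lemma exists_fderiv_stairFn_single_pos (hij : i ≠ j) (h0 : 0 < l) (h1 : l < 1 / 2) {y : ℝ}
    (hy : y ≠ 0) : ∃ t : ℝ, 0 < fderiv ℝ (stairFn l i j)
      (EuclideanSpace.single i t + EuclideanSpace.single j y) (EuclideanSpace.single i 1) := by
  set c : ℝ → Euc N := fun t => EuclideanSpace.single i t + EuclideanSpace.single j y with hc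
  have hci : ∀ t, c t i = t := fun t => by simp [hc, hij]
  have hcj : ∀ t, c t j = y := fun t => by simp [hc, hij.symm]
  have hcd : ∀ t, HasDerivAt c (EuclideanSpace.single i 1) t := by
    intro t
    have : c = fun t => t • (EuclideanSpace.single i 1 : Euc N) + EuclideanSpace.single j y := by
      funext t
      ext k
      simp [hc]
    rw [this]
    simpa using ((hasDerivAt_id t).smul_const (EuclideanSpace.single i 1 : Euc N)).add_const
      (EuclideanSpace.single j y : Euc N)
  have hd : ∀ t, HasDerivAt (fun t => stairFn l i j (c t))
      (fderiv ℝ (stairFn l i j) (c t) (EuclideanSpace.single i 1)) t := fun t =>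
    (((lift_contDiffAt (fun k => stairStep_contDiff (k + 4)) (by rw [hcj]; exact hy) :
      ContDiffAt ℝ (⊤ : ℕ∞) (stairFn l i j) (c t)).differentiableAt
        (by simp)).hasFDerivAt).comp_hasDerivAt t (hcd t)
  obtain ⟨t, -, ht⟩ := exists_hasDerivAt_eq_slope (fun t => stairFn l i j (c t)) _
    (by norm_num : (-(1 / 4) : ℝ) < 1 / 4) (fun t _ => (hd t).continuousAt.continuousWithinAt)
    (fun t _ => hd t)
  refine ⟨t, ?_⟩
  change 0 < fderiv ℝ (stairFn l i j) (c t) (EuclideanSpace.single i 1)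
  have e1 : stairFn l i j (c (1 / 4)) = 1 := by
    obtain ⟨θ, -, -, e⟩ := lift_eq (l := l) (i := i) (j := j)
      (fun k => stairStep l (k + 4)) (c (1 / 4))
    rw [stairFn, e, hci, stairStep_of_ge h0 h1 _ le_rfl, stairStep_of_ge h0 h1 _ le_rfl]
    ring
  have e2 : stairFn l i j (c (-(1 / 4))) = 0 := by
    obtain ⟨θ, -, -, e⟩ := lift_eq (l := l) (i := i) (j := j)
      (fun k => stairStep l (k + 4)) (c (-(1 / 4)))
    rw [stairFn, e, hci, stairStep_of_le h0 h1 _ le_rfl, stairStep_of_le h0 h1 _ le_rfl]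
    ring
  rw [ht, e1, e2]
  norm_num

lemma IsLayered.continuousAt_fderiv {Γ : ℝ} {z : Euc N → ℝ} (hz : IsLayered l i j Γ z)
    {x : Euc N} (hx : x j ≠ 0) (v : Euc N) : ContinuousAt (fun x => fderiv ℝ z x v) x :=
  (((hz.smooth x hx).fderiv_right (m := 0) (by simp)).continuousAt).clm_apply continuousAt_const

lemma IsLayered.continuousAt_bracket {Γ : ℝ} {z ψ : Euc N → ℝ} (hz : IsLayered l i j Γ z)
    (hψ : ContDiff ℝ (⊤ : ℕ∞) ψ) {x : Euc N} (hx : x j ≠ 0) :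
    ContinuousAt (bracket i j z ψ) x := by
  have h : ∀ v, ContinuousAt (fun x => fderiv ℝ ψ x v) x := fun v =>
    ((hψ.continuous_fderiv (by simp)).clm_apply continuous_const).continuousAt
  exact ((hz.continuousAt_fderiv hx _).mul (h _)).sub ((hz.continuousAt_fderiv hx _).mul (h _))

lemma inv_two_mul_le (h0 : 0 < l) : (2 * l)⁻¹ ≤ l⁻¹ := by
  gcongr; linarith

lemma tsupport_testCut_subset_ball :
    tsupport (testCut i j : Euc N → ℝ) ⊆ Metric.ball 0 1 := by
  intro x hx
  have h : ‖x‖ ^ 2 ≤ 3 / 4 := tsupport_testCut hx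
  rw [mem_ball_zero_iff]
  nlinarith [norm_nonneg x]

lemma IsLayered.integral_bracket_testCut (hij : i ≠ j) (h0 : 0 < l) (h1 : l < 1 / 2) {Γ : ℝ}
    {z : Euc N → ℝ} (hz : IsLayered l i j Γ z) (hΓ0 : 0 ≤ Γ) (hΓ : Γ ≤ l⁻¹) :
    Integrable (bracket i j z (testCut i j)) ∧ ∫ x, bracket i j z (testCut i j) x = 0 :=
  hz.integral_bracket hij h0 h1 hΓ0 hΓ testCut_contDiff testCut_hasCompactSupport
    tsupport_testCut_subset_ball

lemma integral_halfFn_mul_bracket_ne_zero (hij : i ≠ j) (h0 : 0 < l) (h1 : l < 1 / 2) :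
    ∫ x : Euc N, halfFn l i j x * bracket i j (stairFn l i j) (testCut i j) x ≠ 0 := by
  have hu := halfFn_isLayered hij h0 h1
  have hv := stairFn_isLayered hij h0 h1
  have hbi := (hv.integral_bracket_testCut hij h0 h1 (by positivity) (inv_two_mul_le h0)).1
  have hi : Integrable fun x : Euc N =>
      halfFn l i j x * bracket i j (stairFn l i j) (testCut i j) x :=
    hbi.bdd_mul (c := 1) hu.aestronglyMeasurable (Eventually.of_forall fun x => by
      rw [Real.norm_of_nonneg (hu.mem x).1]; exact (hu.mem x).2)
  set f : Euc N → ℝ := fun x =>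
    halfFn l i j x * bracket i j (stairFn l i j) (testCut i j) x with hf
  have hneg : ∀ᵐ x, f x ≤ 0 := by
    filter_upwards [ae_coord_ne_zero j] with x hx
    rcases lt_or_gt_of_ne hx with h | h
    · rw [hf]
      simp [halfFn, not_lt.2 h.le]
    · simp only [hf]
      rw [hv.bracket_testCut hij h0 h1 hx]
      refine mul_nonpos_of_nonneg_of_nonpos (hu.mem x).1
        (mul_nonpos_of_nonneg_of_nonpos (fderiv_stairFn_single_nonneg hij h0 hx)
          (mul_nonpos_of_nonpos_of_nonneg (deriv_coordCut_nonpos h.le) (restCut_mem x).1))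
  intro h
  have hzero : ∀ᵐ x, f x = 0 := by
    have h2 : ∫ x, (-f) x = 0 := by simp only [Pi.neg_apply]; rw [integral_neg, h, neg_zero]
    rw [integral_eq_zero_iff_of_nonneg_ae (hneg.mono fun x hx => by simpa using hx) hi.neg] at h2
    exact h2.mono fun x hx => by simpa using hx
  obtain ⟨y, hy, hyd⟩ := exists_deriv_coordCut_neg
  obtain ⟨t, ht⟩ := exists_fderiv_stairFn_single_pos (l := l) hij h0 h1 hy.ne'
  set x : Euc N := EuclideanSpace.single i t + EuclideanSpace.single j y with hxdef
  have hxi : x i = t := by simp [hxdef, hij]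
  have hxj : x j = y := by simp [hxdef, hij.symm]
  have hx0 : x j ≠ 0 := by rw [hxj]; exact hy.ne'
  have hrest : restCut i j x = 1 := by
    refine cutoff_eq_one (by norm_num) ?_
    have : ‖x‖ ^ 2 = t ^ 2 + y ^ 2 := by
      rw [hxdef, @norm_add_sq_real]
      simp [EuclideanSpace.inner_single_left, hij]
    rw [this, hxi, hxj]
    norm_num
  have hu1 : halfFn l i j x = 1 := by
    rw [halfFn, if_pos (by rw [hxj]; exact hy)]
    exact capFn_eq_one_of_stairFn h0 h1 hx0 fun h => by simp [h] at ht
  have hfx : f x ≠ 0 := by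
    simp only [hf]
    rw [hv.bracket_testCut hij h0 h1 hx0, hu1, hrest, hxj]
    simp [ht.ne', hyd.ne]
  have hcont : ContinuousAt f x :=
    (hu.smooth x hx0).continuousAt.mul (hv.continuousAt_bracket testCut_contDiff hx0)
  have hn := hcont.eventually_ne hfx
  exact (Measure.measure_pos_of_mem_nhds volume hn).ne' (by simpa [ae_iff] using hzero)

lemma integral_stairFn_mul_bracket_ne_zero (hij : i ≠ j) (h0 : 0 < l) (h1 : l < 1 / 2) :
    ∫ x : Euc N, stairFn l i j x * bracket i j (halfFn l i j) (testCut i j) x ≠ 0 := by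
  have hu := halfFn_isLayered hij h0 h1
  have hv := stairFn_isLayered hij h0 h1
  have hl : 0 ≤ l⁻¹ := by positivity
  have hbv := (hv.integral_bracket_testCut hij h0 h1 (by positivity) (inv_two_mul_le h0)).1
  have hbu := (hu.integral_bracket_testCut hij h0 h1 hl le_rfl).1
  have hbuv := ((hu.mul hv hl (by positivity) le_rfl (inv_two_mul_le h0)).integral_bracket_testCut
    hij h0 h1 hl le_rfl).2
  have hiu : Integrable fun x : Euc N =>
      halfFn l i j x * bracket i j (stairFn l i j) (testCut i j) x :=
    hbv.bdd_mul (c := 1) hu.aestronglyMeasurable (Eventually.of_forall fun x => by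
      rw [Real.norm_of_nonneg (hu.mem x).1]; exact (hu.mem x).2)
  have hiv : Integrable fun x : Euc N =>
      stairFn l i j x * bracket i j (halfFn l i j) (testCut i j) x :=
    hbu.bdd_mul (c := 1) hv.aestronglyMeasurable (Eventually.of_forall fun x => by
      rw [Real.norm_of_nonneg (hv.mem x).1]; exact (hv.mem x).2)
  have he : ∫ x, bracket i j (fun x => halfFn l i j x * stairFn l i j x) (testCut i j) x =
      ∫ x, (halfFn l i j x * bracket i j (stairFn l i j) (testCut i j) x +
        stairFn l i j x * bracket i j (halfFn l i j) (testCut i j) x) := by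
    refine integral_congr_ae ?_
    filter_upwards [ae_coord_ne_zero j] with x hx
    have h : fderiv ℝ (fun x => halfFn l i j x * stairFn l i j x) x = _ :=
      fderiv_fun_mul ((hu.smooth x hx).differentiableAt (by simp))
        ((hv.smooth x hx).differentiableAt (by simp))
    simp only [bracket, h, _root_.add_apply, _root_.smul_apply, smul_eq_mul]
    ring
  rw [integral_add hiu hiv, hbuv] at he
  intro h
  rw [h, add_zero] at he
  exact integral_halfFn_mul_bracket_ne_zero hij h0 h1 he.symm

end Sign

/-! ### Non-approximability -/

section Nonapproximation

variable {N : ℕ} {l : ℝ} {i j : Fin N}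

lemma abs_bracket_sub_le {z φ w : Euc N → ℝ} {x : Euc N}
    (h : fderiv ℝ w x = 0 ∨ fderiv ℝ z x = 0) :
    |bracket i j z φ x| ≤ 2 * ‖fderiv ℝ z x‖ * ‖fderiv ℝ φ x - fderiv ℝ w x‖ := by
  set d := fderiv ℝ φ x - fderiv ℝ w x with hd
  have e : bracket i j z φ x =
      fderiv ℝ z x (EuclideanSpace.single i 1) * d (EuclideanSpace.single j 1) -
        fderiv ℝ z x (EuclideanSpace.single j 1) * d (EuclideanSpace.single i 1) := by
    rcases h with h | h <;> simp [bracket, hd, h]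
  have hb : ∀ (f : Euc N →L[ℝ] ℝ) (k : Fin N), |f (EuclideanSpace.single k 1)| ≤ ‖f‖ := by
    intro f k
    refine (f.le_opNorm _).trans ?_
    rw [PiLp.norm_single, norm_one, mul_one]
  rw [e]
  refine (abs_sub _ _).trans ?_
  rw [abs_mul, abs_mul]
  calc _ ≤ ‖fderiv ℝ z x‖ * ‖d‖ + ‖fderiv ℝ z x‖ * ‖d‖ := by
        gcongr <;> exact hb _ _
    _ = _ := by ring

lemma mul_le_rpow_add_rpow {a d p ε : ℝ} (ha : 0 ≤ a) (hd : 0 ≤ d) (hp : 1 < p) (hε : 0 < ε)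
    (hε1 : ε ≤ 1) : 2 * a * d ≤ ε * a ^ (p / (p - 1)) + (2 / ε * d) ^ p := by
  have hc := Real.HolderConjugate.conjExponent hp
  have hq : 1 ≤ p / (p - 1) := by rw [le_div_iff₀ (by linarith)]; linarith
  have h1 := Real.young_inequality_of_nonneg (a := 2 / ε * d) (b := ε * a) (by positivity)
    (by positivity) hc
  have e : 2 / ε * d * (ε * a) = 2 * a * d := by field_simp
  rw [e] at h1
  refine h1.trans ?_
  rw [add_comm]
  refine add_le_add ?_ (div_le_self (by positivity) hp.le)
  refine (div_le_self (by positivity) hq).trans ?_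
  rw [Real.conjExponent, mul_rpow hε.le ha]
  gcongr
  calc ε ^ (p / (p - 1)) ≤ ε ^ (1 : ℝ) := rpow_le_rpow_of_exponent_ge hε hε1 hq
    _ = ε := rpow_one ε

lemma IsLayered.not_tendsto (hij : i ≠ j) (h0 : 0 < l) (h1 : l < 1 / 2) {Γ : ℝ}
    {z w₀ w p : Euc N → ℝ} (hz : IsLayered l i j Γ z) (hΓ0 : 0 ≤ Γ) (hΓ : Γ ≤ l⁻¹)
    (hw₀ : AEStronglyMeasurable w₀) (hw₀1 : ∀ x, ‖w₀ x‖ ≤ 1)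
    (hzw : ∀ x, x j ≠ 0 → fderiv ℝ w₀ x = 0 ∨ fderiv ℝ z x = 0)
    (hne : ∫ x, w₀ x * bracket i j z (testCut i j) x ≠ 0)
    (hw : ∀ x : Euc N, ‖x‖ ^ 2 ≤ 3 / 4 → w =ᶠ[𝓝 x] w₀)
    (hpc : Continuous p) (hp : ∀ x, 1 < p x)
    (hE : ∫⁻ x in {x : Euc N | ‖x‖ ^ 2 ≤ 3 / 4},
      ENNReal.ofReal (‖fderiv ℝ z x‖ ^ (p x / (p x - 1))) < ⊤)
    {U : Set (Euc N)} (hU : IsOpen U) (hbU : Metric.ball 0 1 ⊆ U) {φ : ℕ → Euc N → ℝ}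
    (hφ : ∀ n, ContDiffOn ℝ (⊤ : ℕ∞) (φ n) U)
    (hφ1 : Tendsto (fun n => ∫⁻ x in U, ENNReal.ofReal |φ n x - w x|) atTop (𝓝 0))
    (hφ2 : ∀ lam : ℝ, 0 < lam → Tendsto (fun n => ∫⁻ x in U,
      ENNReal.ofReal ((lam * ‖fderiv ℝ (φ n) x - fderiv ℝ w x‖) ^ p x)) atTop (𝓝 0)) : False := by
  set T : Set (Euc N) := {x : Euc N | ‖x‖ ^ 2 ≤ 3 / 4} with hT
  have hTc : IsClosed T := isClosed_le (by fun_prop) continuous_const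
  have hTb : T ⊆ Metric.ball 0 1 := fun x (hx : ‖x‖ ^ 2 ≤ 3 / 4) => by
    rw [mem_ball_zero_iff]
    nlinarith [norm_nonneg x]
  have hTU := hTb.trans hbU
  set η : Euc N → ℝ := testCut i j with hη
  have hηT : tsupport η ⊆ T := tsupport_testCut
  obtain ⟨C, hC0, hC⟩ := hz.exists_bracket_testCut_le hij h0 h1 hΓ0 hΓ
  set I := ∫ x, w₀ x * bracket i j z η x with hI
  set E := ∫⁻ x in T, ENNReal.ofReal (‖fderiv ℝ z x‖ ^ (p x / (p x - 1))) with hEdef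
  have hwx : ∀ x ∈ T, w x = w₀ x ∧ fderiv ℝ w x = fderiv ℝ w₀ x := fun x hx =>
    ⟨(hw x hx).eq_of_nhds, (hw x hx).fderiv_eq⟩
  have hbz := hz.integral_bracket_testCut hij h0 h1 hΓ0 hΓ
  have hi1 : Integrable fun x => w₀ x * bracket i j z η x :=
    hbz.1.bdd_mul (c := 1) hw₀ (Eventually.of_forall hw₀1)
  have hmain : ∀ ε : ℝ, 0 < ε → ε ≤ 1 → ∀ n, ENNReal.ofReal |I| ≤
      (ENNReal.ofReal C * (∫⁻ x in U, ENNReal.ofReal |φ n x - w x|) +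
        ∫⁻ x in U, ENNReal.ofReal ((2 / ε * ‖fderiv ℝ (φ n) x - fderiv ℝ w x‖) ^ p x)) +
        ENNReal.ofReal ε * E := by
    intro ε hε hε1 n
    set ψ : Euc N → ℝ := fun x => η x * φ n x with hψdef
    have hψs : tsupport ψ ⊆ tsupport η := tsupport_mul_subset_left
    have hψ : ContDiff ℝ (⊤ : ℕ∞) ψ := by
      rw [contDiff_iff_contDiffAt]
      intro x
      by_cases hx : x ∈ tsupport η
      · exact testCut_contDiff.contDiffAt.mul
          ((hφ n).contDiffAt (hU.mem_nhds (hTU (hηT hx))))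
      · refine (contDiffAt_const (c := (0 : ℝ))).congr_of_eventuallyEq ?_
        filter_upwards [(isClosed_tsupport η).isOpen_compl.mem_nhds hx] with y hy
        rw [hψdef]
        simp only
        rw [image_eq_zero_of_notMem_tsupport hy, zero_mul]
    have hbψ := hz.integral_bracket hij h0 h1 hΓ0 hΓ hψ
      (testCut_hasCompactSupport.mul_right) (hψs.trans (hηT.trans hTb))
    have hIe : I = ∫ x in T, (w₀ x * bracket i j z η x - bracket i j z ψ x) := by
      rw [setIntegral_eq_integral_of_forall_compl_eq_zero, integral_sub hi1 hbψ.1, hbψ.2, sub_zero]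
      intro x hx
      have e1 : fderiv ℝ η x = 0 := fderiv_of_notMem_tsupport ℝ fun h => hx (hηT h)
      have e2 : fderiv ℝ ψ x = 0 := fderiv_of_notMem_tsupport ℝ fun h => hx (hηT (hψs h))
      simp [bracket, e1, e2]
    have hpt : ∀ᵐ x ∂volume.restrict T, ‖w₀ x * bracket i j z η x - bracket i j z ψ x‖ₑ ≤
        (ENNReal.ofReal C * ENNReal.ofReal |φ n x - w x| +
          ENNReal.ofReal ((2 / ε * ‖fderiv ℝ (φ n) x - fderiv ℝ w x‖) ^ p x)) +
          ENNReal.ofReal ε * ENNReal.ofReal (‖fderiv ℝ z x‖ ^ (p x / (p x - 1))) := by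
      filter_upwards [ae_restrict_of_ae (ae_coord_ne_zero j), ae_restrict_mem hTc.measurableSet]
        with x hxj hxT
      rw [← ofReal_norm, ← ENNReal.ofReal_mul hC0, ← ENNReal.ofReal_mul hε.le,
        ← ENNReal.ofReal_add (by positivity) (by positivity),
        ← ENNReal.ofReal_add (by positivity) (by positivity)]
      refine ENNReal.ofReal_le_ofReal ?_
      have hd : fderiv ℝ ψ x = η x • fderiv ℝ (φ n) x + φ n x • fderiv ℝ η x :=
        fderiv_fun_mul (testCut_contDiff.differentiable (by simp) x)
          (((hφ n).contDiffAt (hU.mem_nhds (hTU hxT))).differentiableAt (by simp))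
      have hsplit : w₀ x * bracket i j z η x - bracket i j z ψ x =
          -((φ n x - w x) * bracket i j z η x) - η x * bracket i j z (φ n) x := by
        rw [(hwx x hxT).1]
        simp only [bracket, hd, _root_.add_apply, _root_.smul_apply, smul_eq_mul]
        ring
      rw [hsplit, (hwx x hxT).2, Real.norm_eq_abs]
      have hη1 := testCut_mem (i := i) (j := j) x
      have hb := abs_bracket_sub_le (i := i) (j := j) (φ := φ n) (hzw x hxj)
      have hy := mul_le_rpow_add_rpow (norm_nonneg (fderiv ℝ z x))
        (norm_nonneg (fderiv ℝ (φ n) x - fderiv ℝ w₀ x)) (hp x) hε hε1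
      have t1 : |(φ n x - w x) * bracket i j z η x| ≤ C * |φ n x - w x| := by
        rw [abs_mul, mul_comm]
        gcongr
        exact hC x hxj
      have t2 : |η x * bracket i j z (φ n) x| ≤ |bracket i j z (φ n) x| := by
        rw [abs_mul, abs_of_nonneg hη1.1]
        exact mul_le_of_le_one_left (abs_nonneg _) hη1.2
      refine (abs_sub _ _).trans ?_
      rw [abs_neg]
      linarith
    have hm2 : Measurable fun x =>
        ENNReal.ofReal ((2 / ε * ‖fderiv ℝ (φ n) x - fderiv ℝ w x‖) ^ p x) := by
      refine ENNReal.measurable_ofReal.comp (Measurable.pow ?_ hpc.measurable)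
      exact (((measurable_fderiv ℝ (φ n)).sub (measurable_fderiv ℝ w)).norm).const_mul _
    have hm3 : Measurable fun x => ENNReal.ofReal ε *
        ENNReal.ofReal (‖fderiv ℝ z x‖ ^ (p x / (p x - 1))) := by
      refine Measurable.const_mul (ENNReal.measurable_ofReal.comp (Measurable.pow ?_ ?_)) _
      · exact (measurable_fderiv ℝ z).norm
      · exact hpc.measurable.div (hpc.measurable.sub_const 1)
    calc ENNReal.ofReal |I| = ‖I‖ₑ := by rw [← Real.norm_eq_abs, ofReal_norm]
      _ ≤ ∫⁻ x in T, ‖w₀ x * bracket i j z η x - bracket i j z ψ x‖ₑ := by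
        rw [hIe]; exact enorm_integral_le_lintegral_enorm _
      _ ≤ _ := lintegral_mono_ae hpt
      _ = (ENNReal.ofReal C * (∫⁻ x in T, ENNReal.ofReal |φ n x - w x|) +
        ∫⁻ x in T, ENNReal.ofReal ((2 / ε * ‖fderiv ℝ (φ n) x - fderiv ℝ w x‖) ^ p x)) +
        ENNReal.ofReal ε * E := by
        rw [lintegral_add_right _ hm3, lintegral_add_right _ hm2,
          lintegral_const_mul' _ _ ENNReal.ofReal_ne_top,
          lintegral_const_mul' _ _ ENNReal.ofReal_ne_top]
      _ ≤ _ := by gcongr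
  have hlim : ∀ ε : ℝ, 0 < ε → ε ≤ 1 → ENNReal.ofReal |I| ≤ ENNReal.ofReal ε * E := by
    intro ε hε hε1
    have ht := ((ENNReal.Tendsto.const_mul (a := ENNReal.ofReal C) hφ1
      (Or.inr ENNReal.ofReal_ne_top)).add (hφ2 (2 / ε) (by positivity))).add_const
        (ENNReal.ofReal ε * E)
    rw [mul_zero, zero_add, zero_add] at ht
    exact ge_of_tendsto' ht (hmain ε hε hε1)
  have ht : Tendsto (fun ε : ℝ => ENNReal.ofReal ε * E) (𝓝[>] 0) (𝓝 0) := by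
    have h2 : Tendsto (fun ε : ℝ => ENNReal.ofReal ε) (𝓝[>] 0) (𝓝 0) := by
      simpa using (ENNReal.continuous_ofReal.tendsto 0).mono_left nhdsWithin_le_nhds
    simpa using ENNReal.Tendsto.mul_const h2 (Or.inr hE.ne)
  have hle : ENNReal.ofReal |I| ≤ 0 := by
    refine ge_of_tendsto ht ?_
    filter_upwards [Ioc_mem_nhdsGT (zero_lt_one (α := ℝ))] with ε hε
    exact hlim ε hε.1 hε.2
  rw [nonpos_iff_eq_zero, ENNReal.ofReal_eq_zero] at hle
  exact hne (abs_nonpos_iff.1 hle)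

end Nonapproximation

/-! ### The truncated function and its weak gradient -/

section Truncation

variable {N : ℕ} {l : ℝ} {i j : Fin N}

/-- The truncation of `z` to the unit ball, equal to `z` on a smaller ball. -/
def trunc (z : Euc N → ℝ) (x : Euc N) : ℝ := radCut (4 / 5) (7 / 8) x * z x

lemma trunc_eventuallyEq (z : Euc N → ℝ) {x : Euc N} (hx : ‖x‖ ^ 2 ≤ 3 / 4) :
    trunc z =ᶠ[𝓝 x] z := by
  have h : ∀ᶠ y : Euc N in 𝓝 x, ‖y‖ ^ 2 < 4 / 5 :=
    (continuous_norm.pow 2).continuousAt.eventually (gt_mem_nhds (lt_of_le_of_lt hx (by norm_num)))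
  filter_upwards [h] with y hy
  rw [trunc, radCut, cutoff_eq_one (by norm_num) hy.le, one_mul]

lemma trunc_eventuallyEq_zero (z : Euc N → ℝ) {x : Euc N} (hx : 7 / 8 < ‖x‖ ^ 2) :
    trunc z =ᶠ[𝓝 x] fun _ => 0 := by
  have h : ∀ᶠ y : Euc N in 𝓝 x, 7 / 8 < ‖y‖ ^ 2 :=
    (continuous_norm.pow 2).continuousAt.eventually (lt_mem_nhds hx)
  filter_upwards [h] with y hy
  rw [trunc, radCut, cutoff_eq_zero (by norm_num) hy.le, zero_mul]

lemma fderiv_trunc_eq_zero (z : Euc N → ℝ) {x : Euc N} (hx : 7 / 8 < ‖x‖ ^ 2) :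
    fderiv ℝ (trunc z) x = 0 := by
  rw [(trunc_eventuallyEq_zero z hx).fderiv_eq, fderiv_fun_const, Pi.zero_apply]

lemma trunc_mem {z : Euc N → ℝ} (hz : ∀ x, 0 ≤ z x ∧ z x ≤ 1) (x : Euc N) :
    0 ≤ trunc z x ∧ trunc z x ≤ 1 :=
  ⟨mul_nonneg (cutoff_nonneg _ _ _) (hz x).1,
    mul_le_one₀ (cutoff_le_one _ _ _) (hz x).1 (hz x).2⟩

lemma IsLayered.trunc_contDiffAt {Γ : ℝ} {z : Euc N → ℝ} (hz : IsLayered l i j Γ z) {x : Euc N}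
    (hx : x j ≠ 0 ∨ 1 < ‖x‖) : ContDiffAt ℝ (⊤ : ℕ∞) (trunc z) x := by
  rcases hx with hx | hx
  · exact (radCut_contDiff _ _).contDiffAt.mul (hz.smooth x hx)
  · exact contDiffAt_const.congr_of_eventuallyEq (trunc_eventuallyEq_zero z (by nlinarith))

lemma IsLayered.fderiv_trunc {Γ : ℝ} {z : Euc N → ℝ} (hz : IsLayered l i j Γ z) {x : Euc N}
    (hx : x j ≠ 0) : fderiv ℝ (trunc z) x = (radCut (4 / 5) (7 / 8) x : ℝ) • fderiv ℝ z x +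
      z x • fderiv ℝ (radCut (4 / 5) (7 / 8)) x :=
  fderiv_fun_mul ((radCut_contDiff _ _).differentiable (by simp) x)
    ((hz.smooth x hx).differentiableAt (by simp))

lemma IsLayered.exists_norm_fderiv_trunc_le {Γ : ℝ} {z : Euc N → ℝ} (hz : IsLayered l i j Γ z) :
    ∃ M, 0 ≤ M ∧ ∀ x, x j ≠ 0 → ‖fderiv ℝ (trunc z) x‖ ≤ ‖fderiv ℝ z x‖ + M := by
  have hχ : ContDiff ℝ (⊤ : ℕ∞) (radCut (4 / 5) (7 / 8) : Euc N → ℝ) := radCut_contDiff _ _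
  obtain ⟨M, hM⟩ := ((radCut_hasCompactSupport (N := N) (by norm_num : (4 / 5 : ℝ) < 7 / 8)
    (by norm_num)).fderiv ℝ).exists_bound_of_continuous (hχ.continuous_fderiv (by simp))
  refine ⟨M, (norm_nonneg _).trans (hM 0), fun x hx => ?_⟩
  rw [hz.fderiv_trunc hx]
  refine (norm_add_le _ _).trans ?_
  rw [norm_smul, norm_smul, Real.norm_of_nonneg (hz.mem x).1, radCut,
    Real.norm_of_nonneg (cutoff_nonneg _ _ _)]
  refine add_le_add (mul_le_of_le_one_left (norm_nonneg _) (cutoff_le_one _ _ _)) ?_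
  exact (mul_le_of_le_one_left (norm_nonneg _) (hz.mem x).2).trans (hM x)

lemma IsLayered.integrable_fderiv_trunc (hij : i ≠ j) (h0 : 0 < l) (h1 : l < 1 / 2) {Γ : ℝ}
    {z : Euc N → ℝ} (hz : IsLayered l i j Γ z) (hΓ0 : 0 ≤ Γ) (hΓ : Γ ≤ l⁻¹) :
    Integrable (fderiv ℝ (trunc z)) := by
  obtain ⟨M, hM0, hM⟩ := hz.exists_norm_fderiv_trunc_le
  have h : IntegrableOn (fderiv ℝ (trunc z)) (Metric.ball 0 1) := by
    refine ((hz.integrableOn_fderiv hij h0 h1 hΓ0 hΓ).norm.add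
      (integrableOn_const (C := M) measure_ball_lt_top.ne)).mono'
      (measurable_fderiv ℝ _).aestronglyMeasurable ?_
    filter_upwards [ae_restrict_of_ae (ae_coord_ne_zero j)] with x hx
    exact hM x hx
  refine (integrable_norm_iff (measurable_fderiv ℝ _).aestronglyMeasurable).1
    (IntegrableOn.integrable_of_forall_notMem_eq_zero h.norm fun x hx => ?_)
  rw [mem_ball_zero_iff] at hx
  rw [fderiv_trunc_eq_zero z, norm_zero]
  nlinarith

lemma gradient_apply (f : Euc N → ℝ) (x : Euc N) (k : Fin N) :
    gradient f x k = fderiv ℝ f x (EuclideanSpace.single k 1) := by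
  have h := InnerProductSpace.toDual_symm_apply (𝕜 := ℝ) (x := EuclideanSpace.single k (1 : ℝ))
    (y := fderiv ℝ f x)
  rw [← h, EuclideanSpace.inner_single_right]
  simp [gradient]

lemma norm_gradient_sub (f h : Euc N → ℝ) (x : Euc N) :
    ‖gradient f x - gradient h x‖ = ‖fderiv ℝ f x - fderiv ℝ h x‖ := by
  rw [gradient, gradient, ← map_sub, LinearIsometryEquiv.norm_map]

lemma norm_gradient (f : Euc N → ℝ) (x : Euc N) : ‖gradient f x‖ = ‖fderiv ℝ f x‖ :=
  LinearIsometryEquiv.norm_map _ _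

lemma IsLayered.hasWeakGradOn_trunc (hij : i ≠ j) (h0 : 0 < l) (h1 : l < 1 / 2) {Γ : ℝ}
    {z : Euc N → ℝ} (hz : IsLayered l i j Γ z) (hΓ0 : 0 ≤ Γ) (hΓ : Γ ≤ l⁻¹)
    (hb : Metric.ball 0 1 ⊆ Omg N) : HasWeakGradOn N (trunc z) (gradient (trunc z)) := by
  have hχ : ContDiff ℝ (⊤ : ℕ∞) (radCut (4 / 5) (7 / 8) : Euc N → ℝ) := radCut_contDiff _ _
  have hχ0 : ∀ x : Euc N, x ∉ Metric.ball (0 : Euc N) 1 → 7 / 8 < ‖x‖ ^ 2 := fun x hx => by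
    rw [mem_ball_zero_iff, not_lt] at hx
    nlinarith
  have hgi := hz.integrable_fderiv_trunc hij h0 h1 hΓ0 hΓ
  refine ⟨?_, ?_, fun φ hφ k => ?_⟩
  · refine LocallyIntegrable.locallyIntegrableOn (fun x => ?_) _
    refine ⟨Metric.ball x 1, Metric.ball_mem_nhds x one_pos, ?_⟩
    refine Measure.integrableOn_of_bounded (M := 1) measure_ball_lt_top.ne
      (hχ.continuous.aestronglyMeasurable.mul hz.aestronglyMeasurable) ?_
    refine Eventually.of_forall fun y => ?_
    rw [Real.norm_of_nonneg (trunc_mem hz.mem y).1]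
    exact (trunc_mem hz.mem y).2
  · exact ((InnerProductSpace.toDual ℝ (Euc N)).symm.toContinuousLinearEquiv
      |>.toContinuousLinearMap.integrable_comp hgi).integrableOn
  · set v : Euc N := EuclideanSpace.single k 1 with hv
    simp_rw [gradient_apply, ← hv]
    rw [setIntegral_eq_integral_of_forall_compl_eq_zero,
      setIntegral_eq_integral_of_forall_compl_eq_zero]
    rotate_left
    · intro x hx
      rw [fderiv_trunc_eq_zero z (hχ0 x fun h => hx (hb h)), _root_.zero_apply, zero_mul]
    · intro x hx
      rw [(trunc_eventuallyEq_zero z (hχ0 x fun h => hx (hb h))).eq_of_nhds, zero_mul]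
    have hs : tsupport (fun x => radCut (4 / 5) (7 / 8) x * φ x) ⊆ Metric.ball (0 : Euc N) 1 := by
      refine (tsupport_mul_subset_left).trans fun x hx => ?_
      by_contra hn
      refine absurd hx ?_
      rw [notMem_tsupport_iff_eventuallyEq]
      filter_upwards [(trunc_eventuallyEq_zero (fun _ => 1) (hχ0 x hn))] with y hy
      simpa [trunc] using hy
    obtain ⟨i1, i2, he⟩ := hz.integral_mul_fderiv hij h0 h1 hΓ0 hΓ (hχ.mul hφ.1)
      hφ.2.1.mul_left hs v
    have hd : ∀ x, fderiv ℝ (fun x => radCut (4 / 5) (7 / 8) x * φ x) x v =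
        radCut (4 / 5) (7 / 8) x * fderiv ℝ φ x v +
          φ x * fderiv ℝ (radCut (4 / 5) (7 / 8)) x v := fun x => by
      rw [fderiv_fun_mul (hχ.differentiable (by simp) x) (hφ.1.differentiable (by simp) x)]
      simp
    have hz1 : ∀ᵐ x, ‖z x‖ ≤ 1 := Eventually.of_forall fun x => by
      rw [Real.norm_of_nonneg (hz.mem x).1]; exact (hz.mem x).2
    have i3 : Integrable fun x => z x * (φ x * fderiv ℝ (radCut (4 / 5) (7 / 8)) x v) := by
      refine Integrable.bdd_mul (c := 1) ?_ hz.aestronglyMeasurable hz1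
      exact (hφ.1.continuous.mul ((hχ.continuous_fderiv (by simp)).clm_apply
        continuous_const)).integrable_of_hasCompactSupport hφ.2.1.mul_right
    have e1 : ∫ x, trunc z x * fderiv ℝ φ x v =
        (∫ x, z x * fderiv ℝ (fun x => radCut (4 / 5) (7 / 8) x * φ x) x v) -
          ∫ x, z x * (φ x * fderiv ℝ (radCut (4 / 5) (7 / 8)) x v) := by
      rw [← integral_sub i1 i3]
      refine integral_congr_ae (Eventually.of_forall fun x => ?_)
      simp only [hd, trunc]
      ring
    have e2 : ∫ x, fderiv ℝ (trunc z) x v * φ x =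
        (∫ x, fderiv ℝ z x v * (radCut (4 / 5) (7 / 8) x * φ x)) +
          ∫ x, z x * (φ x * fderiv ℝ (radCut (4 / 5) (7 / 8)) x v) := by
      rw [← integral_add i2 i3]
      refine integral_congr_ae ?_
      filter_upwards [ae_coord_ne_zero j] with x hx
      rw [hz.fderiv_trunc hx]
      simp only [_root_.add_apply, _root_.smul_apply, smul_eq_mul]
      ring
    rw [e1, e2, he]
    ring

lemma rpow_add_le {a b q P : ℝ} (ha : 0 ≤ a) (hb : 0 ≤ b) (hq : 0 ≤ q) (hqP : q ≤ P) :
    (a + b) ^ q ≤ (2 * a) ^ q + (1 + 2 * b) ^ P := by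
  rcases le_total a b with h | h
  · have h1 : (a + b) ^ q ≤ (1 + 2 * b) ^ P :=
      (rpow_le_rpow (by positivity) (by linarith) hq).trans
        (rpow_le_rpow_of_exponent_le (by linarith) hqP)
    have := rpow_nonneg (by positivity : 0 ≤ 2 * a) q
    linarith
  · have h1 : (a + b) ^ q ≤ (2 * a) ^ q := rpow_le_rpow (by positivity) (by linarith) hq
    have := rpow_nonneg (by positivity : 0 ≤ 1 + 2 * b) P
    linarith

end Truncation

/-! ### Choice of the exponents -/

section Exponents

variable {N : ℕ} {i j : Fin N}

lemma exists_ratio {q : ℝ} (hq1 : 1 < q) (hq2 : q < 2) : ∃ l : ℝ, 0 < l ∧ l < 1 / 2 ∧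
    2 * l ^ 2 * l⁻¹ ^ q = 1 ∧ 2 * l ^ 2 * (2 * l)⁻¹ ^ (q / (q - 1)) = 1 := by
  have h2 : 0 < 2 - q := by linarith
  have hq : q - 1 ≠ 0 := by linarith
  set t : ℝ := -(1 / (2 - q)) with ht
  have e1 : t * (2 - q) = -1 := by rw [ht]; field_simp
  have ht1 : t < -1 := by
    rw [ht, neg_lt_neg_iff, lt_div_iff₀ h2]; linarith
  have key : ∀ a b r : ℝ, 1 + 2 * a + b * r = 0 →
      (2 : ℝ) * ((2 : ℝ) ^ a) ^ 2 * ((2 : ℝ) ^ b) ^ r = 1 := fun a b r h => by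
    rw [← rpow_natCast, ← rpow_mul two_pos.le, ← rpow_mul two_pos.le]
    nth_rw 1 [← rpow_one 2]
    rw [← rpow_add two_pos, ← rpow_add two_pos, ← rpow_zero 2]
    congr 1
    push_cast
    linarith
  refine ⟨2 ^ t, by positivity, ?_, ?_, ?_⟩
  · calc (2 : ℝ) ^ t < 2 ^ (-1 : ℝ) := rpow_lt_rpow_of_exponent_lt one_lt_two ht1
      _ = 1 / 2 := by rw [rpow_neg_one]; norm_num
  · rw [← rpow_neg two_pos.le]
    exact key _ _ _ (by linarith)
  · have : (2 * (2 : ℝ) ^ t)⁻¹ = 2 ^ (-(1 + t)) := by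
      rw [rpow_neg two_pos.le (1 + t), rpow_add two_pos, rpow_one]
    rw [this]
    refine key _ _ _ ?_
    field_simp
    linarith

lemma exists_layered_pair (hij : i ≠ j) {pm pp : ℝ} (hpm : 1 < pm) (hpmpp : pm < pp) :
    ∃ (l Γw Γz p₀ s : ℝ) (w₀ z : Euc N → ℝ), 0 < l ∧ l < 1 / 2 ∧ pm < p₀ ∧ p₀ < pp ∧
      IsLayered l i j Γw w₀ ∧ IsLayered l i j Γz z ∧ 1 < Γw ∧ Γw ≤ l⁻¹ ∧ 1 < Γz ∧ Γz ≤ l⁻¹ ∧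
      2 * l ^ 2 * Γw ^ p₀ = 1 ∧ 2 * l ^ 2 * Γz ^ (p₀ / (p₀ - 1)) = 1 ∧ |s| = 1 ∧
      (∀ x, x j ≠ 0 → fderiv ℝ w₀ x ≠ 0 → s * (2 * sepFn l i j x - 1) = -1) ∧
      (∀ x, x j ≠ 0 → fderiv ℝ z x ≠ 0 → s * (2 * sepFn l i j x - 1) = 1) ∧
      ∫ x, w₀ x * bracket i j z (testCut i j) x ≠ 0 := by
  obtain ⟨p₀, hp1, hp2, hp3⟩ : ∃ p₀, pm < p₀ ∧ p₀ < pp ∧ p₀ ≠ 2 := by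
    by_cases h : (pm + pp) / 2 = 2
    · exact ⟨(pm + 2) / 2, by linarith, by linarith, by intro h'; linarith⟩
    · exact ⟨(pm + pp) / 2, by linarith, by linarith, h⟩
  have hg : ∀ l : ℝ, 0 < l → l < 1 / 2 → 1 < l⁻¹ ∧ 1 < (2 * l)⁻¹ := fun l h0 h1 =>
    ⟨(one_lt_inv₀ h0).2 (by linarith), (one_lt_inv₀ (by positivity)).2 (by linarith)⟩
  rcases lt_or_gt_of_ne hp3 with h | h
  · obtain ⟨l, h0, h1, e1, e2⟩ := exists_ratio (hpm.trans hp1) h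
    refine ⟨l, l⁻¹, (2 * l)⁻¹, p₀, 1, halfFn l i j, stairFn l i j, h0, h1, hp1, hp2,
      halfFn_isLayered hij h0 h1, stairFn_isLayered hij h0 h1, (hg l h0 h1).1, le_rfl,
      (hg l h0 h1).2, inv_two_mul_le h0, e1, e2, abs_one, fun x hx hd => ?_, fun x hx hd => ?_,
      integral_halfFn_mul_bracket_ne_zero hij h0 h1⟩
    · rw [sepFn_eq_zero_of_capFn h0 h1 hx (fderiv_capFn_ne_zero_of_halfFn hx hd)]; norm_num
    · rw [sepFn_eq_one_of_stairFn h0 h1 hx hd]; norm_num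
  · have hp : 0 < p₀ - 1 := by linarith
    obtain ⟨l, h0, h1, e1, e2⟩ := exists_ratio (q := p₀ / (p₀ - 1))
      (by rw [lt_div_iff₀ hp]; linarith) (by rw [div_lt_iff₀ hp]; linarith)
    have e3 : p₀ / (p₀ - 1) / (p₀ / (p₀ - 1) - 1) = p₀ := by field_simp; ring
    rw [e3] at e2
    refine ⟨l, (2 * l)⁻¹, l⁻¹, p₀, -1, stairFn l i j, halfFn l i j, h0, h1, hp1, hp2,
      stairFn_isLayered hij h0 h1, halfFn_isLayered hij h0 h1, (hg l h0 h1).2, inv_two_mul_le h0,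
      (hg l h0 h1).1, le_rfl, e2, e1, by norm_num, fun x hx hd => ?_, fun x hx hd => ?_,
      integral_stairFn_mul_bracket_ne_zero hij h0 h1⟩
    · rw [sepFn_eq_one_of_stairFn h0 h1 hx hd]; norm_num
    · rw [sepFn_eq_zero_of_capFn h0 h1 hx (fderiv_capFn_ne_zero_of_halfFn hx hd)]; norm_num

end Exponents

/-- Theorem C (0-form case), non-density `H ≠ W` for the variable exponent
integrand `Φ(x,t) = t^{p(x)}`. -/
theorem statement5 (N : ℕ) (hN : 2 ≤ N) (pm pp : ℝ) (hpm : 1 < pm) (hpmpp : pm < pp) :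
    ∃ (ϰ₀ : ℝ) (p : Euc N → ℝ) (S : Set (Euc N)) (w : Euc N → ℝ) (g : Euc N → Euc N),
      0 < ϰ₀ ∧
      -- the variable exponent
      Continuous p ∧ (∀ x, p x ∈ Set.Icc pm pp) ∧
      (∀ x y : Euc N, 0 < dist x y → dist x y ≤ Real.exp (-Real.exp 1) →
        |p x - p y| ≤ ϰ₀ * (Real.log (1 / dist x y))⁻¹ * Real.log (Real.log (1 / dist x y))) ∧
      -- the singular set, off which p is smooth
      IsCompact S ∧ S ⊆ Omg N ∧ volume S = 0 ∧ ContDiffOn ℝ (⊤ : ℕ∞) p Sᶜ ∧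
      -- the function w with weak gradient g, of finite energy
      (∃ M : ℝ, ∀ x, |w x| ≤ M) ∧ ContDiffOn ℝ (⊤ : ℕ∞) w (Omg N \ S) ∧
      HasWeakGradOn N w g ∧
      IntegrableOn (fun x => ‖g x‖ ^ p x) (Omg N) ∧
      -- non-approximability by smooth functions with energy convergence
      ¬ ∃ φ : ℕ → Euc N → ℝ,
          (∀ j, ContDiffOn ℝ (⊤ : ℕ∞) (φ j) (Omg N)) ∧
          (∀ j, (∫⁻ x in Omg N, ENNReal.ofReal (‖gradient (φ j) x‖ ^ p x)) < ⊤) ∧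
          Tendsto (fun j => ∫⁻ x in Omg N, ENNReal.ofReal |φ j x - w x|) atTop (𝓝 0) ∧
          (∀ lam : ℝ, 0 < lam →
            Tendsto (fun j => ∫⁻ x in Omg N,
                ENNReal.ofReal ((lam * ‖gradient (φ j) x - g x‖) ^ p x))
              atTop (𝓝 0)) := by
  set i : Fin N := ⟨0, by omega⟩ with hi
  set j : Fin N := ⟨1, by omega⟩ with hj
  have hij : i ≠ j := by simp [hi, hj]
  have hR : 1 < √(N : ℝ) := by
    rw [lt_sqrt zero_le_one]
    have : (2 : ℝ) ≤ N := by exact_mod_cast hN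
    linarith
  have hbO : Metric.ball (0 : Euc N) 1 ⊆ Omg N := Metric.ball_subset_ball hR.le
  obtain ⟨l, Γw, Γz, p₀, s, w₀, z, h0, h1, hp₀m, hp₀p, hw, hz, hΓw, hΓwl, hΓz, hΓzl, ew, ez, hs,
    hsw, hsz, hne⟩ := exists_layered_pair hij hpm hpmpp
  have hL : 0 < log l⁻¹ := log_pos (hΓw.trans_le hΓwl)
  have hlw := log_pos hΓw
  have hlz := log_pos hΓz
  have hp₀1 : 0 < p₀ - 1 := by linarith
  have hpp1 : 0 < pp - 1 := by linarith
  set c : ℝ := 1 / ((p₀ - 1) * (pp - 1)) with hc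
  have hc0 : 0 < c := by positivity
  set ϰ : ℝ := 4 * log l⁻¹ / log Γw + 4 * log l⁻¹ / (c * log Γz) with hϰ
  have hϰ0 : 0 < ϰ := by positivity
  have hϰw : 4 * log l⁻¹ ≤ ϰ * log Γw := by
    rw [← div_le_iff₀ hlw, hϰ]
    exact le_add_of_nonneg_right (by positivity)
  have hϰz : 4 * log l⁻¹ ≤ c * ϰ * log Γz := by
    rw [mul_comm c, mul_assoc, ← div_le_iff₀ (by positivity), hϰ]
    exact le_add_of_nonneg_left (by positivity)
  obtain ⟨K, hK, hKm, hKp⟩ : ∃ K, exp 1 ≤ K ∧ ϰ * logMod K < p₀ - pm ∧ ϰ * logMod K < pp - p₀ := by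
    have ht : Tendsto (fun K => ϰ * logMod K) atTop (𝓝 0) := by
      simpa using tendsto_logMod.const_mul ϰ
    exact ((eventually_ge_atTop _).and ((ht.eventually (gt_mem_nhds (by linarith))).and
      (ht.eventually (gt_mem_nhds (by linarith))))).exists
  obtain ⟨A, hA0, hA⟩ := exists_expMod_modulus (i := i) (j := j) h0 h1 hK
  set p : Euc N → ℝ := fun x => p₀ + s * ϰ * expMod l i j K x with hp
  set S : Set (Euc N) := {x | x j = 0} ∩ Metric.closedBall 0 1 with hS
  have hSc : ∀ x, x ∉ S → x j ≠ 0 ∨ 1 < ‖x‖ := fun x hx => by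
    by_contra! h
    exact hx ⟨h.1, mem_closedBall_zero_iff.2 h.2⟩
  have hpc : Continuous p := continuous_const.add (continuous_const.mul (expMod_continuous h0 h1 hK))
  have hpI : ∀ x, p x ∈ Set.Icc pm pp := fun x => by
    have h2 : |s * ϰ * expMod l i j K x| ≤ ϰ * logMod K := by
      rw [abs_mul, abs_mul, hs, one_mul, abs_of_pos hϰ0]
      exact mul_le_mul_of_nonneg_left (abs_expMod_le h0 h1 hK x) hϰ0.le
    have h3 := abs_le.1 h2
    constructor <;> simp only [hp] <;> linarith [h3.1, h3.2]
  have hp1 : ∀ x, 1 < p x := fun x => hpm.trans_le (hpI x).1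
  have hpx : ∀ x : Euc N, ‖x‖ ^ 2 ≤ 7 / 8 →
      p x = p₀ + ϰ * heightMod K (x j) * (s * (2 * sepFn l i j x - 1)) := fun x hx => by
    simp only [hp, expMod]
    rw [radCut, cutoff_eq_one (by norm_num) hx]
    ring
  have hball : ∀ r : ℝ, r < 1 → {x : Euc N | ‖x‖ ^ 2 ≤ r} ⊆ Metric.ball 0 1 := fun r hr x hx => by
    have hx' : ‖x‖ ^ 2 ≤ r := hx
    rw [mem_ball_zero_iff]
    nlinarith [norm_nonneg x]
  have hclosed : ∀ r : ℝ, MeasurableSet {x : Euc N | ‖x‖ ^ 2 ≤ r} := fun r =>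
    (isClosed_le (by fun_prop) continuous_const).measurableSet
  have hEw : ∫⁻ x in {x : Euc N | ‖x‖ ^ 2 ≤ 7 / 8},
      ENNReal.ofReal ((2 * ‖fderiv ℝ w₀ x‖) ^ p x) < ⊤ := by
    refine hw.lintegral_rpow_lt_top hij h0 h1 hK hΓw.le ew hϰ0.le hϰw zero_le_two (hclosed _)
      (hball _ (by norm_num)) (fun x _ => one_pos.trans (hp1 x)) fun x hx hxj hd => ?_
    rw [hpx x hx, hsw x hxj hd]
    linarith
  have hEz : ∫⁻ x in {x : Euc N | ‖x‖ ^ 2 ≤ 3 / 4},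
      ENNReal.ofReal (‖fderiv ℝ z x‖ ^ (p x / (p x - 1))) < ⊤ := by
    have := hz.lintegral_rpow_lt_top (q := fun x => p x / (p x - 1)) (R := 1) hij h0 h1 hK hΓz.le ez
      (by positivity) hϰz zero_le_one (hclosed (3 / 4)) (hball _ (by norm_num))
      (fun x _ => div_pos (one_pos.trans (hp1 x)) (sub_pos.2 (hp1 x))) fun x hx hxj hd => ?_
    · simpa using this
    have hx' : ‖x‖ ^ 2 ≤ 3 / 4 := hx
    have hxb : ‖x‖ ≤ 1 := by nlinarith [norm_nonneg x]
    have e : p x = p₀ + ϰ * heightMod K (x j) := by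
      rw [hpx x (by linarith), hsz x hxj hd, mul_one]
    have hh := heightMod_nonneg hK (abs_coord_le_one hxb j)
    have hpu := (hpI x).2
    have hpl := hp1 x
    set h := ϰ * heightMod K (x j) with hhd
    have hh0 : 0 ≤ h := by positivity
    have e2 : p₀ / (p₀ - 1) - p x / (p x - 1) = 1 / ((p₀ - 1) * (p x - 1)) * h := by
      have : p x - 1 ≠ 0 := by linarith
      field_simp
      rw [e]
      ring
    have e3 : c ≤ 1 / ((p₀ - 1) * (p x - 1)) := by
      rw [hc]
      have : 0 < p x - 1 := by linarith
      gcongr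
    have := mul_le_mul_of_nonneg_right e3 hh0
    have e4 : c * ϰ * heightMod K (x j) = c * h := by rw [hhd]; ring
    rw [e4]
    linarith
  refine ⟨ϰ * A, p, S, trunc w₀, gradient (trunc w₀), by positivity, hpc, hpI, fun x y hd hde => ?_,
    ?_, ?_, ?_, fun x hx => ?_, ⟨1, fun x => ?_⟩, fun x hx => ?_,
    hw.hasWeakGradOn_trunc hij h0 h1 (by linarith) hΓwl hbO, ?_, ?_⟩
  · have e : p x - p y = s * ϰ * (expMod l i j K x - expMod l i j K y) := by simp only [hp]; ring
    rw [e, abs_mul, abs_mul, hs, one_mul, abs_of_pos hϰ0]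
    refine (mul_le_mul_of_nonneg_left (hA x y hd hde) hϰ0.le).trans (le_of_eq ?_)
    rw [logMod]
    ring
  · exact (isCompact_closedBall _ _).inter_left
      (isClosed_eq (coord_contDiff j).continuous continuous_const)
  · exact fun x hx => Metric.closedBall_subset_ball hR hx.2
  · exact measure_mono_null Set.inter_subset_left (volume_coord_eq_zero j)
  · exact (contDiffAt_const.add (contDiffAt_const.mul
      (expMod_contDiffAt hK (hSc x hx)))).contDiffWithinAt
  · rw [abs_of_nonneg (trunc_mem hw.mem x).1]
    exact (trunc_mem hw.mem x).2
  · exact (hw.trunc_contDiffAt (hSc x hx.2)).contDiffWithinAt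
  · simp_rw [norm_gradient]
    obtain ⟨M, hM0, hM⟩ := hw.exists_norm_fderiv_trunc_le
    have hT : ∀ x ∉ {x : Euc N | ‖x‖ ^ 2 ≤ 7 / 8}, ‖fderiv ℝ (trunc w₀) x‖ ^ p x = 0 := fun x hx => by
      rw [fderiv_trunc_eq_zero w₀ (not_le.1 hx), norm_zero, zero_rpow (one_pos.trans (hp1 x)).ne']
    have hmeas : Measurable fun x => ‖fderiv ℝ (trunc w₀) x‖ ^ p x :=
      (measurable_fderiv ℝ _).norm.pow hpc.measurable
    refine Integrable.integrableOn ?_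
    refine IntegrableOn.integrable_of_forall_notMem_eq_zero ?_ hT
    have hI1 : IntegrableOn (fun x => (2 * ‖fderiv ℝ w₀ x‖) ^ p x)
        {x : Euc N | ‖x‖ ^ 2 ≤ 7 / 8} := by
      refine ⟨(((measurable_fderiv ℝ _).norm.const_mul 2).pow
        hpc.measurable).aestronglyMeasurable, ?_⟩
      rw [hasFiniteIntegral_iff_ofReal (Eventually.of_forall fun x => by positivity)]
      exact hEw
    refine (hI1.add (integrableOn_const (C := (1 + 2 * M) ^ pp) (((measure_mono
      (hball _ (by norm_num))).trans_lt measure_ball_lt_top).ne))).mono'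
      hmeas.aestronglyMeasurable ?_
    filter_upwards [ae_restrict_of_ae (ae_coord_ne_zero j)] with x hx
    rw [Real.norm_of_nonneg (by positivity)]
    have hq := (one_pos.trans (hp1 x)).le
    exact (rpow_le_rpow (norm_nonneg _) (hM x hx) hq).trans
      (rpow_add_le (norm_nonneg _) hM0 hq (hpI x).2)
  · rintro ⟨φ, hφ, -, hφ1, hφ2⟩
    simp_rw [norm_gradient_sub] at hφ2
    refine hz.not_tendsto hij h0 h1 (by linarith) hΓzl hw.aestronglyMeasurable (fun x => ?_)
      (fun x hx => ?_) hne (fun x hx => trunc_eventuallyEq w₀ hx) hpc hp1 hEz Metric.isOpen_ball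
      hbO hφ hφ1 hφ2
    · rw [Real.norm_of_nonneg (hw.mem x).1]
      exact (hw.mem x).2
    · by_contra! h
      linarith [hsw x hx h.1, hsz x hx h.2]

end
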